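/- Let k be an odd positive integer such that D := k² + 4 is squarefree. Then the class number of the real quadratic field ℚ(√D) equals 1 if and only if k ∈ {1, 3, 5, 7, 13, 17}. -/

import Mathlib

/-- The order `ℤ[ε]` with `ε ^ 2 = k ε + 1`, of discriminant `k ^ 2 + 4`. -/
abbrev UnitOrder (k : ℤ) := QuadraticAlgebra ℤ 1 k

namespace UnitOrder

open QuadraticAlgebra

variable {k : ℤ}

theorem norm_eq (z : UnitOrder k) : norm z = z.re ^ 2 + k * z.re * z.im - z.im ^ 2 := by
  rw [norm_def]; ring

theorem isUnit_omega : IsUnit (ω : UnitOrder k) := by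
  rw [isUnit_iff_norm_isUnit, norm_eq]
  simp

/-- The lattice points `x + y ε` of norm `n` in the half-open cone spanned by `1` and `ε ^ 2`. -/
def cone (k : ℤ) (n : ℕ) : Set (ℤ × ℤ) :=
  {p | 0 < p.1 ∧ 0 ≤ p.2 ∧ p.2 < k * p.1 ∧ p.1 ^ 2 + k * p.1 * p.2 - p.2 ^ 2 = n}

/-- The classes of associated elements of norm `± n`. -/
def normClasses (k : ℤ) (n : ℕ) : Set (Associates (UnitOrder k)) :=
  {a | ∃ z : UnitOrder k, Associates.mk z = a ∧ (norm z).natAbs = n}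

theorem natAbs_norm_eq_of_associated {z w : UnitOrder k} (h : Associated z w) :
    (norm z).natAbs = (norm w).natAbs :=
  Int.natAbs_eq_iff_associated.mpr (h.map QuadraticAlgebra.norm)

theorem mk_mem_normClasses {z : UnitOrder k} {n : ℕ} :
    Associates.mk z ∈ normClasses k n ↔ (norm z).natAbs = n := by
  constructor
  · rintro ⟨w, hw, rfl⟩
    exact (natAbs_norm_eq_of_associated (Associates.mk_eq_mk_iff_associated.mp hw)).symm
  · exact fun h ↦ ⟨z, rfl, h⟩

theorem exists_cone_of_nonneg (hk : 0 < k) (m : ℕ) :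
    ∀ z : UnitOrder k, 0 < norm z → 0 < z.re → 0 ≤ z.im → z.im.toNat ≤ m →
      ∃ w : UnitOrder k, Associated z w ∧ norm w = norm z ∧ 0 < w.re ∧ 0 ≤ w.im ∧
        w.im < k * w.re := by
  induction m with
  | zero =>
    intro z hn hre him hm
    exact ⟨z, .refl _, rfl, hre, him, by nlinarith [show z.im = 0 by omega]⟩
  | succ m ih =>
    intro z hn hre him hm
    by_cases h : z.im < k * z.re
    · exact ⟨z, .refl _, rfl, hre, him, h⟩
    push Not at h
    rw [norm_eq] at hn
    have hpos : 0 < k * z.re := mul_pos hk hre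
    set z' : UnitOrder k := ⟨z.re - k * (z.im - k * z.re), z.im - k * z.re⟩ with hz'
    have hz : z = z' * ω ^ 2 := by
      rw [sq, omega_mul_omega_eq_mk]
      ext <;> simp [hz'] <;> ring
    have hnz : norm z' = norm z := by
      rw [norm_eq, norm_eq, hz']; ring
    have hass : Associated z z' := by
      rw [hz]; exact (associated_mul_unit_left _ _ (isUnit_omega.pow 2))
    obtain ⟨w, h1, h2, h3⟩ := ih z' (by rw [hnz, norm_eq]; exact hn)
      (by
        change 0 < z.re - k * (z.im - k * z.re)
        by_contra! hcon
        nlinarith [sq_nonneg (z.im - k * z.re)]) (by change 0 ≤ z.im - k * z.re; omega)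
      (by change (z.im - k * z.re).toNat ≤ m; omega)
    exact ⟨w, hass.trans h1, h2.trans hnz, h3⟩

theorem exists_cone_of_neg (hk : 0 < k) (m : ℕ) :
    ∀ z : UnitOrder k, 0 < norm z → 0 < z.re + k * z.im → z.im < 0 → (-z.im).toNat ≤ m →
      ∃ w : UnitOrder k, Associated z w ∧ norm w = norm z ∧ 0 < w.re ∧ 0 ≤ w.im ∧
        w.im < k * w.re := by
  induction m with
  | zero => intro z hn hre him hm; omega
  | succ m ih =>
    intro z hn hre him hm
    rw [norm_eq] at hn
    set z' : UnitOrder k := ⟨z.re + k * z.im, z.im + k * (z.re + k * z.im)⟩ with hz'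
    have hz : z' = z * ω ^ 2 := by
      rw [sq, omega_mul_omega_eq_mk]
      ext <;> simp [hz'] <;> ring
    have hnz : norm z' = norm z := by
      rw [norm_eq, norm_eq, hz']; ring
    have hass : Associated z z' := by
      rw [hz]; exact (associated_mul_unit_right _ _ (isUnit_omega.pow 2))
    have hpos : 0 < k * (z.re + k * z.im) := mul_pos hk hre
    by_cases h : 0 ≤ z'.im
    · refine ⟨z', hass, hnz, hre, h, ?_⟩
      change z.im + k * (z.re + k * z.im) < k * (z.re + k * z.im)
      omega
    push Not at h
    have hn' : 0 < norm z' := by rw [hnz, norm_eq]; exact hn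
    obtain ⟨w, h1, h2, h3⟩ := ih z' hn'
      (by
        rw [norm_eq] at hn'
        have h5 : 0 < z'.re := hre
        by_contra! hcon
        nlinarith [sq_nonneg z'.im]) h
      (by change z.im + k * (z.re + k * z.im) < 0 at h
          change (-(z.im + k * (z.re + k * z.im))).toNat ≤ m; omega)
    exact ⟨w, hass.trans h1, h2.trans hnz, h3⟩

theorem exists_cone (hk : 0 < k) (z : UnitOrder k) (hz : norm z ≠ 0) :
    ∃ w : UnitOrder k, Associated z w ∧ norm w = (norm z).natAbs ∧ 0 < w.re ∧ 0 ≤ w.im ∧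
      w.im < k * w.re := by
  obtain ⟨z₁, h₁, hn₁⟩ : ∃ z₁ : UnitOrder k, Associated z z₁ ∧ norm z₁ = (norm z).natAbs := by
    rcases lt_or_gt_of_ne hz with h | h
    · refine ⟨z * ω, associated_mul_unit_right _ _ isUnit_omega, ?_⟩
      rw [map_mul, norm_eq ω, omega_re, omega_im]
      omega
    · exact ⟨z, .refl _, by omega⟩
  have hpos : 0 < norm z₁ := by omega
  obtain ⟨z₂, h₂, hn₂, ht⟩ : ∃ z₂ : UnitOrder k, Associated z₁ z₂ ∧ norm z₂ = norm z₁ ∧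
      0 ≤ 2 * z₂.re + k * z₂.im := by
    by_cases h : 0 ≤ 2 * z₁.re + k * z₁.im
    · exact ⟨z₁, .refl _, rfl, h⟩
    · refine ⟨-z₁, (Associated.refl z₁).neg_right, norm_neg _, ?_⟩
      simp only [re_neg, im_neg]; linarith
  have h12 := h₁.trans h₂
  have hpos₂ : 0 < norm z₂ := by omega
  have hpos₃ := hpos₂
  rw [norm_eq] at hpos₃
  have hmul : 0 < z₂.re * (z₂.re + k * z₂.im) := by nlinarith [sq_nonneg z₂.im]
  have hre : 0 < z₂.re := by
    by_contra! hcon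
    nlinarith
  have hre' : 0 < z₂.re + k * z₂.im := by
    by_contra! hcon
    nlinarith
  obtain ⟨w, hw1, hw2, hw3⟩ : ∃ w : UnitOrder k, Associated z₂ w ∧ norm w = norm z₂ ∧ 0 < w.re ∧
      0 ≤ w.im ∧ w.im < k * w.re := by
    rcases le_or_gt 0 z₂.im with h | h
    · exact exists_cone_of_nonneg hk _ z₂ hpos₂ hre h le_rfl
    · exact exists_cone_of_neg hk _ z₂ hpos₂ hre' h le_rfl
  exact ⟨w, h12.trans hw1, by omega, hw3⟩

theorem eq_of_cone_of_mul {x y a b : ℤ} (hx : 0 < x) (hy : 0 ≤ y) (hyx : y < k * x)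
    (hu : a ^ 2 + k * a * b - b ^ 2 = 1) (hb : 0 ≤ b)
    (hx' : 0 < x * a + y * b) (hyx' : x * b + y * a + k * y * b < k * (x * a + y * b)) :
    a = 1 ∧ b = 0 := by
  rcases hb.eq_or_lt with rfl | hb
  · refine ⟨?_, rfl⟩
    have : a ^ 2 = 1 := by linarith
    rcases sq_eq_one_iff.mp this with h | h
    · exact h
    · subst h; linarith
  exfalso
  rcases le_or_gt a 0 with ha | ha
  · have h1 : a + k * b < 0 := by
      by_contra! hcon
      nlinarith
    nlinarith
  · have h1 : k * a ≤ b := by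
      by_contra! hcon
      nlinarith [mul_pos hb (sub_pos.mpr hcon)]
    nlinarith

theorem bijOn_cone (hk : 0 < k) {n : ℕ} (hn : n ≠ 0) :
    Set.BijOn (fun p : ℤ × ℤ ↦ Associates.mk (⟨p.1, p.2⟩ : UnitOrder k)) (cone k n)
      (normClasses k n) := by
  refine ⟨?_, ?_, ?_⟩
  · rintro ⟨x, y⟩ ⟨-, -, -, h⟩
    rw [mk_mem_normClasses, norm_eq]
    simp only at h ⊢
    omega
  · rintro ⟨x, y⟩ ⟨h1, h2, h3, h4⟩ ⟨x', y'⟩ ⟨h1', h2', h3', h4'⟩ h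
    obtain ⟨u, hu⟩ := Associates.mk_eq_mk_iff_associated.mp h
    simp only at h1 h2 h3 h4 h1' h2' h3' h4' hu
    have hnu : norm (u : UnitOrder k) = 1 := by
      have := congrArg QuadraticAlgebra.norm hu
      rw [map_mul, norm_eq ⟨x, y⟩, norm_eq ⟨x', y'⟩] at this
      simp only at this
      rw [h4, h4'] at this
      exact (mul_eq_left₀ (by exact_mod_cast hn)).mp this
    rcases hab : (u : UnitOrder k) with ⟨a, b⟩
    rw [hab] at hnu hu
    rw [norm_eq] at hnu
    simp only at hnu
    have hre : x * a + y * b = x' := by simpa using congrArg QuadraticAlgebra.re hu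
    have him : x * b + y * a + k * y * b = y' := by simpa using congrArg QuadraticAlgebra.im hu
    suffices a = 1 ∧ b = 0 by
      obtain ⟨rfl, rfl⟩ := this
      simp_all
    rcases le_total 0 b with hb | hb
    · exact eq_of_cone_of_mul h1 h2 h3 hnu hb (by omega) (by rw [hre, him]; exact h3')
    · have e1 : x' * (a + k * b) + y' * (-b) = x := by
        rw [← hre, ← him]; linear_combination x * hnu
      have e2 : x' * (-b) + y' * (a + k * b) + k * y' * (-b) = y := by
        rw [← hre, ← him]; linear_combination y * hnu
      have := eq_of_cone_of_mul (a := a + k * b) (b := -b) h1' h2' h3'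
        (by linear_combination hnu) (by omega) (by omega) (by rw [e1, e2]; exact h3)
      obtain ⟨h5, h6⟩ := this
      have : b = 0 := by omega
      subst this
      exact ⟨by linarith, rfl⟩
  · rintro a ⟨z, rfl, hz⟩
    obtain ⟨w, h1, h2, h3, h4, h5⟩ := exists_cone hk z (by omega)
    refine ⟨(w.re, w.im), ⟨h3, h4, h5, ?_⟩, Associates.mk_eq_mk_iff_associated.mpr h1.symm⟩
    rw [norm_eq] at h2
    simp only
    omega

theorem finite_cone (hk : 0 < k) (n : ℕ) : (cone k n).Finite := by
  refine ((Set.finite_Icc (0 : ℤ) n).prod (Set.finite_Icc (0 : ℤ) (k * n))).subset ?_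
  rintro ⟨x, y⟩ ⟨h1, h2, h3, h4⟩
  simp only at h1 h2 h3 h4
  have : x ≤ n := by nlinarith
  simp only [Set.mem_prod, Set.mem_Icc]
  exact ⟨⟨h1.le, this⟩, h2, by nlinarith⟩

theorem finite_normClasses (hk : 0 < k) {n : ℕ} (hn : n ≠ 0) : (normClasses k n).Finite :=
  (bijOn_cone hk hn).finite_iff_finite.mp (finite_cone hk n)

theorem ncard_cone (hk : 0 < k) {n : ℕ} (hn : n ≠ 0) :
    (cone k n).ncard = (normClasses k n).ncard := by
  rw [← (bijOn_cone hk hn).image_eq, (bijOn_cone hk hn).injOn.ncard_image]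

theorem ncard_normClasses_one : (normClasses k 1).ncard = 1 := by
  rw [Set.ncard_eq_one]
  refine ⟨1, Set.ext fun a ↦ ?_⟩
  induction a using Quotient.inductionOn with | _ z
  rw [Associates.quotient_mk_eq_mk, mk_mem_normClasses, Set.mem_singleton_iff,
    Associates.mk_eq_one, isUnit_iff_norm_isUnit, Int.isUnit_iff_natAbs_eq]

end UnitOrder

namespace UnitOrder

open QuadraticAlgebra

variable {k : ℤ}

theorem mul_left_cancel_of_norm_ne_zero {p z w : UnitOrder k} (hp : norm p ≠ 0)
    (h : p * z = p * w) : z = w := by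
  have h1 : (algebraMap ℤ (UnitOrder k) (norm p)) * (z - w) = 0 := by
    rw [algebraMap_norm_eq_mul_star]
    linear_combination star p * h
  have h2 : (norm p) • (z - w) = 0 := by rwa [Algebra.smul_def]
  have h3 := congrArg QuadraticAlgebra.re h2
  have h4 := congrArg QuadraticAlgebra.im h2
  simp only [re_smul, im_smul, re_sub, im_sub, re_zero, im_zero, smul_eq_mul, mul_eq_zero, hp,
    false_or] at h3 h4
  ext
  · linarith
  · linarith

theorem injective_mk_mul {p : UnitOrder k} (hp : norm p ≠ 0) :
    Function.Injective fun a : Associates (UnitOrder k) ↦ Associates.mk p * a := by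
  intro a b h
  induction a using Quotient.inductionOn with | _ z
  induction b using Quotient.inductionOn with | _ w
  simp only [Associates.quotient_mk_eq_mk, Associates.mk_mul_mk] at h ⊢
  rw [Associates.mk_eq_mk_iff_associated] at h ⊢
  obtain ⟨u, hu⟩ := h
  exact ⟨u, mul_left_cancel_of_norm_ne_zero hp (by rw [← hu]; ring)⟩

theorem ncard_image_mk_mul {p : UnitOrder k} (hp : norm p ≠ 0)
    (s : Set (Associates (UnitOrder k))) :
    ((fun a ↦ Associates.mk p * a) '' s).ncard = s.ncard :=
  Set.ncard_image_of_injective s (injective_mk_mul hp)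

theorem norm_intCast (a : ℤ) : norm (a : UnitOrder k) = a ^ 2 := by
  rw [norm_eq]; simp

theorem intCast_dvd {a : ℤ} {z : UnitOrder k} (h1 : a ∣ z.re) (h2 : a ∣ z.im) :
    (a : UnitOrder k) ∣ z := by
  obtain ⟨x, hx⟩ := h1
  obtain ⟨y, hy⟩ := h2
  refine ⟨⟨x, y⟩, ?_⟩
  ext <;> simp [hx, hy]

theorem intCast_dvd_of_dvd_norm {l : ℕ} (hl : l.Prime)
    (h : ∀ b : ℤ, ¬ (l : ℤ) ∣ b ^ 2 - k * b - 1) {z : UnitOrder k} (hz : (l : ℤ) ∣ norm z) :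
    (l : UnitOrder k) ∣ z := by
  have hp := Nat.prime_iff_prime_int.mp hl
  rw [norm_eq] at hz
  have h1 : (l : ℤ) ∣ z.re := by
    by_contra hcon
    obtain ⟨u, v, huv⟩ := (Prime.coprime_iff_not_dvd hp).mpr hcon
    refine h (z.im * v) ?_
    have : (z.im * v) ^ 2 - k * (z.im * v) - 1 =
        -(z.re ^ 2 + k * z.re * z.im - z.im ^ 2) * v ^ 2 +
          l * (u * (1 + v * z.re) * -1 - k * z.im * v * u) := by
      linear_combination ((1 + v * z.re) + k * z.im * v) * huv
    rw [this]
    exact dvd_add ((hz.neg_right).mul_right _) (dvd_mul_right _ _)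
  have h2 : (l : ℤ) ∣ z.im := by
    refine hp.dvd_of_dvd_pow (n := 2) ?_
    have := dvd_sub (h1.mul_right (z.re + k * z.im)) hz
    convert this using 1
    ring
  simpa using intCast_dvd (z := z) h1 h2

/-- The classes of norm `± n / l`, of which there are none if `l` does not divide `n`. -/
def normClassesDiv (k : ℤ) (n l : ℕ) : Set (Associates (UnitOrder k)) :=
  if l ∣ n then normClasses k (n / l) else ∅

theorem image_normClassesDiv {l : ℕ} (hl : l ≠ 0) (n : ℕ) (z : UnitOrder k) :
    Associates.mk z ∈ (fun a ↦ Associates.mk (l : UnitOrder k) * a) '' normClassesDiv k n l ↔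
      (l : UnitOrder k) ∣ z ∧ (norm z).natAbs = l * n := by
  have hnl : (norm (l : UnitOrder k)).natAbs = l ^ 2 := by
    have := norm_intCast (k := k) l
    rw [Int.cast_natCast] at this
    rw [this, Int.natAbs_pow, Int.natAbs_natCast]
  constructor
  · rintro ⟨a, ha, hz⟩
    rw [normClassesDiv] at ha
    split_ifs at ha with hd
    · obtain ⟨w, rfl, hw⟩ := ha
      simp only [Associates.mk_mul_mk] at hz
      have hz' := Associates.mk_eq_mk_iff_associated.mp hz
      refine ⟨(dvd_mul_right _ _).trans hz'.dvd, ?_⟩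
      rw [← natAbs_norm_eq_of_associated hz', map_mul, Int.natAbs_mul, hnl, hw]
      obtain ⟨m, rfl⟩ := hd
      rw [Nat.mul_div_cancel_left _ (Nat.pos_of_ne_zero hl)]; ring
    · exact ha.elim
  · rintro ⟨⟨w, rfl⟩, h⟩
    rw [map_mul, Int.natAbs_mul, hnl] at h
    have hw : l * (norm w).natAbs = n :=
      Nat.eq_of_mul_eq_mul_left (Nat.pos_of_ne_zero hl) (by rw [← h]; ring)
    refine ⟨Associates.mk w, ?_, Associates.mk_mul_mk⟩
    rw [normClassesDiv, if_pos ⟨_, hw.symm⟩, ← hw,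
      Nat.mul_div_cancel_left _ (Nat.pos_of_ne_zero hl), mk_mem_normClasses]

theorem ncard_normClasses_mul_of_inert {l : ℕ} (hl : l.Prime)
    (h : ∀ b : ℤ, ¬ (l : ℤ) ∣ b ^ 2 - k * b - 1) (n : ℕ) :
    (normClasses k (l * n)).ncard = (normClassesDiv k n l).ncard := by
  have hnl : norm (l : UnitOrder k) ≠ 0 := by
    have := norm_intCast (k := k) l
    rw [Int.cast_natCast] at this
    rw [this]
    exact pow_ne_zero _ (by exact_mod_cast hl.ne_zero)
  rw [← ncard_image_mk_mul hnl (normClassesDiv k n l)]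
  congr 1
  ext a
  induction a using Quotient.inductionOn with | _ z
  rw [Associates.quotient_mk_eq_mk, mk_mem_normClasses, image_normClassesDiv hl.ne_zero]
  refine ⟨fun hz ↦ ⟨intCast_dvd_of_dvd_norm hl h ?_, hz⟩, fun hz ↦ hz.2⟩
  rw [← Int.natAbs_dvd_natAbs, hz]
  simp

section Split

variable {l : ℕ} {p : UnitOrder k}

theorem dvd_of_dvd_im (hp : (norm p).natAbs = l) (hl : l.Prime) {z : UnitOrder k}
    (hz : (l : ℤ) ∣ norm z) (h : (l : ℤ) ∣ (z * star p).im) : p ∣ z := by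
  have hpr := Nat.prime_iff_prime_int.mp hl
  have hre : (l : ℤ) ∣ (z * star p).re := by
    refine hpr.dvd_of_dvd_pow (n := 2) ?_
    have h1 : (l : ℤ) ∣ norm (z * star p) := by rw [map_mul]; exact hz.mul_right _
    rw [norm_eq] at h1
    have := dvd_sub h1 (h.mul_right (k * (z * star p).re - (z * star p).im))
    convert this using 1
    ring
  have h1 : ((norm p : ℤ) : UnitOrder k) ∣ z * star p := by
    refine intCast_dvd ?_ ?_ <;> rw [← Int.natAbs_dvd, hp] <;> assumption
  have h2 := algebraMap_norm_eq_mul_star p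
  rw [eq_intCast] at h2
  rw [h2] at h1
  obtain ⟨w, hw⟩ := h1
  refine ⟨w, ?_⟩
  refine mul_left_cancel_of_norm_ne_zero (p := star p) ?_ (by rw [mul_comm, hw]; ring)
  rw [QuadraticAlgebra.norm_star]
  intro h0
  rw [h0] at hp
  exact hl.ne_zero hp.symm

theorem dvd_or_star_dvd (hp : (norm p).natAbs = l) (hl : l.Prime) {z : UnitOrder k}
    (hz : (l : ℤ) ∣ norm z) : p ∣ z ∨ star p ∣ z := by
  have hpr := Nat.prime_iff_prime_int.mp hl
  have key : (z * star p).im * (z * p).im = z.im ^ 2 * norm p - p.im ^ 2 * norm z := by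
    rw [norm_eq, norm_eq]
    simp
    ring
  have hdvd : (l : ℤ) ∣ (z * star p).im * (z * p).im := by
    rw [key]
    refine dvd_sub (Dvd.dvd.mul_left ?_ _) (hz.mul_left _)
    rw [← hp]
    exact Int.natAbs_dvd.mpr dvd_rfl
  rcases hpr.dvd_or_dvd hdvd with h | h
  · exact .inl (dvd_of_dvd_im hp hl hz h)
  · exact .inr (dvd_of_dvd_im (by rwa [QuadraticAlgebra.norm_star]) hl hz (by rwa [star_star]))

theorem mk_mem_image_normClasses (hp : (norm p).natAbs = l) (hl : l ≠ 0) {n : ℕ}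
    (z : UnitOrder k) : Associates.mk z ∈ (fun a ↦ Associates.mk p * a) '' normClasses k n ↔
      p ∣ z ∧ (norm z).natAbs = l * n := by
  constructor
  · rintro ⟨_, ⟨w, rfl, hw⟩, hz⟩
    simp only [Associates.mk_mul_mk] at hz
    have hz' := Associates.mk_eq_mk_iff_associated.mp hz
    refine ⟨(dvd_mul_right _ _).trans hz'.dvd, ?_⟩
    rw [← natAbs_norm_eq_of_associated hz', map_mul, Int.natAbs_mul, hp, hw]
  · rintro ⟨⟨w, rfl⟩, h⟩
    rw [map_mul, Int.natAbs_mul, hp] at h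
    exact ⟨Associates.mk w, mk_mem_normClasses.mpr
      (Nat.eq_of_mul_eq_mul_left (Nat.pos_of_ne_zero hl) h), Associates.mk_mul_mk⟩

theorem normClasses_mul_eq_union (hp : (norm p).natAbs = l) (hl : l.Prime) (n : ℕ) :
    normClasses k (l * n) = (fun a ↦ Associates.mk p * a) '' normClasses k n ∪
      (fun a ↦ Associates.mk (star p) * a) '' normClasses k n := by
  ext a
  induction a using Quotient.inductionOn with | _ z
  rw [Associates.quotient_mk_eq_mk, Set.mem_union, mk_mem_image_normClasses hp hl.ne_zero,
    mk_mem_image_normClasses (by rwa [QuadraticAlgebra.norm_star]) hl.ne_zero,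
    mk_mem_normClasses, ← or_and_right]
  refine ⟨fun hz ↦ ⟨dvd_or_star_dvd hp hl ?_, hz⟩, fun hz ↦ hz.2⟩
  rw [← Int.natAbs_dvd_natAbs, hz]
  simp

theorem not_dvd_im (hp : (norm p).natAbs = l) (hl : l.Prime) : ¬ (l : ℤ) ∣ p.im := by
  have hpr := Nat.prime_iff_prime_int.mp hl
  intro h
  have h1 : (l : ℤ) ∣ norm p := by rw [← hp]; exact Int.natAbs_dvd.mpr dvd_rfl
  rw [norm_eq] at h1
  have h2 : (l : ℤ) ∣ p.re := by
    refine hpr.dvd_of_dvd_pow (n := 2) ?_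
    have := dvd_sub h1 (h.mul_right (k * p.re - p.im))
    convert this using 1
    ring
  obtain ⟨x, hx⟩ := h2
  obtain ⟨y, hy⟩ := h
  have h3 : (l : ℤ) ^ 2 ∣ norm p := by
    rw [norm_eq, hx, hy]
    exact ⟨x ^ 2 + k * x * y - y ^ 2, by ring⟩
  rw [← Int.natAbs_dvd_natAbs, hp, Int.natAbs_pow, Int.natAbs_natCast] at h3
  have h4 := Nat.le_of_dvd hl.pos h3
  nlinarith [hl.two_le]

theorem dvd_trace_iff (hp : (norm p).natAbs = l) (hl : l.Prime) :
    (l : ℤ) ∣ 2 * p.re + k * p.im ↔ (l : ℤ) ∣ k ^ 2 + 4 := by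
  have hpr := Nat.prime_iff_prime_int.mp hl
  have h1 : (l : ℤ) ∣ norm p := by rw [← hp]; exact Int.natAbs_dvd.mpr dvd_rfl
  have key : (2 * p.re + k * p.im) ^ 2 = (k ^ 2 + 4) * p.im ^ 2 + 4 * norm p := by
    rw [norm_eq]; ring
  constructor
  · intro h
    have h2 : (l : ℤ) ∣ (k ^ 2 + 4) * p.im ^ 2 := by
      have := dvd_sub (h.mul_right (2 * p.re + k * p.im)) (h1.mul_left 4)
      rw [← sq, key] at this
      simpa using this
    exact (hpr.dvd_or_dvd h2).resolve_right fun h3 ↦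
      not_dvd_im hp hl (hpr.dvd_of_dvd_pow h3)
  · intro h
    refine hpr.dvd_of_dvd_pow (n := 2) ?_
    rw [key]
    exact dvd_add (h.mul_right _) (h1.mul_left _)

theorem ncard_normClasses_mul_of_ramified (hp : (norm p).natAbs = l) (hl : l.Prime)
    (hD : (l : ℤ) ∣ k ^ 2 + 4) (n : ℕ) :
    (normClasses k (l * n)).ncard = (normClasses k n).ncard := by
  have h0 : norm p ≠ 0 := fun h ↦ hl.ne_zero (by rw [← hp, h]; rfl)
  have h1 : (l : ℤ) ∣ norm p := by rw [← hp]; exact Int.natAbs_dvd.mpr dvd_rfl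
  have h2 : star p ∣ p := by
    refine dvd_of_dvd_im (by rwa [QuadraticAlgebra.norm_star]) hl h1 ?_
    have : (p * star (star p)).im = (2 * p.re + k * p.im) * p.im := by
      simp; ring
    rw [this]
    exact ((dvd_trace_iff hp hl).mpr hD).mul_right _
  have h4 : Associates.mk (star p) = Associates.mk p := by
    obtain ⟨w, hw⟩ := h2
    have hw1 : l * (norm w).natAbs = l * 1 := by
      conv_rhs => rw [mul_one, ← hp, hw, map_mul, QuadraticAlgebra.norm_star, Int.natAbs_mul, hp]
    have hw2 : IsUnit w := by
      rw [isUnit_iff_norm_isUnit, Int.isUnit_iff_natAbs_eq]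
      exact Nat.eq_of_mul_eq_mul_left hl.pos hw1
    refine Associates.mk_eq_mk_iff_associated.mpr ⟨hw2.unit, hw.symm⟩
  rw [normClasses_mul_eq_union hp hl, h4, Set.union_self, ncard_image_mk_mul h0]

theorem ncard_normClasses_mul_of_split (hk : 0 < k) (hp : (norm p).natAbs = l) (hl : l.Prime)
    (hD : ¬ (l : ℤ) ∣ k ^ 2 + 4) {n : ℕ} (hn : n ≠ 0) :
    (normClasses k (l * n)).ncard + (normClassesDiv k n l).ncard = 2 * (normClasses k n).ncard := by
  have hpr := Nat.prime_iff_prime_int.mp hl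
  have h0 : norm p ≠ 0 := fun h ↦ hl.ne_zero (by rw [← hp, h]; rfl)
  have h0' : norm (star p) ≠ 0 := by rwa [QuadraticAlgebra.norm_star]
  have hnl : norm (l : UnitOrder k) ≠ 0 := by
    have := norm_intCast (k := k) l
    rw [Int.cast_natCast] at this
    rw [this]
    exact pow_ne_zero _ (by exact_mod_cast hl.ne_zero)
  have hpl : (l : UnitOrder k) ∣ p * star p ∧ p * star p ∣ (l : UnitOrder k) := by
    rw [← algebraMap_norm_eq_mul_star, eq_intCast, ← Int.cast_natCast, ← hp]
    exact ⟨map_dvd (Int.castRingHom (UnitOrder k)) (Int.natAbs_dvd.mpr dvd_rfl),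
      map_dvd (Int.castRingHom (UnitOrder k)) (Int.dvd_natAbs.mpr dvd_rfl)⟩
  have hinter : (fun a ↦ Associates.mk p * a) '' normClasses k n ∩
      (fun a ↦ Associates.mk (star p) * a) '' normClasses k n =
      (fun a ↦ Associates.mk (l : UnitOrder k) * a) '' normClassesDiv k n l := by
    ext a
    induction a using Quotient.inductionOn with | _ z
    rw [Associates.quotient_mk_eq_mk, Set.mem_inter_iff, mk_mem_image_normClasses hp hl.ne_zero,
      mk_mem_image_normClasses (by rwa [QuadraticAlgebra.norm_star]) hl.ne_zero,
      image_normClassesDiv hl.ne_zero,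
      ← and_and_right]
    refine and_congr_left fun _ ↦ ⟨?_, fun h ↦ ?_⟩
    · rintro ⟨⟨u, hu⟩, ⟨v, hv⟩⟩
      obtain ⟨a, b, hab⟩ := (Prime.coprime_iff_not_dvd hpr).mpr
        ((dvd_trace_iff hp hl).not.mpr hD)
      have htr : p + star p = ((2 * p.re + k * p.im : ℤ) : UnitOrder k) := by
        ext <;> simp; ring
      have h1 : ((a * l + b * (2 * p.re + k * p.im) : ℤ) : UnitOrder k) = 1 := by
        rw [hab, Int.cast_one]
      rw [Int.cast_add, Int.cast_mul, Int.cast_mul, ← htr] at h1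
      have h2 : z = l * (a * z) + p * star p * (b * (u + v)) := by
        push_cast at h1
        linear_combination (-z) * h1 + b * star p * hu + b * p * hv
      rw [h2]
      exact dvd_add (dvd_mul_right _ _) (hpl.1.mul_right _)
    · exact ⟨(dvd_mul_right _ _).trans (hpl.2.trans h), (dvd_mul_left _ _).trans (hpl.2.trans h)⟩
  have hfin := finite_normClasses hk hn
  rw [normClasses_mul_eq_union hp hl, ← ncard_image_mk_mul hnl (normClassesDiv k n l), ← hinter,
    Set.ncard_union_add_ncard_inter _ _ (hfin.image _) (hfin.image _), ncard_image_mk_mul h0,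
    ncard_image_mk_mul h0', two_mul]

end Split

end UnitOrder

namespace UnitOrder

open QuadraticAlgebra

variable {k : ℤ}

/-- Every prime that is a norm from the residue rings of the order is a norm up to sign. -/
def PrincipalNorms (k : ℤ) : Prop :=
  ∀ l : ℕ, l.Prime → (∃ b : ℤ, (l : ℤ) ∣ b ^ 2 - k * b - 1) →
    ∃ z : UnitOrder k, (norm z).natAbs = l

theorem natAbs_discr_mod_eight (hodd : Odd k) : (k ^ 2 + 4).natAbs % 8 = 5 := by
  have h1 : k ^ 2 % 8 = 1 := by
    obtain ⟨j, rfl⟩ := hodd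
    obtain ⟨m, hm⟩ := Int.even_mul_succ_self j
    have : (2 * j + 1) ^ 2 = 8 * m + 1 := by linear_combination 4 * hm
    omega
  have h2 : 0 ≤ k ^ 2 := sq_nonneg k
  omega

theorem exists_root_iff_isSquare {l : ℕ} [Fact l.Prime] (hl : l ≠ 2) :
    (∃ b : ℤ, (l : ℤ) ∣ b ^ 2 - k * b - 1) ↔ IsSquare ((k ^ 2 + 4 : ℤ) : ZMod l) := by
  have h2 : (2 : ZMod l) ≠ 0 := by
    have := Ring.two_ne_zero (R := ZMod l) (by rwa [ZMod.ringChar_zmod_n])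
    exact this
  constructor
  · rintro ⟨b, hb⟩
    rw [← ZMod.intCast_zmod_eq_zero_iff_dvd] at hb
    refine ⟨2 * b - k, ?_⟩
    push_cast at hb ⊢
    linear_combination -4 * hb
  · rintro ⟨r, hr⟩
    refine ⟨(((r + k) / 2 : ZMod l)).val, ?_⟩
    rw [← ZMod.intCast_zmod_eq_zero_iff_dvd]
    push_cast at hr ⊢
    rw [ZMod.natCast_zmod_val]
    field_simp
    linear_combination -hr

theorem jacobiSym_natCast_discr (hodd : Odd k) {l : ℕ} [Fact l.Prime] (hl : l ≠ 2) :
    jacobiSym l (k ^ 2 + 4).natAbs = legendreSym l (k ^ 2 + 4) := by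
  have h := natAbs_discr_mod_eight hodd
  rw [← jacobiSym.quadratic_reciprocity_one_mod_four (by omega)
    ((Fact.out : l.Prime).odd_of_ne_two hl), jacobiSym.legendreSym.to_jacobiSym]
  congr 1
  have := sq_nonneg k
  omega

theorem jacobiSym_two_discr (hodd : Odd k) : jacobiSym 2 (k ^ 2 + 4).natAbs = -1 := by
  have h := natAbs_discr_mod_eight hodd
  rw [jacobiSym.at_two (Nat.odd_iff.mpr (by omega)), ZMod.χ₈_nat_mod_eight, h]
  rfl

theorem not_two_dvd (hodd : Odd k) (b : ℤ) : ¬ ((2 : ℕ) : ℤ) ∣ b ^ 2 - k * b - 1 := by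
  obtain ⟨j, rfl⟩ := hodd
  intro h
  have h1 : b ^ 2 - (2 * j + 1) * b - 1 = b * (b - 1) - 2 * (j * b) - 1 := by ring
  have h2 := Int.even_mul_pred_self b
  rw [h1] at h
  obtain ⟨m, hm⟩ := h2
  push_cast at h
  omega

theorem jacobiSym_discr_of_inert (hodd : Odd k) {l : ℕ} (hl : l.Prime)
    (h : ∀ b : ℤ, ¬ (l : ℤ) ∣ b ^ 2 - k * b - 1) : jacobiSym l (k ^ 2 + 4).natAbs = -1 := by
  have := Fact.mk hl
  rcases eq_or_ne l 2 with rfl | h2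
  · exact jacobiSym_two_discr hodd
  · rw [jacobiSym_natCast_discr hodd h2, legendreSym.eq_neg_one_iff,
      ← exists_root_iff_isSquare h2, not_exists]
    exact h

theorem jacobiSym_discr_of_root (hodd : Odd k) {l : ℕ} (hl : l.Prime)
    (h : ∃ b : ℤ, (l : ℤ) ∣ b ^ 2 - k * b - 1) :
    jacobiSym l (k ^ 2 + 4).natAbs = if (l : ℤ) ∣ k ^ 2 + 4 then 0 else 1 := by
  have := Fact.mk hl
  have h2 : l ≠ 2 := by
    rintro rfl
    exact not_two_dvd hodd _ h.choose_spec
  rw [jacobiSym_natCast_discr hodd h2]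
  have h3 := (exists_root_iff_isSquare h2).mp h
  split_ifs with hd
  · rwa [legendreSym.eq_zero_iff, ZMod.intCast_zmod_eq_zero_iff_dvd]
  · rwa [legendreSym.eq_one_iff l (by rwa [Ne, ZMod.intCast_zmod_eq_zero_iff_dvd])]

/-- The number of lattice points on the norm hyperbola `n / l`. -/
theorem ncard_normClasses_mul (hk : 0 < k) (hodd : Odd k) (hP : PrincipalNorms k) {l : ℕ}
    (hl : l.Prime) {n : ℕ} (hn : n ≠ 0) :
    ((normClasses k (l * n)).ncard : ℤ) = (1 + jacobiSym l (k ^ 2 + 4).natAbs) *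
      (normClasses k n).ncard - jacobiSym l (k ^ 2 + 4).natAbs * (normClassesDiv k n l).ncard := by
  by_cases h : ∃ b : ℤ, (l : ℤ) ∣ b ^ 2 - k * b - 1
  · obtain ⟨p, hp⟩ := hP l hl h
    rw [jacobiSym_discr_of_root hodd hl h]
    split_ifs with hd
    · rw [ncard_normClasses_mul_of_ramified hp hl hd]
      ring
    · have := ncard_normClasses_mul_of_split hk hp hl hd hn
      zify at this
      linear_combination this
  · push Not at h
    rw [jacobiSym_discr_of_inert hodd hl h, ncard_normClasses_mul_of_inert hl h]
    ring

theorem sum_divisors_prime_mul {R : Type*} [CommRing R] {f : ℕ → R}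
    (hf : ∀ a b, f (a * b) = f a * f b) {l : ℕ} (hl : l.Prime) {n : ℕ} (hn : n ≠ 0) :
    ∑ d ∈ (l * n).divisors, f d = (1 + f l) * ∑ d ∈ n.divisors, f d -
      f l * if l ∣ n then ∑ d ∈ (n / l).divisors, f d else 0 := by
  have hmap : ∀ m : ℕ, ∑ d ∈ m.divisors.image (l * ·), f d = f l * ∑ d ∈ m.divisors, f d := by
    intro m
    rw [Finset.sum_image fun a _ b _ h ↦ Nat.eq_of_mul_eq_mul_left hl.pos h, Finset.mul_sum]
    exact Finset.sum_congr rfl fun d _ ↦ hf l d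
  have hunion : (l * n).divisors = n.divisors ∪ n.divisors.image (l * ·) := by
    ext d
    simp only [Finset.mem_union, Nat.mem_divisors, Finset.mem_image]
    constructor
    · rintro ⟨h1, -⟩
      by_cases h : l ∣ d
      · obtain ⟨e, rfl⟩ := h
        exact .inr ⟨e, ⟨Nat.dvd_of_mul_dvd_mul_left hl.pos h1, hn⟩, rfl⟩
      · exact .inl ⟨((hl.coprime_iff_not_dvd.mpr h).symm).dvd_of_dvd_mul_left h1, hn⟩
    · rintro (⟨h1, -⟩ | ⟨e, ⟨h1, -⟩, rfl⟩)
      · exact ⟨h1.mul_left l, mul_ne_zero hl.ne_zero hn⟩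
      · exact ⟨Nat.mul_dvd_mul_left l h1, mul_ne_zero hl.ne_zero hn⟩
  have hinter : ∑ d ∈ n.divisors ∩ n.divisors.image (l * ·), f d =
      f l * if l ∣ n then ∑ d ∈ (n / l).divisors, f d else 0 := by
    split_ifs with h
    · rw [← hmap]
      congr 1
      obtain ⟨m, rfl⟩ := h
      rw [Nat.mul_div_cancel_left _ hl.pos]
      have hm : m ≠ 0 := by rintro rfl; simp at hn
      ext d
      simp only [Finset.mem_inter, Nat.mem_divisors, Finset.mem_image]
      constructor
      · rintro ⟨⟨h1, -⟩, e, ⟨h2, -⟩, rfl⟩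
        exact ⟨e, ⟨Nat.dvd_of_mul_dvd_mul_left hl.pos h1, hm⟩, rfl⟩
      · rintro ⟨e, ⟨h1, -⟩, rfl⟩
        exact ⟨⟨Nat.mul_dvd_mul_left l h1, hn⟩, e, ⟨h1.mul_left l, hn⟩, rfl⟩
    · rw [mul_zero]
      refine Finset.sum_eq_zero fun d hd ↦ ?_
      simp only [Finset.mem_inter, Nat.mem_divisors, Finset.mem_image] at hd
      obtain ⟨⟨h1, -⟩, e, -, rfl⟩ := hd
      exact (h ((dvd_mul_right l e).trans h1)).elim
  rw [hunion, ← hinter, eq_sub_iff_add_eq, Finset.sum_union_inter, hmap]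
  ring

/-- The analogue of `ζ_K = ζ L(·, χ_D)` for the principal classes. -/
theorem ncard_cone_eq_sum_jacobiSym (hk : 0 < k) (hodd : Odd k) (hP : PrincipalNorms k) {n : ℕ}
    (hn : n ≠ 0) :
    ((cone k n).ncard : ℤ) = ∑ d ∈ n.divisors, jacobiSym d (k ^ 2 + 4).natAbs := by
  rw [ncard_cone hk hn]
  induction n using Nat.strong_induction_on with | _ n ih
  rcases eq_or_ne n 1 with rfl | h1
  · simp [ncard_normClasses_one]
  obtain ⟨m, hm⟩ := Nat.minFac_dvd n
  set l := n.minFac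
  have hl : l.Prime := Nat.minFac_prime h1
  have hm0 : m ≠ 0 := by rintro rfl; simp at hm; exact hn hm
  have hmn : m < n := by
    rw [hm]
    have := hl.two_le
    nlinarith [Nat.pos_of_ne_zero hm0]
  have hrec := sum_divisors_prime_mul (f := fun d : ℕ ↦ jacobiSym d (k ^ 2 + 4).natAbs)
    (fun a b ↦ by push_cast; exact jacobiSym.mul_left _ _ _) hl hm0
  rw [hm, ncard_normClasses_mul hk hodd hP hl hm0, ih m hmn hm0, hrec]
  congr 2
  rw [normClassesDiv]
  split_ifs with h
  · obtain ⟨j, hj⟩ := h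
    have hj0 : j ≠ 0 := by rintro rfl; simp at hj; exact hm0 hj
    have h2 : m / l = j := by rw [hj, Nat.mul_div_cancel_left _ hl.pos]
    rw [h2]
    refine ih j (lt_of_le_of_lt ?_ hmn) hj0
    rw [hj]
    exact Nat.le_mul_of_pos_left j hl.pos
  · simp

end UnitOrder

namespace EulerMaclaurin

open Finset

theorem abs_sub_le_of_hasDerivAt {f f' : ℝ → ℝ} {a K : ℝ}
    (hf : ∀ s ∈ Set.Icc a (a + 1), HasDerivAt f (f' s) s)
    (hK : ∀ s ∈ Set.Icc a (a + 1), |f' s| ≤ K) {s : ℝ} (hs : s ∈ Set.Icc a (a + 1)) :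
    |f s - f a| ≤ K := by
  have ha : a ∈ Set.Icc a (a + 1) := ⟨le_rfl, by linarith⟩
  have h := (convex_Icc a (a + 1)).norm_image_sub_le_of_norm_hasDerivWithin_le
    (fun x hx ↦ (hf x hx).hasDerivWithinAt) hK ha hs
  have hK0 : 0 ≤ K := (abs_nonneg _).trans (hK a ha)
  have h1 : ‖s - a‖ ≤ 1 := by
    rw [Real.norm_eq_abs, abs_of_nonneg (by linarith [hs.1])]
    linarith [hs.2]
  exact h.trans (by nlinarith)

/-- Taylor estimates on a unit interval, for a function and its antiderivative. -/
theorem taylor_estimates {F f f₁ f₂ f₃ : ℝ → ℝ} {a K : ℝ}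
    (hF : ∀ s ∈ Set.Icc a (a + 1), HasDerivAt F (f s) s)
    (hf : ∀ s ∈ Set.Icc a (a + 1), HasDerivAt f (f₁ s) s)
    (hf₁ : ∀ s ∈ Set.Icc a (a + 1), HasDerivAt f₁ (f₂ s) s)
    (hf₂ : ∀ s ∈ Set.Icc a (a + 1), HasDerivAt f₂ (f₃ s) s)
    (hK : ∀ s ∈ Set.Icc a (a + 1), |f₃ s| ≤ K) :
    |f₂ (a + 1) - f₂ a| ≤ K ∧ |f₁ (a + 1) - f₁ a - f₂ a| ≤ K ∧
      |f (a + 1) - f a - f₁ a - f₂ a / 2| ≤ K ∧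
      |F (a + 1) - F a - f a - f₁ a / 2 - f₂ a / 6| ≤ K := by
  have hl : a + 1 ∈ Set.Icc a (a + 1) := ⟨by linarith, le_rfl⟩
  have e₂ : ∀ s ∈ Set.Icc a (a + 1), |f₂ s - f₂ a| ≤ K :=
    fun s hs ↦ abs_sub_le_of_hasDerivAt hf₂ hK hs
  have hid : ∀ s, HasDerivAt (fun s ↦ s - a) 1 s := fun s ↦ (hasDerivAt_id s).sub_const a
  have e₁ : ∀ s ∈ Set.Icc a (a + 1), |f₁ s - f₁ a - (s - a) * f₂ a| ≤ K := by
    intro s hs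
    have := abs_sub_le_of_hasDerivAt (f := fun s ↦ f₁ s - (s - a) * f₂ a)
      (f' := fun s ↦ f₂ s - 1 * f₂ a) (K := K)
      (fun x hx ↦ (hf₁ x hx).sub ((hid x).mul_const _)) (by simpa using e₂) hs
    convert this using 2
    ring
  have e₀ : ∀ s ∈ Set.Icc a (a + 1),
      |f s - f a - (s - a) * f₁ a - (s - a) ^ 2 / 2 * f₂ a| ≤ K := by
    intro s hs
    have := abs_sub_le_of_hasDerivAt
      (f := fun s ↦ f s - (s - a) * f₁ a - (s - a) ^ 2 / 2 * f₂ a)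
      (f' := fun s ↦ f₁ s - 1 * f₁ a - ((2 : ℕ) * (s - a) ^ (2 - 1) * 1) / 2 * f₂ a) (K := K)
      (fun x hx ↦ ((hf x hx).sub ((hid x).mul_const _)).sub
        ((((hid x).pow 2).div_const 2).mul_const _)) (fun x hx ↦ by
          convert e₁ x hx using 2
          push_cast; ring) hs
    convert this using 2
    ring
  have eF : ∀ s ∈ Set.Icc a (a + 1),
      |F s - F a - (s - a) * f a - (s - a) ^ 2 / 2 * f₁ a - (s - a) ^ 3 / 6 * f₂ a| ≤ K := by
    intro s hs
    have := abs_sub_le_of_hasDerivAt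
      (f := fun s ↦ F s - (s - a) * f a - (s - a) ^ 2 / 2 * f₁ a - (s - a) ^ 3 / 6 * f₂ a)
      (f' := fun s ↦ f s - 1 * f a - ((2 : ℕ) * (s - a) ^ (2 - 1) * 1) / 2 * f₁ a -
        ((3 : ℕ) * (s - a) ^ (3 - 1) * 1) / 6 * f₂ a) (K := K)
      (fun x hx ↦ (((hF x hx).sub ((hid x).mul_const _)).sub
        ((((hid x).pow 2).div_const 2).mul_const _)).sub
        ((((hid x).pow 3).div_const 6).mul_const _)) (fun x hx ↦ by
          convert e₀ x hx using 2
          push_cast; ring) hs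
    convert this using 2
    ring
  refine ⟨e₂ _ hl, ?_, ?_, ?_⟩
  · convert e₁ _ hl using 2; ring
  · convert e₀ _ hl using 2; ring
  · convert eF _ hl using 2; ring

/-- The mean value of a `q`-periodic sequence. -/
noncomputable def mean (q : ℕ) (c : ℕ → ℝ) : ℝ := (∑ i ∈ range q, c i) / q

/-- The Euler–Maclaurin coefficient of the function values of a `q`-periodic sequence. -/
noncomputable def coeff₀ (q : ℕ) (c : ℕ → ℝ) (n : ℕ) : ℝ :=
  ∑ i ∈ range q, c (n + i) * (i / q - 1 / 2)

/-- The Euler–Maclaurin coefficient of the first derivatives. -/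
noncomputable def coeff₁ (q : ℕ) (c : ℕ → ℝ) (n : ℕ) : ℝ :=
  ∑ i ∈ range q, c (n + i) * (q / 2 * ((i / q) ^ 2 - i / q + 1 / 6))

/-- The Euler–Maclaurin coefficient of the second derivatives. -/
noncomputable def coeff₂ (q : ℕ) (c : ℕ → ℝ) (n : ℕ) : ℝ :=
  ∑ i ∈ range q, c (n + i) * (q ^ 2 / 6 * ((i / q) ^ 3 - 3 / 2 * (i / q) ^ 2 + 1 / 2 * (i / q)))

section Coeff

variable {q : ℕ} {c : ℕ → ℝ}

theorem sum_range_succ_shift (hc : ∀ n, c (n + q) = c n) (b : ℝ → ℝ) (n : ℕ) :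
    ∑ i ∈ range q, c (n + 1 + i) * b i =
      ∑ i ∈ range q, c (n + i) * b (i - 1) + c n * (b (q - 1) - b (-1)) := by
  have h := sum_range_succ' (fun i ↦ c (n + i) * b (i - 1)) q
  rw [sum_range_succ, hc] at h
  have h2 : ∀ i ∈ range q, c (n + 1 + i) * b i = c (n + (i + 1)) * b ((i + 1 : ℕ) - 1) := by
    intro i _
    push_cast
    rw [add_sub_cancel_right, add_right_comm, add_assoc]
  rw [sum_congr rfl h2]
  simp only [Nat.cast_zero, add_zero, zero_sub] at h
  linarith

theorem sum_range_shift (hc : ∀ n, c (n + q) = c n) (n : ℕ) :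
    ∑ i ∈ range q, c (n + i) = ∑ i ∈ range q, c i := by
  induction n with
  | zero => simp
  | succ n ih =>
    have := sum_range_succ_shift hc (fun _ ↦ 1) n
    simpa [ih] using this

theorem coeff₀_succ (hq : q ≠ 0) (hc : ∀ n, c (n + q) = c n) (n : ℕ) :
    mean q c + coeff₀ q c (n + 1) - coeff₀ q c n = c n := by
  have hq' : (q : ℝ) ≠ 0 := by exact_mod_cast hq
  rw [coeff₀, coeff₀, sum_range_succ_shift hc (fun s ↦ s / q - 1 / 2) n, mean,
    ← sum_range_shift hc n, sum_div]
  have : ∀ A B C D : ℝ, A + (B + D) - C = A + B - C + D := by intros; ring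
  rw [this, ← sum_add_distrib, ← sum_sub_distrib, sum_eq_zero, zero_add]
  · field_simp; ring
  · intro i _; field_simp; ring

theorem coeff₁_succ (hq : q ≠ 0) (hc : ∀ n, c (n + q) = c n) (n : ℕ) :
    mean q c / 2 + coeff₀ q c (n + 1) + coeff₁ q c (n + 1) - coeff₁ q c n = 0 := by
  have hq' : (q : ℝ) ≠ 0 := by exact_mod_cast hq
  rw [coeff₀, coeff₁, coeff₁, sum_range_succ_shift hc (fun s ↦ s / q - 1 / 2) n,
    sum_range_succ_shift hc (fun s ↦ q / 2 * ((s / q) ^ 2 - s / q + 1 / 6)) n, mean,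
    ← sum_range_shift hc n, sum_div, sum_div]
  have : ∀ A B C D E F : ℝ, A + (B + D) + (C + E) - F = A + B + C - F + (D + E) := by intros; ring
  rw [this, ← sum_add_distrib, ← sum_add_distrib, ← sum_sub_distrib, sum_eq_zero, zero_add]
  · field_simp; ring
  · intro i _; field_simp; ring

theorem coeff₂_succ (hq : q ≠ 0) (hc : ∀ n, c (n + q) = c n) (n : ℕ) :
    mean q c / 6 + coeff₀ q c (n + 1) / 2 + coeff₁ q c (n + 1) + coeff₂ q c (n + 1) -
      coeff₂ q c n = 0 := by
  have hq' : (q : ℝ) ≠ 0 := by exact_mod_cast hq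
  rw [coeff₀, coeff₁, coeff₂, coeff₂, sum_range_succ_shift hc (fun s ↦ s / q - 1 / 2) n,
    sum_range_succ_shift hc (fun s ↦ q / 2 * ((s / q) ^ 2 - s / q + 1 / 6)) n,
    sum_range_succ_shift hc
      (fun s ↦ q ^ 2 / 6 * ((s / q) ^ 3 - 3 / 2 * (s / q) ^ 2 + 1 / 2 * (s / q))) n, mean,
    ← sum_range_shift hc n, sum_div, sum_div, add_div, sum_div]
  have : ∀ A B C D E F G H : ℝ, A + (B + E) + (C + F) + (D + G) - H =
    A + B + C + D - H + (E + F + G) := by intros; ring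
  rw [this, ← sum_add_distrib, ← sum_add_distrib, ← sum_add_distrib, ← sum_sub_distrib,
    sum_eq_zero, zero_add]
  · field_simp; ring
  · intro i _; field_simp; ring

theorem abs_sum_le_of_le {M : ℝ} (hM : ∀ n, |c n| ≤ M) (b : ℕ → ℝ) (n : ℕ) :
    |∑ i ∈ range q, c (n + i) * b i| ≤ M * ∑ i ∈ range q, |b i| := by
  rw [mul_sum]
  refine (abs_sum_le_sum_abs _ _).trans (sum_le_sum fun i _ ↦ ?_)
  rw [abs_mul]
  exact mul_le_mul_of_nonneg_right (hM _) (abs_nonneg _)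

/-- The Euler–Maclaurin coefficients are bounded by a multiple of the sequence depending only
on the period. -/
theorem exists_coeff_bound (q : ℕ) : ∃ C : ℝ, 0 < C ∧ ∀ (c : ℕ → ℝ) (M : ℝ), (∀ n, |c n| ≤ M) →
    |mean q c| ≤ C * M ∧
    ∀ n, |coeff₀ q c n| ≤ C * M ∧ |coeff₁ q c n| ≤ C * M ∧ |coeff₂ q c n| ≤ C * M := by
  set s₀ := ∑ i ∈ range q, |(i : ℝ) / q - 1 / 2|
  set s₁ := ∑ i ∈ range q, |(q : ℝ) / 2 * ((i / q) ^ 2 - i / q + 1 / 6)|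
  set s₂ := ∑ i ∈ range q, |(q : ℝ) ^ 2 / 6 * ((i / q) ^ 3 - 3 / 2 * (i / q) ^ 2 + 1 / 2 * (i / q))|
  have h₀ : 0 ≤ s₀ := sum_nonneg fun _ _ ↦ abs_nonneg _
  have h₁ : 0 ≤ s₁ := sum_nonneg fun _ _ ↦ abs_nonneg _
  have h₂ : 0 ≤ s₂ := sum_nonneg fun _ _ ↦ abs_nonneg _
  refine ⟨1 + s₀ + s₁ + s₂, by positivity, fun c M hM ↦ ?_⟩
  have hM0 : 0 ≤ M := (abs_nonneg _).trans (hM 0)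
  refine ⟨?_, fun n ↦ ⟨?_, ?_, ?_⟩⟩
  · have : |∑ i ∈ range q, c i| ≤ q * M := by
      refine (abs_sum_le_sum_abs _ _).trans ((sum_le_sum fun i _ ↦ hM i).trans ?_)
      simp
    rw [mean, abs_div, Nat.abs_cast]
    have h4 : |∑ i ∈ range q, c i| / q ≤ M := by
      rcases Nat.eq_zero_or_pos q with h | h
      · simp [h, hM0]
      · rw [div_le_iff₀ (by exact_mod_cast h)]; linarith
    nlinarith
  all_goals
    refine (abs_sum_le_of_le hM _ n).trans ?_
    nlinarith

end Coeff

/-- The Euler–Maclaurin formula for a periodic weight, with a third order remainder. -/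
theorem abs_sum_range_sub_le (q : ℕ) (hq : q ≠ 0) : ∃ C : ℝ, 0 < C ∧
    ∀ (c : ℕ → ℝ) (M : ℝ), (∀ n, c (n + q) = c n) → (∀ n, |c n| ≤ M) →
    ∀ (F f f₁ f₂ f₃ : ℝ → ℝ) (N : ℕ) (K : ℕ → ℝ),
    (∀ s ∈ Set.Icc (0 : ℝ) N, HasDerivAt F (f s) s) →
    (∀ s ∈ Set.Icc (0 : ℝ) N, HasDerivAt f (f₁ s) s) →
    (∀ s ∈ Set.Icc (0 : ℝ) N, HasDerivAt f₁ (f₂ s) s) →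
    (∀ s ∈ Set.Icc (0 : ℝ) N, HasDerivAt f₂ (f₃ s) s) →
    (∀ n < N, ∀ s ∈ Set.Icc (n : ℝ) (n + 1), |f₃ s| ≤ K n) →
    |∑ n ∈ range N, c n * f n - (mean q c * (F N - F 0) +
      (coeff₀ q c N * f N - coeff₀ q c 0 * f 0) + (coeff₁ q c N * f₁ N - coeff₁ q c 0 * f₁ 0) +
      (coeff₂ q c N * f₂ N - coeff₂ q c 0 * f₂ 0))| ≤ C * M * ∑ n ∈ range N, K n := by
  obtain ⟨C, hC, hb⟩ := exists_coeff_bound q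
  refine ⟨4 * C, by positivity, ?_⟩
  intro c M hc hM F f f₁ f₂ f₃ N K hF hf hf₁ hf₂ hK
  obtain ⟨hm, hb⟩ := hb c M hM
  induction N with
  | zero => simp
  | succ N ih =>
    have hsub : Set.Icc (0 : ℝ) N ⊆ Set.Icc (0 : ℝ) (N + 1 : ℕ) :=
      Set.Icc_subset_Icc_right (by push_cast; linarith)
    have hsub' : Set.Icc (N : ℝ) (N + 1) ⊆ Set.Icc (0 : ℝ) (N + 1 : ℕ) := by
      push_cast
      exact Set.Icc_subset_Icc_left (Nat.cast_nonneg N)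
    specialize ih (fun s hs ↦ hF s (hsub hs)) (fun s hs ↦ hf s (hsub hs))
      (fun s hs ↦ hf₁ s (hsub hs)) (fun s hs ↦ hf₂ s (hsub hs))
      (fun n hn ↦ hK n (hn.trans (Nat.lt_succ_self N)))
    obtain ⟨t₂, t₁, t₀, tF⟩ := taylor_estimates (fun s hs ↦ hF s (hsub' hs))
      (fun s hs ↦ hf s (hsub' hs)) (fun s hs ↦ hf₁ s (hsub' hs)) (fun s hs ↦ hf₂ s (hsub' hs))
      (hK N (Nat.lt_succ_self N))
    rw [sum_range_succ, sum_range_succ, mul_add]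
    obtain ⟨b₀, b₁, b₂⟩ := hb (N + 1)
    have hMC : 0 ≤ C * M := (abs_nonneg _).trans hm
    have prod : ∀ u v : ℝ, |u| ≤ C * M → |v| ≤ K N → |u * v| ≤ C * M * K N := fun u v hu hv ↦ by
      rw [abs_mul]
      exact mul_le_mul hu hv (abs_nonneg _) hMC
    have r₀ := prod _ _ b₀ t₀
    have r₁ := prod _ _ b₁ t₁
    have r₂ := prod _ _ b₂ t₂
    have rm := prod _ _ hm tF
    have key : ∑ n ∈ range N, c n * f n + c N * f N - (mean q c * (F (N + 1 : ℕ) - F 0) +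
        (coeff₀ q c (N + 1) * f (N + 1 : ℕ) - coeff₀ q c 0 * f 0) +
        (coeff₁ q c (N + 1) * f₁ (N + 1 : ℕ) - coeff₁ q c 0 * f₁ 0) +
        (coeff₂ q c (N + 1) * f₂ (N + 1 : ℕ) - coeff₂ q c 0 * f₂ 0)) =
      (∑ n ∈ range N, c n * f n - (mean q c * (F N - F 0) +
        (coeff₀ q c N * f N - coeff₀ q c 0 * f 0) + (coeff₁ q c N * f₁ N - coeff₁ q c 0 * f₁ 0) +
        (coeff₂ q c N * f₂ N - coeff₂ q c 0 * f₂ 0))) -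
      (mean q c * (F (N + 1) - F N - f N - f₁ N / 2 - f₂ N / 6) +
        coeff₀ q c (N + 1) * (f (N + 1) - f N - f₁ N - f₂ N / 2) +
        coeff₁ q c (N + 1) * (f₁ (N + 1) - f₁ N - f₂ N) +
        coeff₂ q c (N + 1) * (f₂ (N + 1) - f₂ N)) := by
      push_cast
      linear_combination (-f N) * coeff₀_succ hq hc N - f₁ N * coeff₁_succ hq hc N -
        f₂ N * coeff₂_succ hq hc N
    rw [key]
    rw [abs_le] at *
    constructor <;> linarith [r₀.1, r₀.2, r₁.1, r₁.2, r₂.1, r₂.2, rm.1, rm.2, ih.1, ih.2]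

end EulerMaclaurin

namespace EulerMaclaurin

open Finset Filter Topology

theorem sum_range_exp_le {h : ℝ} (hh : 0 < h) (N : ℕ) :
    ∑ n ∈ range N, Real.exp (-(h * n)) ≤ 1 + 1 / h := by
  have h1 : ∀ n : ℕ, Real.exp (-(h * n)) = Real.exp (-h) ^ n := fun n ↦ by
    rw [← Real.exp_nat_mul]; ring_nf
  have h2 : Real.exp (-h) < 1 := by rw [Real.exp_lt_one_iff]; linarith
  simp only [h1]
  refine ((summable_geometric_of_lt_one (Real.exp_pos _).le h2).sum_le_tsum _
    fun _ _ ↦ by positivity).trans ?_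
  rw [tsum_geometric_of_lt_one (Real.exp_pos _).le h2, inv_le_comm₀ (by linarith) (by positivity)]
  have h3 : Real.exp (-h) ≤ (1 + h)⁻¹ := by
    rw [Real.exp_neg]
    exact inv_anti₀ (by linarith) (by linarith [Real.add_one_le_exp h])
  have h4 : (1 + 1 / h)⁻¹ = 1 - (1 + h)⁻¹ := by field_simp; ring
  linarith

theorem summable_exp_neg_mul {h : ℝ} (hh : 0 < h) :
    Summable fun n : ℕ ↦ Real.exp (-(h * n)) := by
  have := Real.summable_exp_nat_mul_iff (a := -h) |>.mpr (by linarith)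
  convert this using 2
  ring_nf

/-- The Euler–Maclaurin expansion of a periodically weighted sum of a rescaled function. -/
theorem abs_tsum_sub_le (q : ℕ) (hq : q ≠ 0) : ∃ C : ℝ, 0 < C ∧
    ∀ (c : ℕ → ℝ) (M : ℝ), (∀ n, c (n + q) = c n) → (∀ n, |c n| ≤ M) →
    ∀ (G g g₁ g₂ g₃ : ℝ → ℝ) (L A : ℝ),
    (∀ s, HasDerivAt G (g s) s) → (∀ s, HasDerivAt g (g₁ s) s) →
    (∀ s, HasDerivAt g₁ (g₂ s) s) → (∀ s, HasDerivAt g₂ (g₃ s) s) →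
    (∀ s, 0 ≤ s → |g s| ≤ A * Real.exp (-s)) → (∀ s, 0 ≤ s → |g₁ s| ≤ A * Real.exp (-s)) →
    (∀ s, 0 ≤ s → |g₂ s| ≤ A * Real.exp (-s)) → (∀ s, 0 ≤ s → |g₃ s| ≤ A * Real.exp (-s)) →
    Tendsto G atTop (𝓝 L) → ∀ h : ℝ, 0 < h → h ≤ 1 →
    |∑' n : ℕ, c n * g (h * n) - (mean q c * ((L - G 0) / h) - coeff₀ q c 0 * g 0 -
      h * (coeff₁ q c 0 * g₁ 0))| ≤ C * M * A * h ^ 2 := by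
  obtain ⟨C₁, hC₁, H₁⟩ := abs_sum_range_sub_le q hq
  obtain ⟨C₂, hC₂, H₂⟩ := exists_coeff_bound q
  refine ⟨2 * C₁ + C₂, by positivity, ?_⟩
  intro c M hc hM G g g₁ g₂ g₃ L A hG hg hg₁ hg₂ bg bg₁ bg₂ bg₃ hL h hh hh1
  obtain ⟨-, H₂⟩ := H₂ c M hM
  have hM0 : 0 ≤ M := (abs_nonneg _).trans (hM 0)
  have hA0 : 0 ≤ A := by
    have := (abs_nonneg _).trans (bg 0 le_rfl)
    simpa using this
  have hlin : ∀ s, HasDerivAt (fun s : ℝ ↦ h * s) h s := fun s ↦ by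
    simpa using (hasDerivAt_id s).const_mul h
  have hexp : Tendsto (fun N : ℕ ↦ Real.exp (-(h * N))) atTop (𝓝 0) :=
    (summable_exp_neg_mul hh).tendsto_atTop_zero
  have hsum : Summable fun n : ℕ ↦ c n * g (h * n) := by
    refine Summable.of_norm_bounded (((summable_exp_neg_mul hh).mul_left A).mul_left M) fun n ↦ ?_
    rw [norm_mul]
    exact mul_le_mul (hM n) (bg _ (by positivity)) (abs_nonneg _) hM0
  have bdry : ∀ (a : ℕ → ℝ) (u : ℝ → ℝ), (∀ n, |a n| ≤ C₂ * M) →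
      (∀ s, 0 ≤ s → |u s| ≤ A * Real.exp (-s)) →
      Tendsto (fun N : ℕ ↦ a N * u (h * N)) atTop (𝓝 0) := by
    intro a u ha hu
    refine squeeze_zero_norm (a := fun N : ℕ ↦ C₂ * M * (A * Real.exp (-(h * N)))) (fun n ↦ ?_) ?_
    · rw [norm_mul]
      exact mul_le_mul (ha n) (hu _ (by positivity)) (abs_nonneg _) (by positivity)
    · simpa using (hexp.const_mul A).const_mul (C₂ * M)
  have l₀ := bdry (coeff₀ q c) g (fun n ↦ (H₂ n).1) bg
  have l₁ := (bdry (coeff₁ q c) g₁ (fun n ↦ (H₂ n).2.1) bg₁).const_mul h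
  have l₂ := (bdry (coeff₂ q c) g₂ (fun n ↦ (H₂ n).2.2) bg₂).const_mul (h ^ 2)
  have lG : Tendsto (fun N : ℕ ↦ G (h * N) / h) atTop (𝓝 (L / h)) :=
    (hL.comp (tendsto_natCast_atTop_atTop.const_mul_atTop hh)).div_const h
  have key : ∀ N : ℕ, |∑ n ∈ range N, c n * g (h * n) -
      (mean q c * (G (h * N) / h - G 0 / h) + (coeff₀ q c N * g (h * N) - coeff₀ q c 0 * g 0) +
      (h * (coeff₁ q c N * g₁ (h * N)) - h * (coeff₁ q c 0 * g₁ 0)) +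
      (h ^ 2 * (coeff₂ q c N * g₂ (h * N)) - h ^ 2 * (coeff₂ q c 0 * g₂ 0)))| ≤
      2 * C₁ * M * A * h ^ 2 := by
    intro N
    have := H₁ c M hc hM (fun s ↦ G (h * s) / h) (fun s ↦ g (h * s)) (fun s ↦ g₁ (h * s) * h)
      (fun s ↦ g₂ (h * s) * h * h) (fun s ↦ g₃ (h * s) * h * h * h) N
      (fun n ↦ A * h ^ 3 * Real.exp (-(h * n)))
      (fun s _ ↦ by
        have := ((hG (h * s)).comp s (hlin s)).div_const h
        rwa [mul_div_cancel_right₀ _ hh.ne'] at this)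
      (fun s _ ↦ (hg (h * s)).comp s (hlin s))
      (fun s _ ↦ ((hg₁ (h * s)).comp s (hlin s)).mul_const h)
      (fun s _ ↦ (((hg₂ (h * s)).comp s (hlin s)).mul_const h).mul_const h)
      (fun n _ s hs ↦ by
        have h0 : (0 : ℝ) ≤ s := (Nat.cast_nonneg n).trans hs.1
        have h1 : |g₃ (h * s)| ≤ A * Real.exp (-(h * n)) := by
          refine (bg₃ _ (by positivity)).trans (mul_le_mul_of_nonneg_left ?_ hA0)
          exact Real.exp_le_exp.mpr (neg_le_neg (mul_le_mul_of_nonneg_left hs.1 hh.le))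
        rw [mul_assoc, mul_assoc, abs_mul, abs_of_pos (by positivity : 0 < h * (h * h))]
        calc _ ≤ A * Real.exp (-(h * n)) * (h * (h * h)) :=
              mul_le_mul_of_nonneg_right h1 (by positivity)
          _ = _ := by ring)
    rw [← mul_sum] at this
    have h2 := sum_range_exp_le hh N
    have h3 : C₁ * M * (A * h ^ 3 * ∑ n ∈ range N, Real.exp (-(h * n))) ≤
        2 * C₁ * M * A * h ^ 2 := by
      have h4 : ∑ n ∈ range N, Real.exp (-(h * n)) ≤ 2 / h := by
        refine h2.trans ?_
        rw [le_div_iff₀ hh]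
        field_simp
        linarith
      calc _ ≤ C₁ * M * (A * h ^ 3 * (2 / h)) := by gcongr
        _ = _ := by field_simp
    refine le_trans (le_of_eq ?_) (this.trans h3)
    congr 1
    simp only [mul_zero]
    ring
  have hlim := ((hsum.hasSum.tendsto_sum_nat).sub ((((lG.sub_const (G 0 / h)).const_mul
    (mean q c)).add (l₀.sub_const (coeff₀ q c 0 * g 0))).add
    (l₁.sub_const (h * (coeff₁ q c 0 * g₁ 0))) |>.add
    (l₂.sub_const (h ^ 2 * (coeff₂ q c 0 * g₂ 0))))).abs
  have hle := le_of_tendsto' hlim key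
  have h5 : |h ^ 2 * (coeff₂ q c 0 * g₂ 0)| ≤ C₂ * M * A * h ^ 2 := by
    have h6 : |coeff₂ q c 0 * g₂ 0| ≤ C₂ * M * A := by
      rw [abs_mul]
      have := bg₂ 0 le_rfl
      rw [neg_zero, Real.exp_zero, mul_one] at this
      exact mul_le_mul (H₂ 0).2.2 this (abs_nonneg _) (by positivity)
    rw [abs_mul, abs_of_nonneg (by positivity : (0 : ℝ) ≤ h ^ 2)]
    nlinarith [sq_nonneg h]
  have h7 := (abs_sub _ _).trans (add_le_add hle h5)
  refine le_trans (le_of_eq ?_) (h7.trans (le_of_eq ?_))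
  · congr 1; ring
  · ring

end EulerMaclaurin

namespace EulerMaclaurin

open Finset Filter Topology

/-- The Euler–Maclaurin expansion when the weights have mean zero. -/
theorem abs_tsum_add_le_of_mean_eq_zero {q : ℕ} (hq : q ≠ 0) {c : ℕ → ℝ} {M : ℝ}
    (hc : ∀ n, c (n + q) = c n) (hM : ∀ n, |c n| ≤ M) (hmean : mean q c = 0)
    {g g₁ g₂ g₃ : ℝ → ℝ} {A : ℝ} (hg : ∀ s, HasDerivAt g (g₁ s) s)
    (hg₁ : ∀ s, HasDerivAt g₁ (g₂ s) s) (hg₂ : ∀ s, HasDerivAt g₂ (g₃ s) s)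
    (bg : ∀ s, 0 ≤ s → |g s| ≤ A * Real.exp (-s)) (bg₁ : ∀ s, 0 ≤ s → |g₁ s| ≤ A * Real.exp (-s))
    (bg₂ : ∀ s, 0 ≤ s → |g₂ s| ≤ A * Real.exp (-s))
    (bg₃ : ∀ s, 0 ≤ s → |g₃ s| ≤ A * Real.exp (-s)) :
    ∃ C : ℝ, ∀ h : ℝ, 0 < h → h ≤ 1 →
      |∑' n : ℕ, c n * g (h * n) + coeff₀ q c 0 * g 0 + h * (coeff₁ q c 0 * g₁ 0)| ≤
        C * h ^ 2 := by
  obtain ⟨C, hC, H⟩ := abs_tsum_sub_le q hq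
  have hcont : Continuous g := continuous_iff_continuousAt.mpr fun s ↦ (hg s).continuousAt
  have h_int : MeasureTheory.IntegrableOn g (Set.Ioi 0) := by
    refine MeasureTheory.Integrable.mono' (g := fun s ↦ A * Real.exp (-s))
      ((integrableOn_exp_neg_Ioi 0).const_mul A) hcont.aestronglyMeasurable ?_
    filter_upwards [MeasureTheory.ae_restrict_mem measurableSet_Ioi] with s hs
    exact bg s (le_of_lt hs)
  have hlim := MeasureTheory.intervalIntegral_tendsto_integral_Ioi 0 h_int tendsto_id
  refine ⟨C * M * A, fun h hh hh1 ↦ ?_⟩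
  have := H c M hc hM (fun u ↦ ∫ s in (0 : ℝ)..u, g s) g g₁ g₂ g₃ _ A
    (fun s ↦ (hcont.integral_hasStrictDerivAt 0 s).hasDerivAt) hg hg₁ hg₂ bg bg₁ bg₂ bg₃ hlim
    h hh hh1
  rw [hmean, zero_mul, zero_sub] at this
  refine le_trans (le_of_eq (congrArg _ ?_)) this
  ring

theorem tendsto_tsum_of_mean_eq_zero {q : ℕ} (hq : q ≠ 0) {c : ℕ → ℝ} {M : ℝ}
    (hc : ∀ n, c (n + q) = c n) (hM : ∀ n, |c n| ≤ M) (hmean : mean q c = 0)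
    {g g₁ g₂ g₃ : ℝ → ℝ} {A : ℝ} (hg : ∀ s, HasDerivAt g (g₁ s) s)
    (hg₁ : ∀ s, HasDerivAt g₁ (g₂ s) s) (hg₂ : ∀ s, HasDerivAt g₂ (g₃ s) s)
    (bg : ∀ s, 0 ≤ s → |g s| ≤ A * Real.exp (-s)) (bg₁ : ∀ s, 0 ≤ s → |g₁ s| ≤ A * Real.exp (-s))
    (bg₂ : ∀ s, 0 ≤ s → |g₂ s| ≤ A * Real.exp (-s))
    (bg₃ : ∀ s, 0 ≤ s → |g₃ s| ≤ A * Real.exp (-s)) :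
    Tendsto (fun h : ℝ ↦ ∑' n : ℕ, c n * g (h * n)) (𝓝[>] 0) (𝓝 (-(coeff₀ q c 0 * g 0))) := by
  obtain ⟨C, H⟩ := abs_tsum_add_le_of_mean_eq_zero hq hc hM hmean hg hg₁ hg₂ bg bg₁ bg₂ bg₃
  rw [tendsto_iff_norm_sub_tendsto_zero]
  have h0 : Tendsto (fun h : ℝ ↦ C * h ^ 2 + h * |coeff₁ q c 0 * g₁ 0|) (𝓝[>] 0) (𝓝 0) := by
    have : Continuous fun h : ℝ ↦ C * h ^ 2 + h * |coeff₁ q c 0 * g₁ 0| := by fun_prop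
    have h3 := (this.tendsto 0).mono_left (nhdsWithin_le_nhds (s := Set.Ioi 0))
    simpa using h3
  refine squeeze_zero' (Eventually.of_forall fun _ ↦ norm_nonneg _) ?_ h0
  filter_upwards [Ioc_mem_nhdsGT (zero_lt_one' ℝ)] with h hh
  have h2 : h * |coeff₁ q c 0 * g₁ 0| = |h * (coeff₁ q c 0 * g₁ 0)| := by
    rw [abs_mul h, abs_of_pos hh.1]
  rw [h2]
  refine le_trans ?_ ((abs_sub _ _).trans (add_le_add_left (H h hh.1 hh.2) _))
  refine le_of_eq (congrArg _ ?_)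
  ring

theorem pow_mul_exp_neg_sq_le {j : ℕ} (hj : j ≤ 4) {s : ℝ} (hs : 0 ≤ s) :
    s ^ j * Real.exp (-s ^ 2) ≤ 72 * Real.exp (-s) := by
  have h1 : s ^ j ≤ 24 * Real.exp s := by
    have := Real.pow_div_factorial_le_exp s hs j
    rw [div_le_iff₀ (by positivity)] at this
    refine this.trans ?_
    rw [mul_comm]
    refine mul_le_mul_of_nonneg_right ?_ (Real.exp_pos _).le
    exact_mod_cast (Nat.factorial_le hj)
  have h2 : Real.exp s * Real.exp (-s ^ 2) ≤ 3 * Real.exp (-s) := by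
    have h3 : Real.exp s * Real.exp (-s ^ 2) = Real.exp (2 * s - s ^ 2) * Real.exp (-s) := by
      rw [← Real.exp_add, ← Real.exp_add]; ring_nf
    rw [h3]
    refine mul_le_mul_of_nonneg_right ?_ (Real.exp_pos _).le
    have h4 : Real.exp (2 * s - s ^ 2) ≤ Real.exp 1 :=
      Real.exp_le_exp.mpr (by nlinarith [sq_nonneg (s - 1)])
    linarith [Real.exp_one_lt_three]
  calc s ^ j * Real.exp (-s ^ 2) ≤ 24 * Real.exp s * Real.exp (-s ^ 2) := by gcongr
    _ ≤ _ := by linarith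

theorem exp_neg_sq_bounds {s : ℝ} (hs : 0 ≤ s) (a b c : ℝ) (i : ℕ) (hi : i ≤ 2) :
    |s ^ i * (a + b * s + c * s ^ 2) * Real.exp (-s ^ 2)| ≤
      72 * (|a| + |b| + |c|) * Real.exp (-s) := by
  have h0 := pow_mul_exp_neg_sq_le (show i ≤ 4 by omega) hs
  have h1 := pow_mul_exp_neg_sq_le (show i + 1 ≤ 4 by omega) hs
  have h2 := pow_mul_exp_neg_sq_le (show i + 2 ≤ 4 by omega) hs
  have e : s ^ i * (a + b * s + c * s ^ 2) * Real.exp (-s ^ 2) = a * (s ^ i * Real.exp (-s ^ 2)) +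
      b * (s ^ (i + 1) * Real.exp (-s ^ 2)) + c * (s ^ (i + 2) * Real.exp (-s ^ 2)) := by ring
  rw [e]
  refine (abs_add_three _ _ _).trans ?_
  rw [abs_mul a, abs_mul b, abs_mul c, abs_of_nonneg (a := s ^ i * _) (by positivity),
    abs_of_nonneg (a := s ^ (i + 1) * _) (by positivity),
    abs_of_nonneg (a := s ^ (i + 2) * _) (by positivity)]
  have := mul_le_mul_of_nonneg_left h0 (abs_nonneg a)
  have := mul_le_mul_of_nonneg_left h1 (abs_nonneg b)
  have := mul_le_mul_of_nonneg_left h2 (abs_nonneg c)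
  linarith

theorem exp_neg_sq_bound {s : ℝ} (hs : 0 ≤ s) {a b c A : ℝ} {i : ℕ} (hi : i ≤ 2) {v : ℝ}
    (hv : v = s ^ i * (a + b * s + c * s ^ 2) * Real.exp (-s ^ 2))
    (hA : 72 * (|a| + |b| + |c|) ≤ A) : |v| ≤ A * Real.exp (-s) := by
  rw [hv]
  exact (exp_neg_sq_bounds hs a b c i hi).trans
    (mul_le_mul_of_nonneg_right hA (Real.exp_pos _).le)

theorem hasDerivAt_exp_neg_sq (s : ℝ) :
    HasDerivAt (fun s ↦ Real.exp (-s ^ 2)) (-2 * s * Real.exp (-s ^ 2)) s := by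
  have h : HasDerivAt (fun s : ℝ ↦ -s ^ 2) (-(2 * s)) s := by
    exact (hasDerivAt_pow 2 s).neg.congr_deriv (by norm_num)
  exact h.exp.congr_deriv (by ring)

theorem hasDerivAt_mul_exp_neg_sq {u : ℝ → ℝ} {u' s : ℝ} (hu : HasDerivAt u u' s) {v : ℝ}
    (hv : v = (u' - 2 * s * u s) * Real.exp (-s ^ 2)) :
    HasDerivAt (fun s ↦ u s * Real.exp (-s ^ 2)) v s := by
  exact (hu.mul (hasDerivAt_exp_neg_sq s)).congr_deriv (by rw [hv]; ring)

theorem tendsto_sqrt_nhdsGT : Tendsto Real.sqrt (𝓝[>] 0) (𝓝[>] 0) := by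
  refine tendsto_nhdsWithin_iff.mpr ⟨?_, ?_⟩
  · have := (Real.continuous_sqrt.tendsto 0).mono_left (nhdsWithin_le_nhds (s := Set.Ioi 0))
    rwa [Real.sqrt_zero] at this
  · filter_upwards [self_mem_nhdsWithin] with t ht
    exact Real.sqrt_pos.mpr ht

section Gauss

variable {q : ℕ} {c : ℕ → ℝ} {M : ℝ}

theorem tendsto_tsum_mul_exp (hq : q ≠ 0) (hc : ∀ n, c (n + q) = c n) (hM : ∀ n, |c n| ≤ M)
    (hmean : mean q c = 0) :
    Tendsto (fun t : ℝ ↦ ∑' n : ℕ, c n * Real.exp (-(t * n ^ 2))) (𝓝[>] 0)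
      (𝓝 (-coeff₀ q c 0)) := by
  have h := (tendsto_tsum_of_mean_eq_zero hq hc hM hmean (A := 10000)
    (g := fun s ↦ Real.exp (-s ^ 2)) (g₁ := fun s ↦ (-2 * s) * Real.exp (-s ^ 2))
    (g₂ := fun s ↦ (-2 + 4 * s ^ 2) * Real.exp (-s ^ 2))
    (g₃ := fun s ↦ (12 * s - 8 * s ^ 3) * Real.exp (-s ^ 2)) hasDerivAt_exp_neg_sq
    (fun s ↦ hasDerivAt_mul_exp_neg_sq ((hasDerivAt_id s).const_mul (-2)) (by simp; ring))
    (fun s ↦ hasDerivAt_mul_exp_neg_sq ((((hasDerivAt_id s).pow 2).const_mul 4).const_add (-2))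
      (by simp; ring))
    (fun s hs ↦ exp_neg_sq_bound hs (a := 1) (b := 0) (c := 0) (i := 0) (by norm_num)
      (by ring) (by norm_num))
    (fun s hs ↦ exp_neg_sq_bound hs (a := 0) (b := -2) (c := 0) (i := 0) (by norm_num)
      (by ring) (by norm_num))
    (fun s hs ↦ exp_neg_sq_bound hs (a := -2) (b := 0) (c := 4) (i := 0) (by norm_num)
      (by ring) (by norm_num))
    (fun s hs ↦ exp_neg_sq_bound hs (a := 12) (b := 0) (c := -8) (i := 1) (by norm_num)
      (by ring) (by norm_num))).comp tendsto_sqrt_nhdsGT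
  simp only [ne_eq, OfNat.ofNat_ne_zero, not_false_eq_true, zero_pow, neg_zero, Real.exp_zero,
    mul_one] at h
  refine h.congr' ?_
  filter_upwards [self_mem_nhdsWithin] with t ht
  simp only [Function.comp_apply, mul_pow, Real.sq_sqrt (le_of_lt ht)]

theorem abs_tsum_mul_exp_sub_le (hq : q ≠ 0) (hc : ∀ n, c (n + q) = c n) (hM : ∀ n, |c n| ≤ M) :
    ∃ C : ℝ, ∀ h : ℝ, 0 < h → h ≤ 1 →
      |∑' n : ℕ, c n * (h * n * Real.exp (-(h * n) ^ 2)) -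
        (mean q c / 2 / h - h * coeff₁ q c 0)| ≤ C * h ^ 2 := by
  obtain ⟨C, -, H⟩ := abs_tsum_sub_le q hq
  refine ⟨C * M * 10000, fun h hh hh1 ↦ ?_⟩
  have := H c M hc hM (fun s ↦ (-1 / 2) * Real.exp (-s ^ 2)) (fun s ↦ s * Real.exp (-s ^ 2))
    (fun s ↦ (1 - 2 * s ^ 2) * Real.exp (-s ^ 2)) (fun s ↦ (-6 * s + 4 * s ^ 3) * Real.exp (-s ^ 2))
    (fun s ↦ (-6 + 24 * s ^ 2 - 8 * s ^ 4) * Real.exp (-s ^ 2)) 0 10000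
    (fun s ↦ hasDerivAt_mul_exp_neg_sq (hasDerivAt_const s (-1 / 2)) (by ring))
    (fun s ↦ hasDerivAt_mul_exp_neg_sq (hasDerivAt_id s) (by simp; ring))
    (fun s ↦ hasDerivAt_mul_exp_neg_sq ((((hasDerivAt_id s).pow 2).const_mul 2).const_sub 1)
      (by simp; ring))
    (fun s ↦ hasDerivAt_mul_exp_neg_sq (((hasDerivAt_id s).const_mul (-6)).add
      (((hasDerivAt_id s).pow 3).const_mul 4)) (by simp; ring))
    (fun s hs ↦ exp_neg_sq_bound hs (a := 0) (b := 1) (c := 0) (i := 0) (by norm_num)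
      (by ring) (by norm_num))
    (fun s hs ↦ exp_neg_sq_bound hs (a := 1) (b := 0) (c := -2) (i := 0) (by norm_num)
      (by ring) (by norm_num))
    (fun s hs ↦ exp_neg_sq_bound hs (a := -6) (b := 0) (c := 4) (i := 1) (by norm_num)
      (by ring) (by norm_num))
    (fun s hs ↦ by
      have e : (-6 + 24 * s ^ 2 - 8 * s ^ 4) * Real.exp (-s ^ 2) =
        s ^ 0 * (-6 + 0 * s + 0 * s ^ 2) * Real.exp (-s ^ 2) +
        s ^ 2 * (24 + 0 * s + -8 * s ^ 2) * Real.exp (-s ^ 2) := by ring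
      rw [e]
      refine (abs_add_le _ _).trans ((add_le_add (exp_neg_sq_bounds hs _ _ _ 0 (by norm_num))
        (exp_neg_sq_bounds hs _ _ _ 2 (by norm_num))).trans ?_)
      rw [← add_mul]
      exact mul_le_mul_of_nonneg_right (by norm_num) (Real.exp_pos _).le)
    (by
      have h1 : Tendsto (fun s : ℝ ↦ -s ^ 2) atTop atBot :=
        tendsto_neg_atTop_atBot.comp (tendsto_pow_atTop two_ne_zero)
      simpa using (Real.tendsto_exp_atBot.comp h1).const_mul (-1 / 2 : ℝ)) h hh hh1
  refine le_trans (le_of_eq ?_) this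
  congr 1
  norm_num
  ring

theorem tendsto_tsum_mul_mul_exp (hq : q ≠ 0) (hc : ∀ n, c (n + q) = c n) (hM : ∀ n, |c n| ≤ M) :
    Tendsto (fun t : ℝ ↦ ∑' n : ℕ, c n * (t * n * Real.exp (-(t * n ^ 2)))) (𝓝[>] 0)
      (𝓝 (mean q c / 2)) := by
  obtain ⟨C, H⟩ := abs_tsum_mul_exp_sub_le hq hc hM
  rw [tendsto_iff_norm_sub_tendsto_zero]
  have h0 : Tendsto (fun h : ℝ ↦ C * h ^ 3 + h ^ 2 * |coeff₁ q c 0|) (𝓝[>] 0) (𝓝 0) := by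
    have : Continuous fun h : ℝ ↦ C * h ^ 3 + h ^ 2 * |coeff₁ q c 0| := by fun_prop
    have h3 := (this.tendsto 0).mono_left (nhdsWithin_le_nhds (s := Set.Ioi 0))
    simpa using h3
  refine squeeze_zero' (Eventually.of_forall fun _ ↦ norm_nonneg _) ?_
    (h0.comp tendsto_sqrt_nhdsGT)
  filter_upwards [Ioc_mem_nhdsGT (zero_lt_one' ℝ)] with t ht
  set h := Real.sqrt t
  have hh : 0 < h := Real.sqrt_pos.mpr ht.1
  have hh1 : h ≤ 1 := Real.sqrt_le_one.mpr ht.2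
  have hht : t = h ^ 2 := (Real.sq_sqrt ht.1.le).symm
  have e : ∑' n : ℕ, c n * (t * n * Real.exp (-(t * n ^ 2))) =
      h * ∑' n : ℕ, c n * (h * n * Real.exp (-(h * n) ^ 2)) := by
    rw [← tsum_mul_left]
    refine tsum_congr fun n ↦ ?_
    rw [hht, mul_pow]; ring
  have H' := mul_le_mul_of_nonneg_left (H h hh hh1) hh.le
  rw [← abs_of_pos hh, ← abs_mul, abs_of_pos hh] at H'
  have h2 : h ^ 2 * |coeff₁ q c 0| = |h ^ 2 * coeff₁ q c 0| := by
    rw [abs_mul, abs_of_pos (by positivity : 0 < h ^ 2)]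
  rw [Function.comp_apply, Real.norm_eq_abs, e, h2]
  have h3 := (abs_sub _ _).trans (add_le_add_left H' |h ^ 2 * coeff₁ q c 0|)
  refine le_trans (le_of_eq ?_) (h3.trans (le_of_eq ?_))
  · congr 1
    field_simp
    ring
  · ring

end Gauss

end EulerMaclaurin

namespace EulerMaclaurin

open Finset Filter Topology

/-- The primitive of `exp (u ^ 2)` vanishing at zero. -/
noncomputable def expSqIntegral (v : ℝ) : ℝ := ∫ u in (0 : ℝ)..v, Real.exp (u ^ 2)

theorem hasDerivAt_expSqIntegral (v : ℝ) :
    HasDerivAt expSqIntegral (Real.exp (v ^ 2)) v :=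
  ((by fun_prop : Continuous fun u : ℝ ↦ Real.exp (u ^ 2)).integral_hasStrictDerivAt 0 v).hasDerivAt

theorem expSqIntegral_zero : expSqIntegral 0 = 0 := by simp [expSqIntegral]

theorem expSqIntegral_neg (v : ℝ) : expSqIntegral (-v) = -expSqIntegral v := by
  have := intervalIntegral.integral_comp_neg (a := 0) (b := v) (fun u : ℝ ↦ Real.exp (u ^ 2))
  simp only [neg_sq, neg_zero] at this
  rw [expSqIntegral, expSqIntegral, this, intervalIntegral.integral_symm]

theorem abs_expSqIntegral_le {v : ℝ} (hv : 0 ≤ v) :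
    |expSqIntegral v| ≤ v * Real.exp (v ^ 2) := by
  have := intervalIntegral.norm_integral_le_of_norm_le_const (a := 0) (b := v)
    (f := fun u : ℝ ↦ Real.exp (u ^ 2)) (C := Real.exp (v ^ 2)) (fun u hu ↦ by
      rw [Set.uIoc_of_le hv] at hu
      rw [Real.norm_eq_abs, abs_of_pos (Real.exp_pos _)]
      exact Real.exp_le_exp.mpr (pow_le_pow_left₀ hu.1.le hu.2 2))
  rw [sub_zero, abs_of_nonneg hv, mul_comm, Real.norm_eq_abs] at this
  exact this

/-- The integral of `exp (-(s ^ 2 + k * s * y - y ^ 2))` over `0 ≤ y ≤ k * s`. -/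
noncomputable def sliceIntegral (k s : ℝ) : ℝ :=
  2 * (Real.exp (-((k ^ 2 + 4) / 4 * s ^ 2)) * expSqIntegral (k * s / 2))

theorem hasDerivAt_sliceIntegral (k s : ℝ) : HasDerivAt (sliceIntegral k)
    (-((k ^ 2 + 4) / 2) * s * sliceIntegral k s + k * Real.exp (-s ^ 2)) s := by
  have h1 : HasDerivAt (fun s : ℝ ↦ -((k ^ 2 + 4) / 4 * s ^ 2)) (-((k ^ 2 + 4) / 4 * (2 * s))) s :=
    (((hasDerivAt_pow 2 s).const_mul ((k ^ 2 + 4) / 4)).neg).congr_deriv (by norm_num)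
  have h2 : HasDerivAt (fun s : ℝ ↦ k * s / 2) (k / 2) s :=
    (((hasDerivAt_id s).const_mul k).div_const 2).congr_deriv (by ring)
  have h3 := (h1.exp.mul ((hasDerivAt_expSqIntegral (k * s / 2)).comp s h2)).const_mul 2
  refine h3.congr_deriv ?_
  have e : Real.exp (-s ^ 2) =
      Real.exp (-((k ^ 2 + 4) / 4 * s ^ 2)) * Real.exp ((k * s / 2) ^ 2) := by
    rw [← Real.exp_add]; congr 1; ring
  rw [e, sliceIntegral, Function.comp_apply]
  ring

theorem abs_sliceIntegral_le {k s : ℝ} (hk : 0 ≤ k) (hs : 0 ≤ s) :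
    |sliceIntegral k s| ≤ k * s * Real.exp (-s ^ 2) := by
  have e : Real.exp (-s ^ 2) =
      Real.exp (-((k ^ 2 + 4) / 4 * s ^ 2)) * Real.exp ((k * s / 2) ^ 2) := by
    rw [← Real.exp_add]; congr 1; ring
  rw [sliceIntegral, abs_mul, abs_mul, abs_of_pos (Real.exp_pos _), abs_two, e]
  have := mul_le_mul_of_nonneg_left (abs_expSqIntegral_le (v := k * s / 2) (by positivity))
    (Real.exp_pos (-((k ^ 2 + 4) / 4 * s ^ 2))).le
  linarith

theorem abs_pow_mul_sliceIntegral_le {k s : ℝ} (hk : 0 ≤ k) (hs : 0 ≤ s) (b : ℝ) {j : ℕ}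
    (hj : j ≤ 3) : |b * (s ^ j * sliceIntegral k s)| ≤ 72 * k * |b| * Real.exp (-s) := by
  have h1 := pow_mul_exp_neg_sq_le (show j + 1 ≤ 4 by omega) hs
  have h2 : s ^ j * |sliceIntegral k s| ≤ k * (72 * Real.exp (-s)) := by
    calc s ^ j * |sliceIntegral k s| ≤ s ^ j * (k * s * Real.exp (-s ^ 2)) := by
          gcongr; exact abs_sliceIntegral_le hk hs
      _ = k * (s ^ (j + 1) * Real.exp (-s ^ 2)) := by ring
      _ ≤ _ := by gcongr
  rw [abs_mul, abs_mul, abs_of_nonneg (pow_nonneg hs j)]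
  have := mul_le_mul_of_nonneg_left h2 (abs_nonneg b)
  linarith

theorem abs_pow_mul_exp_le {s : ℝ} (hs : 0 ≤ s) (b : ℝ) {j : ℕ}
    (hj : j ≤ 4) : |b * (s ^ j * Real.exp (-s ^ 2))| ≤ 72 * |b| * Real.exp (-s) := by
  have h1 := pow_mul_exp_neg_sq_le hj hs
  rw [abs_mul, abs_of_nonneg (a := s ^ j * _) (by positivity)]
  have := mul_le_mul_of_nonneg_left h1 (abs_nonneg b)
  linarith

theorem tendsto_tsum_mul_sliceIntegral {q : ℕ} {c : ℕ → ℝ} {M k : ℝ} (hk : 0 ≤ k) (hq : q ≠ 0)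
    (hc : ∀ n, c (n + q) = c n) (hM : ∀ n, |c n| ≤ M) (hmean : mean q c = 0) :
    Tendsto (fun h : ℝ ↦ ∑' n : ℕ, c n * (sliceIntegral k (h * n) / h)) (𝓝[>] 0)
      (𝓝 (-(k * coeff₁ q c 0))) := by
  set a := (k ^ 2 + 4) / 2 with ha
  have hg : ∀ s, HasDerivAt (sliceIntegral k)
      (-a * s * sliceIntegral k s + k * Real.exp (-s ^ 2)) s := hasDerivAt_sliceIntegral k
  have hg₁ : ∀ s, HasDerivAt (fun s ↦ -a * s * sliceIntegral k s + k * Real.exp (-s ^ 2))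
      ((a ^ 2 * s ^ 2 - a) * sliceIntegral k s + -(a + 2) * k * s * Real.exp (-s ^ 2)) s := fun s ↦
    ((((hasDerivAt_id s).const_mul (-a)).mul (hg s)).add
      ((hasDerivAt_exp_neg_sq s).const_mul k)).congr_deriv (by simp only [id]; ring)
  have hg₂ : ∀ s, HasDerivAt
      (fun s ↦ (a ^ 2 * s ^ 2 - a) * sliceIntegral k s + -(a + 2) * k * s * Real.exp (-s ^ 2))
      ((3 * a ^ 2 * s - a ^ 3 * s ^ 3) * sliceIntegral k s +
        (-(2 * a + 2) * k + (a ^ 2 + 2 * a + 4) * k * s ^ 2) * Real.exp (-s ^ 2)) s := fun s ↦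
    ((((((hasDerivAt_pow 2 s).const_mul (a ^ 2)).sub_const a).mul (hg s)).add
      (((hasDerivAt_id s).const_mul (-(a + 2) * k)).mul (hasDerivAt_exp_neg_sq s)))).congr_deriv
      (by simp only [id]; push_cast; ring)
  set A := 72 * k * (1 + |-a| + |a ^ 2| + |3 * a ^ 2| + |-a ^ 3|) +
    72 * (|k| + |-(a + 2) * k| + |-(2 * a + 2) * k| + |(a ^ 2 + 2 * a + 4) * k|) with hA
  have bS := fun s hs b j hj ↦ abs_pow_mul_sliceIntegral_le (k := k) (s := s) hk hs b (j := j) hj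
  have bE := fun s hs b j hj ↦ abs_pow_mul_exp_le (s := s) hs b (j := j) hj
  obtain ⟨C, H⟩ := abs_tsum_add_le_of_mean_eq_zero hq hc hM hmean (A := A) hg hg₁ hg₂
    (fun s hs ↦ by
      have h1 := bS s hs 1 0 (by norm_num)
      rw [one_mul, pow_zero, one_mul] at h1
      refine h1.trans (mul_le_mul_of_nonneg_right ?_ (Real.exp_pos _).le)
      rw [hA, abs_one]
      have : 0 ≤ 72 * k * (|-a| + |a ^ 2| + |3 * a ^ 2| + |-a ^ 3|) := by positivity
      have : 0 ≤ |k| + |-(a + 2) * k| + |-(2 * a + 2) * k| + |(a ^ 2 + 2 * a + 4) * k| := by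
        positivity
      linarith)
    (fun s hs ↦ by
      have h1 := bS s hs (-a) 1 (by norm_num)
      have h2 := bE s hs k 0 (by norm_num)
      refine le_trans (le_of_eq ?_) ((abs_add_le _ _).trans ((add_le_add h1 h2).trans ?_))
      · congr 1; ring
      rw [← add_mul]
      refine mul_le_mul_of_nonneg_right ?_ (Real.exp_pos _).le
      rw [hA]
      have : 0 ≤ 72 * k * (1 + |a ^ 2| + |3 * a ^ 2| + |-a ^ 3|) := by positivity
      have : 0 ≤ |-(a + 2) * k| + |-(2 * a + 2) * k| + |(a ^ 2 + 2 * a + 4) * k| := by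
        positivity
      linarith)
    (fun s hs ↦ by
      have h1 := bS s hs (-a) 0 (by norm_num)
      have h2 := bS s hs (a ^ 2) 2 (by norm_num)
      have h3 := bE s hs (-(a + 2) * k) 1 (by norm_num)
      refine le_trans (le_of_eq ?_) ((abs_add_three _ _ _).trans
        ((add_le_add (add_le_add h1 h2) h3).trans ?_))
      · congr 1; ring
      rw [← add_mul, ← add_mul]
      refine mul_le_mul_of_nonneg_right ?_ (Real.exp_pos _).le
      rw [hA]
      have : 0 ≤ 72 * k * (1 + |3 * a ^ 2| + |-a ^ 3|) := by positivity
      have : 0 ≤ |k| + |-(2 * a + 2) * k| + |(a ^ 2 + 2 * a + 4) * k| := by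
        positivity
      linarith)
    (fun s hs ↦ by
      have h1 := bS s hs (3 * a ^ 2) 1 (by norm_num)
      have h2 := bS s hs (-a ^ 3) 3 (by norm_num)
      have h3 := bE s hs (-(2 * a + 2) * k) 0 (by norm_num)
      have h4 := bE s hs ((a ^ 2 + 2 * a + 4) * k) 2 (by norm_num)
      refine le_trans (le_of_eq ?_) ((abs_add_le _ _).trans
        ((add_le_add ((abs_add_le _ _).trans (add_le_add h1 h2))
          ((abs_add_le _ _).trans (add_le_add h3 h4))).trans ?_))
      · congr 1; ring
      rw [← add_mul, ← add_mul, ← add_mul]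
      refine mul_le_mul_of_nonneg_right ?_ (Real.exp_pos _).le
      rw [hA]
      have : 0 ≤ 72 * k * (1 + |-a| + |a ^ 2|) := by positivity
      have : 0 ≤ |k| + |-(a + 2) * k| := by
        positivity
      linarith)
  rw [tendsto_iff_norm_sub_tendsto_zero]
  have h0 : Tendsto (fun h : ℝ ↦ C * h) (𝓝[>] 0) (𝓝 0) := by
    have h3 := ((continuous_const_mul C).tendsto 0).mono_left
      (nhdsWithin_le_nhds (s := Set.Ioi 0))
    simpa using h3
  refine squeeze_zero' (Eventually.of_forall fun _ ↦ norm_nonneg _) ?_ h0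
  filter_upwards [Ioc_mem_nhdsGT (zero_lt_one' ℝ)] with h hh
  have H' := H h hh.1 hh.2
  have e : ∑' n : ℕ, c n * (sliceIntegral k (h * n) / h) =
      (∑' n : ℕ, c n * sliceIntegral k (h * n)) / h := by
    rw [← tsum_div_const]
    exact tsum_congr fun n ↦ by rw [mul_div_assoc]
  have e0 : sliceIntegral k 0 = 0 := by simp [sliceIntegral, expSqIntegral_zero]
  have hp := hh.1
  rw [e0] at H'
  rw [e, Real.norm_eq_abs]
  refine le_of_mul_le_mul_left ?_ hp
  calc h * |(∑' n : ℕ, c n * sliceIntegral k (h * n)) / h - -(k * coeff₁ q c 0)|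
      = |h * ((∑' n : ℕ, c n * sliceIntegral k (h * n)) / h - -(k * coeff₁ q c 0))| := by
        rw [abs_mul, abs_of_pos hp]
    _ ≤ C * h ^ 2 := by
        refine le_trans (le_of_eq ?_) H'
        congr 1
        rw [mul_sub, mul_div_cancel₀ _ hp.ne', show -(0 : ℝ) ^ 2 = 0 by norm_num, Real.exp_zero]
        ring
    _ = _ := by ring

end EulerMaclaurin

namespace EulerMaclaurin

open Finset Filter Topology

theorem hasDerivAt_quadratic_exp (t X B y : ℝ) :
    HasDerivAt (fun y ↦ Real.exp (-(t * (X + B * y - y ^ 2))))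
      (-(t * (B - 2 * y)) * Real.exp (-(t * (X + B * y - y ^ 2)))) y := by
  have h : HasDerivAt (fun y : ℝ ↦ -(t * (X + B * y - y ^ 2))) (-(t * (B - 2 * y))) y :=
    ((((((hasDerivAt_id y).const_mul B).const_add X).sub (hasDerivAt_pow 2 y)).const_mul t).neg
      ).congr_deriv (by norm_num)
  exact h.exp.congr_deriv (by ring)

theorem hasDerivAt_mul_quadratic_exp (t X B : ℝ) {u : ℝ → ℝ} {u' y : ℝ} (hu : HasDerivAt u u' y)
    {v : ℝ} (hv : v = (u' - u y * (t * (B - 2 * y))) * Real.exp (-(t * (X + B * y - y ^ 2)))) :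
    HasDerivAt (fun y ↦ u y * Real.exp (-(t * (X + B * y - y ^ 2)))) v y :=
  (hu.mul (hasDerivAt_quadratic_exp t X B y)).congr_deriv (by rw [hv]; ring)

/-- The Euler–Maclaurin expansion of a slice of the lattice sum. -/
theorem abs_slice_sub_le (k q : ℕ) (hq : q ≠ 0) : ∃ C : ℝ, 0 ≤ C ∧
    ∀ (c : ℕ → ℝ) (M : ℝ), (∀ n, c (n + q) = c n) → (∀ n, |c n| ≤ M) →
    ∀ (h : ℝ) (x : ℕ), 0 < h →
    |∑ y ∈ range (k * x), c y * Real.exp (-(h ^ 2 * ((x : ℝ) ^ 2 + k * x * y - y ^ 2))) -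
      (mean q c * (sliceIntegral k (h * x) / h) +
      (coeff₀ q c (k * x) - coeff₀ q c 0) * Real.exp (-(h ^ 2 * x ^ 2)) +
      k * ((coeff₁ q c (k * x) + coeff₁ q c 0) * (h ^ 2 * x * Real.exp (-(h ^ 2 * x ^ 2)))))| ≤
    C * M * h ^ 2 * Real.exp (-(h * x)) := by
  obtain ⟨C₁, hC₁, H⟩ := abs_sum_range_sub_le q hq
  obtain ⟨C₂, hC₂, H₂⟩ := exists_coeff_bound q
  refine ⟨C₁ * (72 * (6 * k ^ 2 + k ^ 4)) + 2 * C₂ * (72 * (2 + k ^ 2)), by positivity, ?_⟩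
  intro c M hc hM h x hh
  have hM0 : 0 ≤ M := (abs_nonneg _).trans (hM 0)
  obtain ⟨-, H₂⟩ := H₂ c M hM
  set t := h ^ 2 with ht
  set X : ℝ := (x : ℝ) ^ 2 with hX
  set B : ℝ := k * x with hB
  have hB0 : 0 ≤ B := by positivity
  have hBN : ((k * x : ℕ) : ℝ) = B := by push_cast; rfl
  have hs0 : 0 ≤ h * x := by positivity
  have hexp : Real.exp (-(t * X)) = Real.exp (-(h * x) ^ 2) := by rw [mul_pow]
  have ends : ∀ y, y = 0 ∨ y = B → X + B * y - y ^ 2 = X := by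
    rintro y (rfl | rfl) <;> ring
  have key := H c M hc hM
    (fun y ↦ -(1 / h * Real.exp (-((k ^ 2 + 4) / 4 * (h * x) ^ 2)) *
      expSqIntegral (h * (B / 2 - y))))
    (fun y ↦ Real.exp (-(t * (X + B * y - y ^ 2))))
    (fun y ↦ -(t * (B - 2 * y)) * Real.exp (-(t * (X + B * y - y ^ 2))))
    (fun y ↦ (2 * t + t ^ 2 * (B - 2 * y) ^ 2) * Real.exp (-(t * (X + B * y - y ^ 2))))
    (fun y ↦ (-(6 * t ^ 2) * (B - 2 * y) - t ^ 3 * (B - 2 * y) ^ 3) *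
      Real.exp (-(t * (X + B * y - y ^ 2))))
    (k * x) (fun _ ↦ (6 * t ^ 2 * B + t ^ 3 * B ^ 3) * Real.exp (-(h * x) ^ 2))
    (fun y _ ↦ by
      have h1 : HasDerivAt (fun y : ℝ ↦ h * (B / 2 - y)) (h * (-1)) y :=
        ((hasDerivAt_id y).const_sub (B / 2)).const_mul h
      refine ((((hasDerivAt_expSqIntegral _).comp y h1).const_mul
        (1 / h * Real.exp (-((k ^ 2 + 4) / 4 * (h * x) ^ 2)))).neg).congr_deriv ?_
      have e : Real.exp (-(t * (X + B * y - y ^ 2))) =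
          Real.exp (-((k ^ 2 + 4) / 4 * (h * x) ^ 2)) * Real.exp ((h * (B / 2 - y)) ^ 2) := by
        rw [← Real.exp_add, ht, hX, hB]; congr 1; ring
      rw [e]
      field_simp)
    (fun y _ ↦ hasDerivAt_quadratic_exp t X B y)
    (fun y _ ↦ hasDerivAt_mul_quadratic_exp t X B
      (((((hasDerivAt_id y).const_mul 2).const_sub B).const_mul t).neg)
      (by simp only [id, Pi.neg_apply]; ring))
    (fun y _ ↦ hasDerivAt_mul_quadratic_exp t X B
      ((((((hasDerivAt_id y).const_mul 2).const_sub B).pow 2).const_mul (t ^ 2)).const_add (2 * t))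
      (by simp only [id, Pi.pow_apply]; push_cast; ring))
    (fun n hn y hy ↦ by
      have hy0 : 0 ≤ y := (Nat.cast_nonneg n).trans hy.1
      have hyB : y ≤ B := by
        rw [← hBN]
        exact hy.2.trans (by exact_mod_cast hn)
      have hu : |B - 2 * y| ≤ B := by rw [abs_le]; constructor <;> linarith
      rw [abs_mul, abs_of_pos (Real.exp_pos _)]
      refine mul_le_mul ?_ ?_ (Real.exp_pos _).le (by positivity)
      · refine (abs_sub _ _).trans ?_
        rw [abs_mul, abs_mul, abs_neg, abs_of_nonneg (by positivity : 0 ≤ 6 * t ^ 2),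
          abs_of_nonneg (by positivity : 0 ≤ t ^ 3), abs_pow]
        gcongr
      · rw [← hexp]
        refine Real.exp_le_exp.mpr (neg_le_neg (mul_le_mul_of_nonneg_left ?_ (by positivity)))
        nlinarith)
  rw [sum_const, card_range, nsmul_eq_mul, hBN] at key
  simp only [ends _ (Or.inl rfl), ends _ (Or.inr rfl)] at key
  have hF : -(1 / h * Real.exp (-((k ^ 2 + 4) / 4 * (h * x) ^ 2)) *
      expSqIntegral (h * (B / 2 - B))) - -(1 / h * Real.exp (-((k ^ 2 + 4) / 4 * (h * x) ^ 2)) *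
      expSqIntegral (h * (B / 2 - 0))) = sliceIntegral k (h * x) / h := by
    rw [show h * (B / 2 - B) = -(k * (h * x) / 2) by rw [hB]; ring, expSqIntegral_neg,
      show h * (B / 2 - 0) = k * (h * x) / 2 by rw [hB]; ring, sliceIntegral]
    ring
  rw [hF, hexp] at key
  set E := Real.exp (-(h * x) ^ 2) with hE
  have e1 : h ^ 2 * (x : ℝ) ^ 2 = (h * x) ^ 2 := by ring
  rw [e1, ← hE]
  have p0 := pow_mul_exp_neg_sq_le (show 0 ≤ 4 by norm_num) hs0
  have p2 := pow_mul_exp_neg_sq_le (show 2 ≤ 4 by norm_num) hs0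
  have p4 := pow_mul_exp_neg_sq_le (show 4 ≤ 4 by norm_num) hs0
  rw [← hE] at p0 p2 p4
  have r2 : |(coeff₂ q c (k * x) - coeff₂ q c 0) * (h ^ 2 * ((2 + k ^ 2 * (h * x) ^ 2) * E))| ≤
      2 * C₂ * M * (h ^ 2 * (72 * (2 + k ^ 2) * Real.exp (-(h * x)))) := by
    rw [abs_mul, abs_of_nonneg (a := h ^ 2 * _) (by positivity)]
    refine mul_le_mul ?_ ?_ (by positivity) (by positivity)
    · refine (abs_sub _ _).trans ?_
      linarith [(H₂ (k * x)).2.2, (H₂ 0).2.2]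
    · refine mul_le_mul_of_nonneg_left ?_ (by positivity)
      have := mul_le_mul_of_nonneg_left p2 (by positivity : (0 : ℝ) ≤ k ^ 2)
      linarith
  have r3 : C₁ * M * (B * ((6 * t ^ 2 * B + t ^ 3 * B ^ 3) * E)) ≤
      C₁ * M * (h ^ 2 * (72 * (6 * k ^ 2 + k ^ 4) * Real.exp (-(h * x)))) := by
    refine mul_le_mul_of_nonneg_left ?_ (by positivity)
    have e : B * ((6 * t ^ 2 * B + t ^ 3 * B ^ 3) * E) =
        h ^ 2 * (6 * k ^ 2 * ((h * x) ^ 2 * E) + k ^ 4 * ((h * x) ^ 4 * E)) := by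
      rw [hB, ht]; ring
    rw [e]
    refine mul_le_mul_of_nonneg_left ?_ (by positivity)
    have := mul_le_mul_of_nonneg_left p2 (by positivity : (0 : ℝ) ≤ 6 * k ^ 2)
    have := mul_le_mul_of_nonneg_left p4 (by positivity : (0 : ℝ) ≤ (k : ℝ) ^ 4)
    linarith
  refine le_trans (le_of_eq ?_) ((abs_add_le _ _).trans ((add_le_add (key.trans r3) r2).trans ?_))
  · congr 1
    rw [hB, ht]
    ring
  · refine le_of_eq ?_
    ring

end EulerMaclaurin

namespace EulerMaclaurin

open Finset Filter Topology

theorem apply_add_mul {q : ℕ} {c : ℕ → ℝ} (hc : ∀ n, c (n + q) = c n) (k n : ℕ) :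
    c (n + k * q) = c n := by
  induction k with
  | zero => simp
  | succ k ih => rw [Nat.succ_mul, ← add_assoc, hc, ih]

theorem summable_mul_sq_exp {a : ℕ → ℝ} {A h : ℝ} (hh : 0 < h) (ha : ∀ n, |a n| ≤ A) (b : ℝ) {j : ℕ}
    (hj : j ≤ 4) : Summable fun n : ℕ ↦ a n * (b * ((h * n) ^ j * Real.exp (-(h * n) ^ 2))) := by
  have hA : 0 ≤ A := (abs_nonneg _).trans (ha 0)
  refine Summable.of_norm_bounded (((summable_exp_neg_mul hh).mul_left (72 * |b|)).mul_left A)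
    fun n ↦ ?_
  rw [norm_mul]
  exact mul_le_mul (ha n) (abs_pow_mul_exp_le (by positivity) b hj) (norm_nonneg _) hA

theorem summable_mul_sliceIntegral {a : ℕ → ℝ} {A h k : ℝ} (hk : 0 ≤ k) (hh : 0 < h)
    (ha : ∀ n, |a n| ≤ A) : Summable fun n : ℕ ↦ a n * (sliceIntegral k (h * n) / h) := by
  have hA : 0 ≤ A := (abs_nonneg _).trans (ha 0)
  refine Summable.of_norm_bounded
    (((summable_exp_neg_mul hh).mul_left (72 * k * |1 / h|)).mul_left A) fun n ↦ ?_
  rw [norm_mul]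
  refine mul_le_mul (ha n) ?_ (norm_nonneg _) hA
  have := abs_pow_mul_sliceIntegral_le hk (s := h * n) (by positivity) (1 / h) (j := 0)
    (by norm_num)
  rw [pow_zero, one_mul] at this
  rwa [Real.norm_eq_abs, div_eq_mul_one_div, mul_comm]

/-- The limit of a periodically weighted sum of `exp (-t * Q)` over the lattice points of the cone
`0 ≤ y < k * x`, where `Q (x, y) = x ^ 2 + k * x * y - y ^ 2`. -/
theorem tendsto_lattice_sum (k q : ℕ) (hq : q ≠ 0) {w : ℕ → ℕ → ℝ} {M : ℝ}
    (hwx : ∀ x y, w (x + q) y = w x y) (hwy : ∀ x y, w x (y + q) = w x y) (hM : ∀ x y, |w x y| ≤ M)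
    (hm : mean q (fun x ↦ mean q (w x)) = 0)
    (hα : mean q (fun x ↦ coeff₀ q (w x) (k * x) - coeff₀ q (w x) 0) = 0) :
    Tendsto (fun t : ℝ ↦ ∑' x : ℕ, ∑ y ∈ range (k * x),
      w x y * Real.exp (-(t * ((x : ℝ) ^ 2 + k * x * y - y ^ 2)))) (𝓝[>] 0)
      (𝓝 (-(k * coeff₁ q (fun x ↦ mean q (w x)) 0) +
        -coeff₀ q (fun x ↦ coeff₀ q (w x) (k * x) - coeff₀ q (w x) 0) 0 +
        k * (mean q (fun x ↦ coeff₁ q (w x) (k * x) + coeff₁ q (w x) 0) / 2))) := by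
  obtain ⟨C, hC, H⟩ := abs_slice_sub_le k q hq
  obtain ⟨C₂, hC₂, H₂⟩ := exists_coeff_bound q
  have hM0 : 0 ≤ M := (abs_nonneg _).trans (hM 0 0)
  set m : ℕ → ℝ := fun x ↦ mean q (w x) with hm_def
  set α : ℕ → ℝ := fun x ↦ coeff₀ q (w x) (k * x) - coeff₀ q (w x) 0 with hα_def
  set β : ℕ → ℝ := fun x ↦ coeff₁ q (w x) (k * x) + coeff₁ q (w x) 0 with hβ_def
  have hw1 : ∀ x, w (x + q) = w x := fun x ↦ funext fun y ↦ hwx x y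
  have shift : ∀ x i, w x (k * (x + q) + i) = w x (k * x + i) := fun x i ↦ by
    rw [show k * (x + q) + i = k * x + i + k * q by ring]
    exact apply_add_mul (hwy x) k _
  have pm : ∀ x, m (x + q) = m x := fun x ↦ by simp only [hm_def, hw1]
  have pα : ∀ x, α (x + q) = α x := fun x ↦ by simp only [hα_def, hw1, coeff₀, shift]
  have pβ : ∀ x, β (x + q) = β x := fun x ↦ by simp only [hβ_def, hw1, coeff₁, shift]
  have bm : ∀ x, |m x| ≤ C₂ * M := fun x ↦ (H₂ (w x) M (hM x)).1
  have bα : ∀ x, |α x| ≤ 2 * (C₂ * M) := fun x ↦ by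
    have h := (H₂ (w x) M (hM x)).2
    exact (abs_sub _ _).trans (by linarith [(h (k * x)).1, (h 0).1])
  have bβ : ∀ x, |β x| ≤ 2 * (C₂ * M) := fun x ↦ by
    have h := (H₂ (w x) M (hM x)).2
    exact (abs_add_le _ _).trans (by linarith [(h (k * x)).2.1, (h 0).2.1])
  have lm := (tendsto_tsum_mul_sliceIntegral (Nat.cast_nonneg (α := ℝ) k) hq pm bm hm).comp
    tendsto_sqrt_nhdsGT
  have lα := tendsto_tsum_mul_exp hq pα bα hα
  have lβ := (tendsto_tsum_mul_mul_exp hq pβ bβ).const_mul (k : ℝ)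
  have lsum := (lm.add lα).add lβ
  refine (tendsto_iff_of_dist ?_).mpr lsum
  have h0 : Tendsto (fun h : ℝ ↦ C * M * (h ^ 2 + h)) (𝓝[>] 0) (𝓝 0) := by
    have : Continuous fun h : ℝ ↦ C * M * (h ^ 2 + h) := by fun_prop
    have h3 := (this.tendsto 0).mono_left (nhdsWithin_le_nhds (s := Set.Ioi 0))
    simpa using h3
  refine squeeze_zero' (Eventually.of_forall fun _ ↦ dist_nonneg) ?_ (h0.comp tendsto_sqrt_nhdsGT)
  filter_upwards [self_mem_nhdsWithin] with t ht
  rw [Function.comp_apply, Function.comp_apply]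
  set h := Real.sqrt t with hh_def
  have hh : 0 < h := Real.sqrt_pos.mpr ht
  have hht : t = h ^ 2 := (Real.sq_sqrt (le_of_lt ht)).symm
  rw [hht]
  have sm : Summable fun x : ℕ ↦ m x * (sliceIntegral k (h * x) / h) :=
    summable_mul_sliceIntegral (Nat.cast_nonneg k) hh bm
  have sα : Summable fun x : ℕ ↦ α x * Real.exp (-(h ^ 2 * x ^ 2)) := by
    refine (summable_mul_sq_exp hh bα 1 (j := 0) (by norm_num)).congr fun x ↦ ?_
    rw [mul_pow]; ring_nf
  have sβ : Summable fun x : ℕ ↦ k * (β x * (h ^ 2 * x * Real.exp (-(h ^ 2 * x ^ 2)))) := by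
    refine ((summable_mul_sq_exp hh bβ h (j := 1) (by norm_num)).mul_left (k : ℝ)).congr fun x ↦ ?_
    rw [mul_pow]; ring_nf
  have smain := (sm.add sα).add sβ
  have bound := fun x ↦ H (w x) M (hwy x) (hM x) h x hh
  simp only [← Real.norm_eq_abs] at bound
  have sbound : Summable fun x : ℕ ↦ C * M * h ^ 2 * Real.exp (-(h * x)) :=
    (summable_exp_neg_mul hh).mul_left _
  have sdiff := Summable.of_norm_bounded sbound bound
  have stot := (sdiff.add smain).congr fun x ↦ sub_add_cancel _ _
  rw [← sm.tsum_add sα, ← tsum_mul_left, ← (sm.add sα).tsum_add sβ, Real.dist_eq,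
    ← stot.tsum_sub smain]
  refine (norm_tsum_le_tsum_norm sdiff.norm).trans ((sdiff.norm.tsum_le_tsum bound sbound).trans ?_)
  rw [tsum_mul_left]
  have hE : ∑' x : ℕ, Real.exp (-(h * x)) ≤ 1 + 1 / h :=
    (summable_exp_neg_mul hh).tsum_le_of_sum_range_le fun N ↦ sum_range_exp_le hh N
  calc _ ≤ C * M * h ^ 2 * (1 + 1 / h) := by gcongr
    _ = _ := by field_simp

end EulerMaclaurin

namespace EulerMaclaurin

open Finset Filter Topology

variable {q : ℕ}

/-- The quadratic form `x ^ 2 + k * x * y - y ^ 2` on `ZMod q`. -/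
def form (k : ℕ) (x y : ZMod q) : ZMod q := x ^ 2 + k * x * y - y ^ 2

/-- The bijection `(x, y) ↦ (y, x + k * y)`, which changes the sign of the form. -/
def rotate (k : ℕ) : ZMod q × ZMod q ≃ ZMod q × ZMod q where
  toFun p := (p.2, p.1 + k * p.2)
  invFun p := (p.2 - k * p.1, p.1)
  left_inv p := by simp
  right_inv p := by simp

theorem form_neg (k : ℕ) (x y : ZMod q) : form k (-x) (-y) = form k x y := by
  unfold form; ring

theorem form_reflect (k : ℕ) (x y : ZMod q) : form k x (k * x + y) = form k x (-y) := by
  unfold form; ring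

theorem form_rotate (k : ℕ) (p : ZMod q × ZMod q) :
    form k (rotate k p).1 (rotate k p).2 = -form k p.1 p.2 := by
  simp only [form, rotate, Equiv.coe_fn_mk]; ring

variable [NeZero q]

theorem sum_range_eq_sum_zmod {R : Type*} [AddCommMonoid R] (G : ZMod q → ℕ → R) :
    ∑ i ∈ range q, G i i = ∑ a : ZMod q, G a a.val := by
  refine sum_nbij' (fun i ↦ (i : ZMod q)) ZMod.val (fun _ _ ↦ mem_univ _)
    (fun a _ ↦ mem_range.mpr (ZMod.val_lt a)) (fun i hi ↦ ZMod.val_cast_of_lt (mem_range.mp hi))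
    (fun a _ ↦ ZMod.natCast_zmod_val a) (fun i hi ↦ ?_)
  rw [ZMod.val_cast_of_lt (mem_range.mp hi)]

/-- The odd sawtooth function on `ZMod q`, scaled by `2 * q`. -/
def sawtooth {R : Type*} [Ring R] (a : ZMod q) : R := if a = 0 then 0 else 2 * a.val - q

theorem sawtooth_neg {R : Type*} [Ring R] (a : ZMod q) : (sawtooth (-a) : R) = -sawtooth a := by
  unfold sawtooth
  by_cases h : a = 0
  · simp [h]
  · have : NeZero a := ⟨h⟩
    rw [if_neg (neg_ne_zero.mpr h), if_neg h, ZMod.val_neg_of_ne_zero,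
      Nat.cast_sub (ZMod.val_lt a).le,
      mul_sub, neg_sub, two_mul (q : R)]
    abel

variable {f : ZMod q → ℝ}

theorem sum_form_mul_snd (hf : ∀ a, f (-a) = -f a) (k : ℕ) (b : ZMod q → ℝ) :
    ∑ x, ∑ y, f (form k x y) * b y = -∑ x, ∑ y, f (form k x y) * b x := by
  rw [← Fintype.sum_prod_type', ← Fintype.sum_prod_type',
    ← (rotate k).sum_comp fun p ↦ f (form k p.1 p.2) * b p.1, ← sum_neg_distrib]
  refine sum_congr rfl fun p _ ↦ ?_
  rw [form_rotate, hf]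
  simp [rotate]

theorem sum_form (hf : ∀ a, f (-a) = -f a) (k : ℕ) : ∑ x, ∑ y, f (form k x y) = 0 := by
  have := sum_form_mul_snd hf k 1
  simp only [Pi.one_apply, mul_one] at this
  linarith

theorem sum_form_mul_odd (k : ℕ) {b : ZMod q → ℝ} (hb : ∀ a, b (-a) = -b a) :
    ∑ x, ∑ y, f (form k x y) * b y = 0 := by
  have h : ∑ x, ∑ y, f (form k x y) * b y = ∑ x, ∑ y, f (form k (-x) (-y)) * b (-y) := by
    rw [← Equiv.sum_comp (Equiv.neg (ZMod q))]
    refine sum_congr rfl fun x _ ↦ ?_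
    rw [← Equiv.sum_comp (Equiv.neg (ZMod q))]
    rfl
  simp only [form_neg, hb, mul_neg, sum_neg_distrib] at h
  linarith

theorem coeff₀_form (k x : ℕ) :
    coeff₀ q (fun y ↦ f (form k x y)) (k * x) - coeff₀ q (fun y ↦ f (form k x y)) 0 =
      -(q : ℝ)⁻¹ * ∑ y, f (form k x y) * sawtooth y := by
  have hq : (q : ℝ) ≠ 0 := NeZero.ne _
  unfold coeff₀
  have e1 := sum_range_eq_sum_zmod (q := q) fun a i ↦
    f (form k x ((k * x : ℕ) + a)) * ((i : ℝ) / q - 1 / 2)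
  have e2 := sum_range_eq_sum_zmod (q := q) fun a i ↦ f (form k x a) * ((i : ℝ) / q - 1 / 2)
  simp only [Nat.cast_add, zero_add, e1, e2]
  simp only [Nat.cast_mul, form_reflect]
  rw [← Equiv.sum_comp (Equiv.neg (ZMod q)), ← sum_sub_distrib, mul_sum]
  refine sum_congr rfl fun y _ ↦ ?_
  rw [Equiv.neg_apply, neg_neg, ← mul_sub, mul_left_comm]
  congr 1
  unfold sawtooth
  by_cases h : y = 0
  · simp [h]
  · have : NeZero y := ⟨h⟩
    rw [if_neg h, ZMod.val_neg_of_ne_zero,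
      Nat.cast_sub (ZMod.val_lt y).le]
    field_simp
    ring

theorem coeff₁_form (k x : ℕ) :
    coeff₁ q (fun y ↦ f (form k x y)) (k * x) + coeff₁ q (fun y ↦ f (form k x y)) 0 =
      q * ∑ y, f (form k x y) * (((y.val : ℝ) / q) ^ 2 - y.val / q + 1 / 6) := by
  have hq : (q : ℝ) ≠ 0 := NeZero.ne _
  unfold coeff₁
  have e1 := sum_range_eq_sum_zmod (q := q) fun a i ↦
    f (form k x ((k * x : ℕ) + a)) * ((q : ℝ) / 2 * (((i : ℝ) / q) ^ 2 - i / q + 1 / 6))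
  have e2 := sum_range_eq_sum_zmod (q := q) fun a i ↦
    f (form k x a) * ((q : ℝ) / 2 * (((i : ℝ) / q) ^ 2 - i / q + 1 / 6))
  simp only [Nat.cast_add, zero_add, e1, e2]
  simp only [Nat.cast_mul, form_reflect]
  rw [← Equiv.sum_comp (Equiv.neg (ZMod q)), ← sum_add_distrib, mul_sum]
  refine sum_congr rfl fun y _ ↦ ?_
  rw [Equiv.neg_apply, neg_neg, ← mul_add, mul_left_comm]
  congr 1
  by_cases h : y = 0
  · simp [h]; ring
  · have : NeZero y := ⟨h⟩
    rw [ZMod.val_neg_of_ne_zero,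
      Nat.cast_sub (ZMod.val_lt y).le]
    field_simp
    ring

theorem tendsto_form_sum (hf : ∀ a, f (-a) = -f a) (k : ℕ) :
    Tendsto (fun t : ℝ ↦ ∑' x : ℕ, ∑ y ∈ range (k * x),
      f (form k x y) * Real.exp (-(t * ((x : ℝ) ^ 2 + k * x * y - y ^ 2)))) (𝓝[>] 0)
      (𝓝 ((∑ x, ∑ y, f (form k x y) * (sawtooth x * sawtooth y) -
        2 * k * ∑ x, ∑ y, f (form k x y) * ((x.val : ℝ) ^ 2 - q * x.val)) / (2 * q ^ 2))) := by
  have hq : (q : ℝ) ≠ 0 := NeZero.ne _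
  obtain ⟨M, hM⟩ : ∃ M : ℝ, ∀ a, |f a| ≤ M :=
    ⟨∑ a, |f a|, fun a ↦ single_le_sum (f := fun a ↦ |f a|) (fun _ _ ↦ abs_nonneg _) (mem_univ a)⟩
  have hmean : ∀ x : ℕ, mean q (fun y ↦ f (form k x y)) = (∑ y, f (form k x y)) / q := fun x ↦ by
    rw [mean, sum_range_eq_sum_zmod fun a _ ↦ f (form k x a)]
  have h0 : ∑ y, f (form k 0 y) * (sawtooth y : ℝ) = 0 := by
    have h : ∑ y, f (form k 0 y) * (sawtooth y : ℝ) = ∑ y, f (form k 0 (-y)) * sawtooth (-y) := by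
      rw [← Equiv.sum_comp (Equiv.neg (ZMod q))]
      rfl
    have e : ∀ y : ZMod q, form k 0 (-y) = form k 0 y := fun y ↦ by simpa using form_neg k 0 y
    simp only [e, sawtooth_neg, mul_neg, sum_neg_distrib] at h
    linarith
  have h := tendsto_lattice_sum k q (NeZero.ne q) (w := fun x y ↦ f (form k x y)) (M := M)
    (fun x y ↦ by simp) (fun x y ↦ by simp) (fun x y ↦ hM _)
    (by
      simp only [hmean]
      rw [mean, sum_range_eq_sum_zmod fun a _ ↦ (∑ y, f (form k a y)) / (q : ℝ), ← sum_div,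
        sum_form hf]
      simp)
    (by
      simp only [coeff₀_form]
      rw [mean, sum_range_eq_sum_zmod fun a _ ↦ -(q : ℝ)⁻¹ * ∑ y, f (form k a y) * sawtooth y,
        ← mul_sum, sum_form_mul_odd k sawtooth_neg]
      simp)
  convert h using 2
  simp only [hmean, coeff₀_form, coeff₁_form]
  rw [coeff₀, coeff₁, mean]
  simp only [zero_add]
  rw [sum_range_eq_sum_zmod fun a i ↦ (∑ y, f (form k a y)) / (q : ℝ) *
      ((q : ℝ) / 2 * (((i : ℝ) / q) ^ 2 - i / q + 1 / 6)),
    sum_range_eq_sum_zmod fun a i ↦ (-(q : ℝ)⁻¹ * ∑ y, f (form k a y) * sawtooth y) *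
      ((i : ℝ) / q - 1 / 2),
    sum_range_eq_sum_zmod fun a _ ↦ (q : ℝ) * ∑ y, f (form k a y) *
      (((y.val : ℝ) / q) ^ 2 - y.val / q + 1 / 6), ← mul_sum, sum_form_mul_snd hf]
  have eB : ∑ x, ∑ y, f (form k x y) * (((x.val : ℝ) / q) ^ 2 - x.val / q + 1 / 6) =
      (∑ x, ∑ y, f (form k x y) * ((x.val : ℝ) ^ 2 - q * x.val)) / q ^ 2 := by
    have e : ∀ x y, f (form k x y) * (((x.val : ℝ) / q) ^ 2 - x.val / q + 1 / 6) =
        f (form k x y) * ((x.val : ℝ) ^ 2 - q * x.val) / q ^ 2 + f (form k x y) * (1 / 6) :=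
      fun x y ↦ by field_simp
    simp only [e, sum_add_distrib, ← sum_mul, ← sum_div]
    rw [sum_form hf, zero_mul, add_zero]
  have eA : ∑ a : ZMod q, (-(q : ℝ)⁻¹ * ∑ y, f (form k a y) * sawtooth y) *
      ((a.val : ℝ) / q - 1 / 2) =
      -(∑ x, ∑ y, f (form k x y) * (sawtooth x * sawtooth y)) / (2 * q ^ 2) := by
    rw [neg_div, sum_div, ← sum_neg_distrib]
    refine sum_congr rfl fun x _ ↦ ?_
    simp only [mul_left_comm _ (sawtooth x : ℝ), ← mul_sum]
    by_cases hx : x = 0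
    · rw [hx, h0]; simp
    · have : (sawtooth x : ℝ) = 2 * x.val - q := if_neg hx
      rw [this]
      field_simp
  have eC : ∑ a : ZMod q, (∑ y, f (form k a y)) / (q : ℝ) *
      ((q : ℝ) / 2 * (((a.val : ℝ) / q) ^ 2 - a.val / q + 1 / 6)) =
      (∑ x, ∑ y, f (form k x y) * (((x.val : ℝ) / q) ^ 2 - x.val / q + 1 / 6)) / 2 := by
    rw [sum_div]
    refine sum_congr rfl fun x _ ↦ ?_
    rw [← sum_mul]
    field_simp
  rw [eA, eC, eB]
  field_simp
  ring

end EulerMaclaurin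

namespace EulerMaclaurin

open Finset Filter Topology

open Polynomial in
/-- The function `u ↦ p (exp (-u)) / (1 + exp (-u) + ⋯ + exp (-u) ^ (q - 1)) ^ i`. -/
noncomputable def expQuotient (q : ℕ) (p : ℝ[X]) (i : ℕ) (u : ℝ) : ℝ :=
  p.eval (Real.exp (-u)) / (∑ n ∈ range q, (X : ℝ[X]) ^ n).eval (Real.exp (-u)) ^ i

open Polynomial in
/-- The numerator of the derivative of `expQuotient q p i`. -/
noncomputable def expQuotientDeriv (q : ℕ) (p : ℝ[X]) (i : ℕ) : ℝ[X] :=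
  -(X * (derivative p * ∑ n ∈ range q, X ^ n - (i : ℝ[X]) * p * derivative (∑ n ∈ range q, X ^ n)))

section

open Polynomial

variable {q : ℕ} {p : ℝ[X]}

theorem one_le_eval_geom_sum (hq : q ≠ 0) {z : ℝ} (hz : 0 ≤ z) :
    1 ≤ (∑ n ∈ range q, (X : ℝ[X]) ^ n).eval z := by
  rw [eval_finsetSum]
  simp only [eval_pow, eval_X]
  calc (1 : ℝ) = z ^ 0 := (pow_zero z).symm
    _ ≤ _ := single_le_sum (f := fun n ↦ z ^ n) (fun _ _ ↦ pow_nonneg hz _)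
      (mem_range.mpr (Nat.pos_of_ne_zero hq))

theorem hasDerivAt_expQuotient (hq : q ≠ 0) (i : ℕ) (u : ℝ) :
    HasDerivAt (expQuotient q p i) (expQuotient q (expQuotientDeriv q p i) (i + 1) u) u := by
  set S : ℝ[X] := ∑ n ∈ range q, X ^ n with hS
  have hz : HasDerivAt (fun u : ℝ ↦ Real.exp (-u)) (-Real.exp (-u)) u :=
    (hasDerivAt_neg u).exp.congr_deriv (by ring)
  have hS1 : S.eval (Real.exp (-u)) ≠ 0 := by
    have := one_le_eval_geom_sum hq (Real.exp_pos (-u)).le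
    linarith
  have h1 := (p.hasDerivAt (Real.exp (-u))).comp u hz
  have h2 := ((S.hasDerivAt (Real.exp (-u))).comp u hz).pow i
  refine (h1.div h2 (pow_ne_zero _ hS1)).congr_deriv ?_
  rw [expQuotient, expQuotientDeriv, ← hS]
  simp only [eval_neg, eval_mul, eval_X, eval_sub, eval_natCast, Function.comp_apply, Pi.pow_apply]
  rcases i with _ | i
  · field_simp
    simp
  · simp only [Nat.add_sub_cancel]
    field_simp
    ring

theorem exists_expQuotient_le (hq : q ≠ 0) (hp : p.eval 0 = 0) (i : ℕ) : ∃ A : ℝ, 0 ≤ A ∧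
    ∀ u, 0 ≤ u → |expQuotient q p i u| ≤ A * Real.exp (-u) := by
  obtain ⟨r, rfl⟩ : (X : ℝ[X]) ∣ p := by
    rw [X_dvd_iff, coeff_zero_eq_eval_zero, hp]
  obtain ⟨A, hA⟩ := (isCompact_Icc (a := (0 : ℝ)) (b := 1)).exists_bound_of_continuousOn
    r.continuous.continuousOn
  refine ⟨A, (norm_nonneg _).trans (hA 0 (by simp)), fun u hu ↦ ?_⟩
  have hz1 : Real.exp (-u) ≤ 1 := Real.exp_le_one_iff.mpr (by linarith)
  have h1 := hA _ ⟨(Real.exp_pos (-u)).le, hz1⟩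
  have h2 := one_le_pow₀ (one_le_eval_geom_sum hq (Real.exp_pos (-u)).le) (n := i)
  rw [expQuotient, eval_mul, eval_X, abs_div, abs_mul, abs_of_pos (Real.exp_pos _),
    abs_of_pos (zero_lt_one.trans_le h2), div_le_iff₀ (zero_lt_one.trans_le h2)]
  have h3 := (abs_nonneg _).trans h1
  calc _ ≤ Real.exp (-u) * A := mul_le_mul_of_nonneg_left h1 (Real.exp_pos _).le
    _ = A * Real.exp (-u) * 1 := by ring
    _ ≤ _ := mul_le_mul_of_nonneg_left h2 (mul_nonneg h3 (Real.exp_pos _).le)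

theorem expQuotientDeriv_eval_zero (i : ℕ) : (expQuotientDeriv q p i).eval 0 = 0 := by
  simp [expQuotientDeriv]

theorem tsum_periodic_mul_pow {c : ℕ → ℝ} {M : ℝ} (hc : ∀ n, c (n + q) = c n)
    (hM : ∀ n, |c n| ≤ M) {z : ℝ} (hz : 0 ≤ z) (hz1 : z < 1) (hq : q ≠ 0) :
    Summable (fun n ↦ c n * z ^ n) ∧
      ∑' n, c n * z ^ n = (∑ n ∈ range q, c n * z ^ n) / (1 - z ^ q) := by
  have hs : Summable (fun n ↦ c n * z ^ n) := by
    refine Summable.of_norm_bounded ((summable_geometric_of_lt_one hz hz1).mul_left M) fun n ↦ ?_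
    rw [norm_mul, Real.norm_eq_abs, Real.norm_eq_abs, abs_of_nonneg (pow_nonneg hz n)]
    exact mul_le_mul_of_nonneg_right (hM n) (pow_nonneg hz n)
  refine ⟨hs, ?_⟩
  have h := hs.sum_add_tsum_nat_add q
  simp only [hc, pow_add, ← mul_assoc] at h
  rw [tsum_mul_right] at h
  have : z ^ q < 1 := pow_lt_one₀ hz hz1 hq
  rw [eq_div_iff (by linarith)]
  linarith

/-- The generating function of a periodic sequence with sum zero extends smoothly to the origin. -/
theorem exists_smooth_generating (hq : q ≠ 0) {c : ℕ → ℝ} {M : ℝ} (hc : ∀ n, c (n + q) = c n)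
    (hM : ∀ n, |c n| ≤ M) (h0 : c 0 = 0) (hsum : ∑ n ∈ range q, c n = 0) :
    ∃ (g g₁ g₂ g₃ : ℝ → ℝ) (A : ℝ), ((∀ s, HasDerivAt g (g₁ s) s) ∧ (∀ s, HasDerivAt g₁ (g₂ s) s) ∧
      (∀ s, HasDerivAt g₂ (g₃ s) s)) ∧ ((∀ s, 0 ≤ s → |g s| ≤ A * Real.exp (-s)) ∧
      (∀ s, 0 ≤ s → |g₁ s| ≤ A * Real.exp (-s)) ∧ (∀ s, 0 ≤ s → |g₂ s| ≤ A * Real.exp (-s)) ∧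
      (∀ s, 0 ≤ s → |g₃ s| ≤ A * Real.exp (-s))) ∧
      (∀ s, 0 < s → ∑' n : ℕ, c n * Real.exp (-(s * n)) = g s) ∧
      g 0 = -(∑ n ∈ range q, n * c n) / q := by
  set R : ℝ[X] := ∑ n ∈ range q, C (c n) * X ^ n with hR
  have hR1 : R.eval 1 = 0 := by rw [hR, eval_finsetSum]; simpa using hsum
  obtain ⟨P, hP⟩ : (X - C 1) ∣ R := dvd_iff_isRoot.mpr hR1
  have hR0 : R.eval 0 = 0 := by
    rw [hR, eval_finsetSum]
    refine sum_eq_zero fun n _ ↦ ?_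
    rcases n with _ | n <;> simp [h0]
  have hP0 : (-P).eval 0 = 0 := by
    rw [hP, eval_mul] at hR0
    simpa using hR0
  set p₁ := expQuotientDeriv q (-P) 1
  set p₂ := expQuotientDeriv q p₁ 2
  set p₃ := expQuotientDeriv q p₂ 3
  obtain ⟨A₀, hA₀, b₀⟩ := exists_expQuotient_le hq hP0 1
  obtain ⟨A₁, hA₁, b₁⟩ := exists_expQuotient_le hq (expQuotientDeriv_eval_zero (p := -P) 1) 2
  obtain ⟨A₂, hA₂, b₂⟩ := exists_expQuotient_le hq (expQuotientDeriv_eval_zero (p := p₁) 2) 3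
  obtain ⟨A₃, hA₃, b₃⟩ := exists_expQuotient_le hq (expQuotientDeriv_eval_zero (p := p₂) 3) 4
  refine ⟨expQuotient q (-P) 1, expQuotient q p₁ 2, expQuotient q p₂ 3, expQuotient q p₃ 4,
    A₀ + A₁ + A₂ + A₃, ⟨hasDerivAt_expQuotient hq 1, hasDerivAt_expQuotient hq 2,
    hasDerivAt_expQuotient hq 3⟩, ⟨fun s hs ↦ (b₀ s hs).trans ?_, fun s hs ↦ (b₁ s hs).trans ?_,
    fun s hs ↦ (b₂ s hs).trans ?_, fun s hs ↦ (b₃ s hs).trans ?_⟩, fun s hs ↦ ?_, ?_⟩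
  iterate 4 exact mul_le_mul_of_nonneg_right (by linarith) (Real.exp_pos _).le
  · have hz1 : Real.exp (-s) < 1 := by rw [Real.exp_lt_one_iff]; linarith
    have hz0 := (Real.exp_pos (-s)).le
    set z := Real.exp (-s) with hz
    have e : ∀ n : ℕ, Real.exp (-(s * n)) = z ^ n := fun n ↦ by
      rw [hz, ← Real.exp_nat_mul]; congr 1; ring
    simp only [e]
    rw [(tsum_periodic_mul_pow hc hM hz0 hz1 hq).2]
    have e1 : ∑ n ∈ range q, c n * z ^ n = R.eval z := by
      rw [hR, eval_finsetSum]; simp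
    have hS := one_le_eval_geom_sum hq hz0
    rw [expQuotient, ← hz, e1, hP, pow_one]
    have e2 : (∑ n ∈ range q, (X : ℝ[X]) ^ n).eval z * (z - 1) = z ^ q - 1 := by
      rw [eval_finsetSum]; simpa using geom_sum_mul z q
    have : z ^ q < 1 := pow_lt_one₀ hz0 hz1 hq
    rw [div_eq_div_iff (by linarith) (by linarith)]
    simp only [eval_mul, eval_sub, eval_X, eval_C, eval_neg]
    linear_combination (eval z P) * e2
  · have hP1 : P.eval 1 = ∑ n ∈ range q, n * c n := by
      have h1 : (derivative R).eval 1 = P.eval 1 := by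
        rw [hP]; simp
      rw [← h1, hR, derivative_sum, eval_finsetSum]
      refine sum_congr rfl fun n _ ↦ ?_
      rw [derivative_C_mul, derivative_X_pow, eval_mul, eval_C, eval_mul, eval_C, eval_pow, eval_X,
        one_pow, mul_one, mul_comm]
    rw [expQuotient, neg_zero, Real.exp_zero, eval_neg, hP1, eval_finsetSum]
    simp

end

theorem tendsto_double_sum {q N : ℕ} [NeZero q] (hN : N ≠ 0) (hqN : q ∣ N) {f : ZMod q → ℝ}
    (hf : ∀ a, f (-a) = -f a) {J : ℕ → ℝ} {M : ℝ} (hJ : ∀ n, J (n + N) = J n)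
    (hM : ∀ n, |J n| ≤ M)
    (hmean : ∀ j : ZMod q, ∑ b ∈ range N, (if (b : ZMod q) = j then J b else 0) = 0) :
    Tendsto (fun t : ℝ ↦ ∑' b : ℕ, J b * ∑' a : ℕ, f (a * b) * Real.exp (-(t * (a * b))))
      (𝓝[>] 0) (𝓝 ((∑ b ∈ range N, ∑ a ∈ range q, a * b * (J b * f (a * b))) / (N * q))) := by
  have hM0 : 0 ≤ M := (abs_nonneg _).trans (hM 0)
  have hf0 : f 0 = 0 := by
    have := hf 0
    rw [neg_zero] at this
    linarith
  have hgen := fun j : ZMod q ↦ exists_smooth_generating (q := q) (NeZero.ne q)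
    (c := fun n ↦ f (n * j)) (M := ∑ a, |f a|) (fun n ↦ by simp)
    (fun n ↦ single_le_sum (f := fun a ↦ |f a|) (fun _ _ ↦ abs_nonneg _) (mem_univ _))
    (by simp [hf0]) (by
      rw [sum_range_eq_sum_zmod fun a _ ↦ f (a * j)]
      have h : ∑ a : ZMod q, f (a * j) = ∑ a : ZMod q, f (-a * j) := by
        rw [← Equiv.sum_comp (Equiv.neg (ZMod q))]
        rfl
      simp only [neg_mul, hf, sum_neg_distrib] at h
      linarith)
  choose g g₁ g₂ g₃ A hderiv hbound hval hzero using hgen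
  set c : ZMod q → ℕ → ℝ := fun j b ↦ if (b : ZMod q) = j then J b else 0 with hc
  have pc : ∀ j n, c j (n + N) = c j n := fun j n ↦ by
    have : ((N : ℕ) : ZMod q) = 0 := (ZMod.natCast_eq_zero_iff N q).mpr hqN
    simp only [hc, Nat.cast_add, this, add_zero, hJ]
  have bc : ∀ j n, |c j n| ≤ M := fun j n ↦ by
    simp only [hc]
    split_ifs
    · exact hM n
    · simpa using hM0
  have lim := tendsto_finsetSum (univ : Finset (ZMod q)) fun j _ ↦
    tendsto_tsum_of_mean_eq_zero hN (pc j) (bc j) (by rw [mean, hmean, zero_div]) (hderiv j).1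
      (hderiv j).2.1 (hderiv j).2.2 (hbound j).1 (hbound j).2.1 (hbound j).2.2.1 (hbound j).2.2.2
  have elim : ∑ j : ZMod q, -(coeff₀ N (c j) 0 * g j 0) =
      (∑ b ∈ range N, ∑ a ∈ range q, a * b * (J b * f (a * b))) / (N * q) := by
    have e1 : ∀ j, coeff₀ N (c j) 0 = (∑ b ∈ range N, b * c j b) / N := fun j ↦ by
      have h : ∀ b : ℕ, c j (0 + b) * ((b : ℝ) / N - 1 / 2) = b * c j b / N - c j b / 2 := fun b ↦ by
        rw [zero_add]; ring
      rw [coeff₀]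
      simp only [h]
      rw [sum_sub_distrib, ← sum_div, ← sum_div, hmean, zero_div, sub_zero]
    simp only [e1, hzero]
    have e2 : ∀ j, -((∑ b ∈ range N, b * c j b) / N * (-(∑ n ∈ range q, n * f (n * j)) / q)) =
        (∑ b ∈ range N, b * c j b * ∑ n ∈ range q, n * f (n * j)) / (N * q) := fun j ↦ by
      rw [← sum_mul]; field_simp
    simp only [e2]
    rw [← sum_div, sum_comm]
    congr 1
    refine sum_congr rfl fun b _ ↦ ?_
    rw [sum_eq_single (b : ZMod q)]
    · simp only [hc, if_true, mul_sum]
      exact sum_congr rfl fun a _ ↦ by ring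
    · intro j _ hj
      simp [hc, hj.symm]
    · simp
  rw [← elim]
  refine lim.congr' ?_
  filter_upwards [self_mem_nhdsWithin] with t ht
  have ht' : 0 < t := ht
  have inner : ∀ b : ℕ, ∑' a : ℕ, f (a * b) * Real.exp (-(t * (a * b))) = g b (t * b) := fun b ↦ by
    rcases Nat.eq_zero_or_pos b with rfl | hb
    · simp [hf0, hzero]
    · rw [← hval b (t * b) (by positivity)]
      refine tsum_congr fun a ↦ ?_
      congr 3; ring
  simp only [inner]
  rw [← Summable.tsum_finsetSum]
  · refine tsum_congr fun b ↦ ?_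
    rw [sum_eq_single (b : ZMod q)]
    · simp [hc]
    · intro j _ hj
      simp [hc, hj.symm]
    · simp
  · intro j _
    refine Summable.of_norm_bounded (((summable_exp_neg_mul ht').mul_left (A j)).mul_left M)
      fun b ↦ ?_
    rw [norm_mul]
    exact mul_le_mul (bc j b) ((hbound j).1 _ (by positivity)) (norm_nonneg _) hM0

end EulerMaclaurin

namespace EulerMaclaurin

open Finset Filter Topology

theorem tsum_eq_tsum_fiber {α : Type*} {H v : α → ℝ} {φ : α → ℕ} {u : ℕ → ℝ} {T : ℕ → Finset α}
    (hH : Summable H) (hu : u 0 = 0) (hHv : ∀ p, H p = v p * u (φ p))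
    (hT : ∀ n ≠ 0, ∀ p ∈ T n, φ p = n) (hT' : ∀ p, φ p ≠ 0 → v p ≠ 0 → p ∈ T (φ p)) :
    ∑' p, H p = ∑' n, u n * ∑ p ∈ T n, v p := by
  rw [← (hH.hasSum.tsum_fiberwise φ).tsum_eq]
  refine tsum_congr fun n ↦ ?_
  have h1 : ∑' p : φ ⁻¹' {n}, H p = u n * ∑' p : φ ⁻¹' {n}, v p := by
    rw [← tsum_mul_left]
    refine tsum_congr fun p ↦ ?_
    rw [hHv, show φ p = n from p.2, mul_comm]
  rw [h1]
  rcases eq_or_ne n 0 with rfl | hn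
  · simp [hu]
  congr 1
  rw [tsum_subtype (φ ⁻¹' {n}) v, tsum_eq_sum (s := T n)]
  · refine sum_congr rfl fun p hp ↦ ?_
    rw [Set.indicator_of_mem]
    exact hT n hn p hp
  · intro p hp
    by_contra h
    have h2 : φ p = n := by
      by_contra h3
      exact h (Set.indicator_of_notMem (by simpa using h3) _)
    rw [Set.indicator_of_mem (by simpa using h2)] at h
    subst h2
    exact hp (hT' p hn h)

theorem summable_exp_mul_exp {a b : ℝ} (ha : 0 < a) (hb : 0 < b) :
    Summable fun p : ℕ × ℕ ↦ Real.exp (-(a * p.1)) * Real.exp (-(b * p.2)) :=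
  (summable_exp_neg_mul ha).mul_of_nonneg (summable_exp_neg_mul hb)
    (fun _ ↦ (Real.exp_pos _).le) fun _ ↦ (Real.exp_pos _).le

theorem exists_abs_le {q : ℕ} [NeZero q] (f : ZMod q → ℝ) : ∃ M, 0 ≤ M ∧ ∀ a, |f a| ≤ M :=
  ⟨∑ a, |f a|, sum_nonneg fun _ _ ↦ abs_nonneg _,
    fun a ↦ single_le_sum (f := fun a ↦ |f a|) (fun _ _ ↦ abs_nonneg _) (mem_univ a)⟩

variable {q : ℕ} [NeZero q] {f : ZMod q → ℝ}

theorem tsum_mul_eq_tsum_divisors (hf : f 0 = 0) {J : ℕ → ℝ} {M : ℝ} (hM : ∀ n, |J n| ≤ M) {t : ℝ}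
    (ht : 0 < t) :
    ∑' b : ℕ, J b * ∑' a : ℕ, f (a * b) * Real.exp (-(t * (a * b)))
      = ∑' n : ℕ, f n * Real.exp (-(t * n)) * ∑ d ∈ n.divisors, J d := by
  obtain ⟨M', hM0, hM'⟩ := exists_abs_le f
  have hs : Summable fun p : ℕ × ℕ ↦
      J p.1 * (f (p.2 * p.1) * Real.exp (-(t * (p.2 * p.1)))) := by
    refine Summable.of_norm_bounded
      ((summable_exp_mul_exp (half_pos ht) (half_pos ht)).mul_left (M * M')) fun p ↦ ?_
    obtain ⟨b, a⟩ := p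
    have hM0' : 0 ≤ M := (abs_nonneg _).trans (hM 0)
    simp only [Real.norm_eq_abs]
    by_cases hab : a = 0 ∨ b = 0
    · rcases hab with rfl | rfl <;> simp [hf] <;> positivity
    push Not at hab
    rw [abs_mul, abs_mul, ← mul_assoc, ← Real.exp_add, Real.abs_exp]
    have ha : (1 : ℝ) ≤ a := by exact_mod_cast Nat.one_le_iff_ne_zero.mpr hab.1
    have hb : (1 : ℝ) ≤ b := by exact_mod_cast Nat.one_le_iff_ne_zero.mpr hab.2
    gcongr
    · exact hM b
    · exact hM' _
    · nlinarith [mul_nonneg (sub_nonneg.mpr ha) (sub_nonneg.mpr hb), mul_nonneg ht.le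
        (add_nonneg (mul_nonneg (by linarith : (0 : ℝ) ≤ a) (sub_nonneg.mpr hb))
          (mul_nonneg (by linarith : (0 : ℝ) ≤ b) (sub_nonneg.mpr ha)))]
  calc
    _ = ∑' b : ℕ, ∑' a : ℕ, J b * (f (a * b) * Real.exp (-(t * (a * b)))) := by
      simp_rw [tsum_mul_left]
    _ = ∑' p : ℕ × ℕ, J p.1 * (f (p.2 * p.1) * Real.exp (-(t * (p.2 * p.1)))) :=
      (hs.tsum_prod (f := fun p : ℕ × ℕ ↦
        J p.1 * (f (p.2 * p.1) * Real.exp (-(t * (p.2 * p.1)))))).symm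
    _ = ∑' n : ℕ, f n * Real.exp (-(t * n)) * ∑ p ∈ n.divisorsAntidiagonal, J p.1 := by
      refine tsum_eq_tsum_fiber (φ := fun p ↦ p.1 * p.2) hs (by simp [hf]) ?_ ?_ ?_
      · rintro ⟨b, a⟩
        push_cast
        simp only [mul_comm (a : ZMod q), mul_comm (a : ℝ)]
      · intro n _ p hp
        exact (Nat.mem_divisorsAntidiagonal.mp hp).1
      · intro p hp _
        exact Nat.mem_divisorsAntidiagonal.mpr ⟨rfl, hp⟩
    _ = _ := by
      exact tsum_congr fun n ↦ by rw [Nat.sum_divisorsAntidiagonal fun d _ ↦ J d]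

theorem tsum_form_eq_tsum_cone (hf : f 0 = 0) {k : ℕ} (hk : 0 < k) {t : ℝ} (ht : 0 < t) :
    ∑' x : ℕ, ∑ y ∈ range (k * x),
        f (form k x y) * Real.exp (-(t * ((x : ℝ) ^ 2 + k * x * y - y ^ 2)))
      = ∑' n : ℕ, f n * Real.exp (-(t * n)) * (UnitOrder.cone k n).ncard := by
  obtain ⟨M, hM0, hM⟩ := exists_abs_le f
  set H : ℕ × ℕ → ℝ := fun p ↦ if p.2 < k * p.1 then f (form k p.1 p.2) *
    Real.exp (-(t * ((p.1 : ℝ) ^ 2 + k * p.1 * p.2 - p.2 ^ 2))) else 0 with hH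
  have hk' : (0 : ℝ) < k := by exact_mod_cast hk
  have hs : Summable H := by
    refine Summable.of_norm_bounded
      ((summable_exp_mul_exp (half_pos ht) (by positivity : 0 < t / (2 * k))).mul_left M)
      fun p ↦ ?_
    obtain ⟨x, y⟩ := p
    simp only [hH]
    split_ifs with h
    · rw [Real.norm_eq_abs, abs_mul, Real.abs_exp, ← Real.exp_add]
      have h1 : (y : ℝ) ≤ k * x := by exact_mod_cast h.le
      have h2 : (x : ℝ) ≤ x ^ 2 := by exact_mod_cast Nat.le_self_pow two_ne_zero x
      have h3 : (y : ℝ) / k ≤ x := by rw [div_le_iff₀ hk']; linarith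
      have h4 : (0 : ℝ) ≤ y := Nat.cast_nonneg y
      gcongr
      · exact hM _
      · have h5 : x / 2 + y / k / 2 ≤ (x : ℝ) ^ 2 + k * x * y - y ^ 2 := by
          nlinarith [mul_nonneg h4 (sub_nonneg.mpr h1)]
        have h6 := mul_le_mul_of_nonneg_left h5 ht.le
        have h7 : t / (2 * k) * y = t * (y / k / 2) := by ring
        nlinarith
    · rw [norm_zero]
      positivity
  have hfin (n : ℕ) : (Prod.map Nat.cast Nat.cast ⁻¹' UnitOrder.cone k n : Set (ℕ × ℕ)).Finite :=
    (UnitOrder.finite_cone (by exact_mod_cast hk) n).preimage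
      (Nat.cast_injective.prodMap Nat.cast_injective).injOn
  calc
    _ = ∑' x : ℕ, ∑' y : ℕ, H (x, y) := by
      refine tsum_congr fun x ↦ ?_
      rw [tsum_eq_sum (s := range (k * x))]
      · exact sum_congr rfl fun y hy ↦ (if_pos (mem_range.mp hy)).symm
      · intro y hy
        exact if_neg (by simpa using hy)
    _ = ∑' p, H p := hs.tsum_prod.symm
    _ = ∑' n : ℕ, f n * Real.exp (-(t * n)) *
          ∑ p ∈ (hfin n).toFinset, if p.2 < k * p.1 then (1 : ℝ) else 0 := by
      have hQ : ∀ x y : ℕ, y < k * x → 0 ≤ (x : ℤ) ^ 2 + k * x * y - y ^ 2 := by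
        intro x y h
        have h1 : (y : ℤ) ≤ k * x := by exact_mod_cast h.le
        nlinarith [mul_nonneg (Nat.cast_nonneg (α := ℤ) y) (sub_nonneg.mpr h1), sq_nonneg (x : ℤ)]
      refine tsum_eq_tsum_fiber (φ := fun p ↦ ((p.1 : ℤ) ^ 2 + k * p.1 * p.2 - p.2 ^ 2).toNat) hs
        (by simp [hf]) ?_ ?_ ?_
      · rintro ⟨x, y⟩
        simp only [hH]
        split_ifs with h
        · have h1 := Int.toNat_of_nonneg (hQ x y h)
          have h2 := congrArg (Int.cast : ℤ → ZMod q) h1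
          have h3 := congrArg (Int.cast : ℤ → ℝ) h1
          push_cast at h2 h3
          rw [one_mul, h2, h3, form]
        · simp
      · intro n _ p hp
        have := ((hfin n).mem_toFinset.mp hp).2.2.2
        simp only [Prod.map_fst, Prod.map_snd] at this
        rw [this, Int.toNat_natCast]
      · rintro ⟨x, y⟩ hp hv
        have h : y < k * x := by
          by_contra h
          exact hv (if_neg h)
        refine (hfin _).mem_toFinset.mpr ⟨?_, ?_, ?_, ?_⟩
        · have : x ≠ 0 := by
            rintro rfl
            omega
          simp only [Prod.map_fst]
          omega
        · simp
        · simp only [Prod.map_fst, Prod.map_snd]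
          exact_mod_cast h
        · exact (Int.toNat_of_nonneg (hQ x y h)).symm
    _ = _ := by
      refine tsum_congr fun n ↦ ?_
      congr 1
      rw [sum_congr rfl fun p hp ↦ if_pos ?_, sum_const, nsmul_one,
        ← Set.ncard_preimage_of_injective_subset_range
          (Nat.cast_injective.prodMap Nat.cast_injective : Function.Injective
            (Prod.map (Nat.cast : ℕ → ℤ) (Nat.cast : ℕ → ℤ))), Set.ncard_eq_toFinset_card _ (hfin n)]
      · rintro ⟨x, y⟩ ⟨h1, h2, -⟩
        exact ⟨(x.toNat, y.toNat), by
          simp only [Prod.map, Int.toNat_of_nonneg h2, Int.toNat_of_nonneg h1.le]⟩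
      · have := ((hfin n).mem_toFinset.mp hp).2.2.1
        simp only [Prod.map_fst, Prod.map_snd] at this
        exact_mod_cast this

end EulerMaclaurin

namespace EulerMaclaurin

open Finset Filter Topology

/-- Sums of an odd quadratic character over an arithmetic progression vanish. -/
theorem sum_jacobiSym_eq_zero {q D : ℕ} [NeZero q] (hD : Odd D) (hq : q.Coprime D)
    (h2 : jacobiSym 2 D = -1) (j : ZMod q) :
    ∑ b ∈ range (q * D), (if (b : ZMod q) = j then (jacobiSym b D : ℝ) else 0) = 0 := by
  have : NeZero D := ⟨by rintro rfl; simp at hD⟩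
  obtain ⟨u, hu1, hu2⟩ := Nat.chineseRemainder hq 1 2
  have hu : u.Coprime (q * D) := by
    refine Nat.Coprime.mul_right ?_ ?_
    · rw [Nat.Coprime, hu1.gcd_eq, Nat.gcd_one_left]
    · rw [Nat.Coprime, hu2.gcd_eq]
      exact Nat.coprime_two_left.mpr hD
  set F : ℕ → ℝ := fun b ↦ if (b : ZMod q) = j then (jacobiSym b D : ℝ) else 0 with hF
  have hFN (b : ℕ) : F (b % (q * D)) = F b := by
    have h3 : ((b % (q * D) : ℕ) : ZMod q) = b := by
      rw [ZMod.natCast_eq_natCast_iff]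
      exact (Nat.mod_modEq b (q * D)).of_mul_right D
    have h4 : jacobiSym ((b % (q * D) : ℕ) : ℤ) D = jacobiSym b D := by
      refine jacobiSym.mod_left' ?_
      exact_mod_cast (Nat.mod_modEq b (q * D)).of_mul_left q
    simp only [hF, h3, h4]
  have hFu (b : ℕ) : F (u * b) = -F b := by
    have h3 : ((u * b : ℕ) : ZMod q) = b := by
      rw [Nat.cast_mul, (ZMod.natCast_eq_natCast_iff _ _ _).mpr hu1, Nat.cast_one, one_mul]
    have h4 : jacobiSym ((u * b : ℕ) : ℤ) D = -jacobiSym b D := by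
      rw [Nat.cast_mul, jacobiSym.mul_left,
        jacobiSym.mod_left' (a₁ := u) (a₂ := 2) (by exact_mod_cast hu2), h2, neg_one_mul]
    simp only [hF, h3, h4]
    split_ifs <;> simp
  have h5 : ∑ b ∈ range (q * D), F b = ∑ z : ZMod (q * D), F z.val :=
    sum_range_eq_sum_zmod fun _ b ↦ F b
  have h6 : ∑ z : ZMod (q * D), F (ZMod.val ((ZMod.unitOfCoprime u hu : ZMod (q * D)) * z))
      = ∑ z : ZMod (q * D), F z.val :=
    Equiv.sum_comp (Units.mulLeft (ZMod.unitOfCoprime u hu)) fun z ↦ F z.val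
  have h7 (z : ZMod (q * D)) : F (ZMod.val ((ZMod.unitOfCoprime u hu : ZMod (q * D)) * z)) = -F z.val := by
    rw [ZMod.coe_unitOfCoprime, ZMod.val_mul, hFN, ZMod.val_natCast, ← hFN, Nat.mod_mul_mod, hFN,
      hFu]
  simp only [h7, sum_neg_distrib] at h6
  change ∑ b ∈ range (q * D), F b = 0
  linarith

theorem two_mul_double_sum_eq {q k : ℕ} [NeZero q] (hk : 0 < k) (hodd : Odd k)
    (hP : UnitOrder.PrincipalNorms k) (hq : q.Coprime (k ^ 2 + 4)) {f : ZMod q → ℝ}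
    (hf : ∀ a, f (-a) = -f a) :
    2 * ∑ b ∈ range (q * (k ^ 2 + 4)), ∑ a ∈ range q,
        (a * b * (jacobiSym b (k ^ 2 + 4) * f (a * b)) : ℝ)
      = (k ^ 2 + 4) * (∑ x, ∑ y, f (form k x y) * (sawtooth x * sawtooth y)
        - 2 * k * ∑ x : ZMod q, ∑ y, f (form k x y) * ((x.val : ℝ) ^ 2 - q * x.val)) := by
  have hD0 : k ^ 2 + 4 ≠ 0 := by omega
  have hf0 : f 0 = 0 := by
    have := hf 0
    rw [neg_zero] at this
    linarith
  have hDabs : ((k : ℤ) ^ 2 + 4).natAbs = k ^ 2 + 4 := by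
    rw [← Int.natCast_inj, Int.natAbs_of_nonneg (by positivity)]
    push_cast
    rfl
  have hoddZ : Odd (k : ℤ) := by exact_mod_cast hodd
  have hqD : q * (k ^ 2 + 4) ≠ 0 := mul_ne_zero (NeZero.ne q) hD0
  set J : ℕ → ℝ := fun b ↦ jacobiSym b (k ^ 2 + 4) with hJ
  have hM (n : ℕ) : |J n| ≤ 1 := by
    simp only [hJ]
    rcases jacobiSym.trichotomy n (k ^ 2 + 4) with h | h | h <;> simp [h]
  have h1 := tendsto_double_sum (J := J) hqD (Dvd.intro _ rfl) hf
    (fun n ↦ by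
      simp only [hJ]
      congr 1
      refine jacobiSym.mod_left' ?_
      push_cast
      rw [← mul_comm ((k : ℤ) ^ 2 + 4), Int.add_mul_emod_self_left]) hM
    (sum_jacobiSym_eq_zero
      (Nat.odd_iff.mpr (by have := UnitOrder.natAbs_discr_mod_eight hoddZ; omega)) hq
      (hDabs ▸ UnitOrder.jacobiSym_two_discr hoddZ))
  have h2 := tendsto_form_sum hf k
  have h3 : ∀ t : ℝ, 0 < t → ∑' b : ℕ, J b * ∑' a : ℕ, f (a * b) * Real.exp (-(t * (a * b)))
      = ∑' x : ℕ, ∑ y ∈ range (k * x),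
        f (form k x y) * Real.exp (-(t * ((x : ℝ) ^ 2 + k * x * y - y ^ 2))) := by
    intro t ht
    rw [tsum_mul_eq_tsum_divisors hf0 hM ht, tsum_form_eq_tsum_cone hf0 hk ht]
    refine tsum_congr fun n ↦ ?_
    rcases eq_or_ne n 0 with rfl | hn
    · simp [hf0]
    have := UnitOrder.ncard_cone_eq_sum_jacobiSym (by exact_mod_cast hk) hoddZ hP hn
    rw [hDabs] at this
    simp only [hJ]
    rw [← Int.cast_natCast (R := ℝ) (Set.ncard _), this]
    push_cast
    rfl
  have h3' := eventually_nhdsWithin_of_forall (s := Set.Ioi 0) (a := 0) h3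
  have h4 := tendsto_nhds_unique (h1.congr' h3') h2
  have hq0 : (q : ℝ) ≠ 0 := Nat.cast_ne_zero.mpr (NeZero.ne q)
  have hD1 : (k : ℝ) ^ 2 + 4 ≠ 0 := by positivity
  push_cast at h4
  rw [div_eq_div_iff (by positivity) (by positivity)] at h4
  refine mul_left_cancel₀ (pow_ne_zero 2 hq0) ?_
  linear_combination h4

end EulerMaclaurin

namespace EulerMaclaurin

open Finset

theorem intCast_sawtooth {q : ℕ} [NeZero q] {R : Type*} [Ring R] (a : ZMod q) :
    ((sawtooth a : ℤ) : R) = sawtooth a := by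
  unfold sawtooth
  split_ifs <;> simp

theorem form_eq_of_natCast_eq {q k a : ℕ} (h : (k : ZMod q) = a) : form (q := q) k = form a := by
  funext x y
  simp only [form, h]

theorem form_eq_of_natCast_eq_neg {q k a : ℕ} (h : (k : ZMod q) = -a) (x y : ZMod q) :
    form k x y = form a x (-y) := by
  simp only [form, h]
  ring

section

variable {q : ℕ} [NeZero q] {R : Type*} [CommRing R]

/-- The sum of an odd function of the quadratic form weighted by two sawtooth factors. -/
def sawtoothSum (χ : ZMod q → R) (k : ℕ) : R :=
  ∑ x, ∑ y, χ (form k x y) * (sawtooth x * sawtooth y)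

/-- The sum of an odd function of the quadratic form weighted by the second Bernoulli
polynomial, up to normalisation. -/
def squareSum (χ : ZMod q → R) (k : ℕ) : R :=
  ∑ x : ZMod q, ∑ y, χ (form k x y) * ((x.val : R) ^ 2 - q * x.val)

theorem sawtoothSum_of_eq_neg {k a : ℕ} (h : (k : ZMod q) = -a) (χ : ZMod q → R) :
    sawtoothSum χ k = -sawtoothSum χ a := by
  unfold sawtoothSum
  simp only [form_eq_of_natCast_eq_neg h, ← sum_neg_distrib]
  refine sum_congr rfl fun x _ ↦ ?_
  rw [← Equiv.sum_comp (Equiv.neg _)]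
  refine sum_congr rfl fun y _ ↦ ?_
  simp only [Equiv.neg_apply, neg_neg, sawtooth_neg]
  ring

theorem squareSum_of_eq_neg {k a : ℕ} (h : (k : ZMod q) = -a) (χ : ZMod q → R) :
    squareSum χ k = squareSum χ a := by
  unfold squareSum
  simp only [form_eq_of_natCast_eq_neg h]
  refine sum_congr rfl fun x _ ↦ ?_
  rw [← Equiv.sum_comp (Equiv.neg _)]
  simp only [Equiv.neg_apply, neg_neg]

end

theorem sawtoothSum_eq {q k : ℕ} [NeZero q] {r : ℕ} [Fact r.Prime] (hk : 0 < k) (hodd : Odd k)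
    (hP : UnitOrder.PrincipalNorms k) (hq : q.Coprime (k ^ 2 + 4)) (hr : r.Coprime (k ^ 2 + 4))
    (hr2 : r ≠ 2) {χ : ZMod q → ZMod r} (hmul : ∀ a b, χ (a * b) = χ a * χ b)
    (hneg : ∀ a, χ (-a) = -χ a) (hsum : ∑ a ∈ range q, (a : ZMod r) * χ a = 0) :
    sawtoothSum χ k = 2 * k * squareSum χ k := by
  set g : ZMod q → ℤ := fun a ↦ (χ a).val with hg
  set F : ZMod q → ℤ := fun a ↦ g a - g (-a) with hF
  have hgχ (a : ZMod q) : (g a : ZMod r) = χ a := by simp [hg]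
  have hFχ (a : ZMod q) : (F a : ZMod r) = 2 * χ a := by
    simp only [hF, Int.cast_sub, hgχ, hneg]
    ring
  have h1 := two_mul_double_sum_eq hk hodd hP hq (f := fun a ↦ (F a : ℝ)) fun a ↦ by
    simp only [hF, neg_neg]
    push_cast
    ring
  have h2 : 2 * ∑ b ∈ range (q * (k ^ 2 + 4)), ∑ a ∈ range q,
        ((a : ℤ) * b * (jacobiSym b (k ^ 2 + 4) * F (a * b)) : ℤ)
      = (k ^ 2 + 4) * (∑ x, ∑ y, F (form k x y) * (sawtooth x * sawtooth y)
        - 2 * k * ∑ x : ZMod q, ∑ y, F (form k x y) * ((x.val : ℤ) ^ 2 - q * x.val)) := by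
    simp only [← intCast_sawtooth (R := ℝ)] at h1
    exact_mod_cast h1
  have h3 := congrArg (Int.cast : ℤ → ZMod r) h2
  push_cast at h3
  simp only [intCast_sawtooth, hFχ, hmul] at h3
  have h4 : ∑ b ∈ range (q * (k ^ 2 + 4)), ∑ a ∈ range q,
      ((a : ZMod r) * b * (jacobiSym b (k ^ 2 + 4) * (2 * (χ a * χ b)))) = 0 := by
    refine sum_eq_zero fun b _ ↦ ?_
    rw [← mul_zero (2 * b * jacobiSym b (k ^ 2 + 4) * χ b), ← hsum, mul_sum]
    exact sum_congr rfl fun a _ ↦ by ring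
  have h5 : (2 : ZMod r) ≠ 0 := by
    intro h
    have : ((2 : ℕ) : ZMod r) = 0 := by exact_mod_cast h
    rw [ZMod.natCast_eq_zero_iff, Nat.prime_dvd_prime_iff_eq Fact.out Nat.prime_two] at this
    exact hr2 this
  have h6 : (k : ZMod r) ^ 2 + 4 ≠ 0 := by
    intro h
    have : ((k ^ 2 + 4 : ℕ) : ZMod r) = 0 := by exact_mod_cast h
    rw [ZMod.natCast_eq_zero_iff] at this
    exact (Fact.out : r.Prime).one_lt.ne' (Nat.eq_one_of_dvd_coprimes hr dvd_rfl this)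
  rw [h4, mul_zero] at h3
  have h7 := (mul_eq_zero.mp h3.symm).resolve_left h6
  have h8 : (2 : ZMod r) * (sawtoothSum χ k - 2 * k * squareSum χ k) = 0 := by
    rw [← h7, sawtoothSum, squareSum, mul_sub, mul_left_comm, mul_sum, mul_sum (a := (2 : ZMod r))]
    simp only [mul_sum, mul_assoc]
  exact sub_eq_zero.mp ((mul_eq_zero.mp h8).resolve_left h5)

end EulerMaclaurin

namespace EulerMaclaurin

open Finset

/-- `∑ i < n, f i`, in a form suited to evaluation by the kernel. -/
def natSum (f : ℕ → ℕ) (n : ℕ) : ℕ := Nat.rec 0 (fun i s ↦ s + f i) n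

/-- `∀ i < n, p i`, in a form suited to evaluation by the kernel. -/
def natAll (p : ℕ → Bool) (n : ℕ) : Bool := Nat.rec true (fun i s ↦ p i && s) n

theorem natSum_eq (f : ℕ → ℕ) (n : ℕ) : natSum f n = ∑ i ∈ range n, f i := by
  induction n with
  | zero => rfl
  | succ n ih => rw [sum_range_succ, ← ih]; rfl

theorem natAll_iff {p : ℕ → Bool} {n : ℕ} : natAll p n = true ↔ ∀ i < n, p i = true := by
  induction n with
  | zero => simp [natAll]
  | succ n ih =>
    rw [show natAll p (n + 1) = (p n && natAll p n) from rfl, Bool.and_eq_true, ih,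
      Nat.forall_lt_succ_right, and_comm]

/-- The entry with index `n` of the table `T` of `w`-bit numbers. -/
def entry (w T n : ℕ) : ℕ := (T >>> (w * n)) % 2 ^ w

/-- The test that the table `T` is an odd multiplicative function modulo `q`, with values
modulo `r`, and that its first moment vanishes. -/
def checkCharacter (q r w T : ℕ) : Bool :=
  natAll (fun a ↦ natAll (fun b ↦
    (entry w T (a * b % q) % r).beq (entry w T a * entry w T b % r)) q) q &&
  ((entry w T (q - 1) + 1) % r).beq 0 &&
  (natSum (fun a ↦ a * entry w T a) q % r).beq 0

/-- A natural number congruent to `sawtooth x` modulo `r`. -/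
def sawtoothNat (q r x : ℕ) : ℕ := Nat.rec 0 (fun i _ ↦ 2 * (i + 1) + (r - 1) * q) x

/-- The value of the table `T` at the quadratic form. -/
def entryForm (q w T k x y : ℕ) : ℕ := entry w T ((x ^ 2 + k * x * y + (q - 1) * y ^ 2) % q)

/-- A natural number congruent to `sawtoothSum`. -/
def sawtoothSumNat (q r w T k : ℕ) : ℕ :=
  natSum (fun x ↦ sawtoothNat q r x *
    natSum (fun y ↦ entryForm q w T k x y * sawtoothNat q r y) q) q

/-- A natural number congruent to `squareSum`. -/
def squareSumNat (q r w T k : ℕ) : ℕ :=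
  natSum (fun x ↦ x * (x + (r - 1) * q) * natSum (fun y ↦ entryForm q w T k x y) q) q

/-- The test that the residue `a` modulo `q` determines the residue `c` modulo `r`. -/
def checkClass (q r w T a c : ℕ) : Bool :=
  (sawtoothSumNat q r w T a % r).beq (2 * c * squareSumNat q r w T a % r) &&
  !((squareSumNat q r w T a % r).beq 0)

/-- The function modulo `q` with values modulo `r` given by the table `T`. -/
def ofTable (q r w T : ℕ) (a : ZMod q) : ZMod r := (entry w T a.val : ℕ)

theorem ofTable_natCast {q r w T : ℕ} (a : ℕ) : ofTable q r w T a = (entry w T (a % q) : ℕ) := by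
  rw [ofTable, ZMod.val_natCast]

theorem natCast_pred_eq (n : ℕ) [NeZero n] : ((n - 1 : ℕ) : ZMod n) = -1 := by
  rw [Nat.cast_pred (NeZero.pos n), ZMod.natCast_self, zero_sub]

section

variable {q r w T : ℕ} [Fact r.Prime]

theorem sawtoothNat_cast {x : ℕ} (hx : x < q) :
    (sawtooth (x : ZMod q) : ZMod r) = (sawtoothNat q r x : ℕ) := by
  rcases x with _ | x
  · simp [sawtooth, sawtoothNat]
  · have h1 : ((x + 1 : ℕ) : ZMod q) ≠ 0 := by
      rw [Ne, ZMod.natCast_eq_zero_iff]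
      exact Nat.not_dvd_of_pos_of_lt x.succ_pos hx
    rw [sawtooth, if_neg h1, ZMod.val_natCast, Nat.mod_eq_of_lt hx, sawtoothNat]
    have := Fact.out (p := r.Prime)
    have : NeZero r := ⟨this.ne_zero⟩
    push_cast
    rw [natCast_pred_eq]
    ring

variable [NeZero q]

theorem ofTable_form (k x y : ℕ) :
    ofTable q r w T (form k x y) = (entryForm q w T k x y : ℕ) := by
  rw [entryForm, ← ofTable_natCast]
  congr 1
  push_cast
  rw [natCast_pred_eq, form]
  ring

theorem sawtoothSumNat_cast (k : ℕ) :
    sawtoothSum (ofTable q r w T) k = (sawtoothSumNat q r w T k : ℕ) := by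
  have h (g : ZMod q → ZMod r) : ∑ a, g a = ∑ i ∈ range q, g i := by
    rw [sum_range_eq_sum_zmod fun a _ ↦ g a]
  rw [sawtoothSum, sawtoothSumNat, natSum_eq, Nat.cast_sum, h]
  refine sum_congr rfl fun x hx ↦ ?_
  rw [natSum_eq, Nat.cast_mul, Nat.cast_sum, h, mul_sum]
  refine sum_congr rfl fun y hy ↦ ?_
  rw [ofTable_form, sawtoothNat_cast (mem_range.mp hx), sawtoothNat_cast (mem_range.mp hy)]
  push_cast
  ring

theorem squareSumNat_cast (k : ℕ) :
    squareSum (ofTable q r w T) k = (squareSumNat q r w T k : ℕ) := by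
  have : NeZero r := ⟨(Fact.out (p := r.Prime)).ne_zero⟩
  have h (g : ZMod q → ZMod r) : ∑ a, g a = ∑ i ∈ range q, g i := by
    rw [sum_range_eq_sum_zmod fun a _ ↦ g a]
  rw [squareSum, squareSumNat, natSum_eq, Nat.cast_sum, h]
  refine sum_congr rfl fun x hx ↦ ?_
  rw [natSum_eq, Nat.cast_mul, Nat.cast_sum, h, mul_sum]
  refine sum_congr rfl fun y hy ↦ ?_
  rw [ofTable_form, ZMod.val_natCast, Nat.mod_eq_of_lt (mem_range.mp hx)]
  push_cast
  rw [natCast_pred_eq]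
  ring

/-- A successful test transports residues of `k` up to sign from the modulus `q` to `r`. -/
theorem natCast_eq_or_eq_neg (hchar : checkCharacter q r w T = true) {a c : ℕ}
    (hclass : checkClass q r w T a c = true) {k : ℕ} (hk : 0 < k) (hodd : Odd k)
    (hP : UnitOrder.PrincipalNorms k) (hq : q.Coprime (k ^ 2 + 4)) (hr : r.Coprime (k ^ 2 + 4))
    (hr2 : r ≠ 2) (ha : (k : ZMod q) = a ∨ (k : ZMod q) = -a) :
    (k : ZMod r) = c ∨ (k : ZMod r) = -c := by
  simp only [checkCharacter, Bool.and_eq_true, natAll_iff, Nat.beq_eq, natSum_eq] at hchar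
  simp only [checkClass, Bool.and_eq_true, Nat.beq_eq, Bool.not_eq_true', ← Bool.not_eq_true]
    at hclass
  obtain ⟨⟨hmul, hneg⟩, hsum⟩ := hchar
  obtain ⟨h1, h2⟩ := hclass
  set χ := ofTable q r w T with hχ
  have hmul' (a b : ZMod q) : χ (a * b) = χ a * χ b := by
    have := (ZMod.natCast_eq_natCast_iff _ _ _).mpr (hmul _ a.val_lt _ b.val_lt)
    rwa [← ZMod.val_mul, Nat.cast_mul] at this
  have hneg1 : χ (-1) = -1 := by
    rw [← natCast_pred_eq, hχ, ofTable_natCast, Nat.mod_eq_of_lt (Nat.sub_one_lt (NeZero.ne q)),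
      eq_neg_iff_add_eq_zero]
    exact_mod_cast (ZMod.natCast_eq_zero_iff _ _).mpr (Nat.dvd_of_mod_eq_zero hneg)
  have hsum' : ∑ a ∈ range q, (a : ZMod r) * χ a = 0 := by
    rw [← (ZMod.natCast_eq_zero_iff _ _).mpr (Nat.dvd_of_mod_eq_zero hsum), Nat.cast_sum]
    refine sum_congr rfl fun a ha ↦ ?_
    rw [hχ, ofTable_natCast, Nat.mod_eq_of_lt (mem_range.mp ha), Nat.cast_mul]
  have h3 := sawtoothSum_eq hk hodd hP hq hr hr2 hmul'
    (fun a ↦ by rw [← neg_one_mul, hmul', hneg1, neg_one_mul]) hsum'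
  have h4 : sawtoothSum χ a = 2 * c * squareSum χ a := by
    rw [sawtoothSumNat_cast, squareSumNat_cast]
    exact_mod_cast (ZMod.natCast_eq_natCast_iff _ _ _).mpr h1
  have h5 : squareSum χ a ≠ 0 := by
    rw [squareSumNat_cast, Ne, ZMod.natCast_eq_zero_iff]
    exact fun h ↦ h2 (Nat.mod_eq_zero_of_dvd h)
  have h6 : (2 : ZMod r) ≠ 0 := by
    intro h
    have : ((2 : ℕ) : ZMod r) = 0 := by exact_mod_cast h
    rw [ZMod.natCast_eq_zero_iff, Nat.prime_dvd_prime_iff_eq Fact.out Nat.prime_two] at this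
    exact hr2 this
  rcases ha with ha | ha
  · left
    rw [sawtoothSum, squareSum, form_eq_of_natCast_eq ha] at h3
    change sawtoothSum χ a = 2 * k * squareSum χ a at h3
    refine mul_left_cancel₀ h6 (mul_right_cancel₀ h5 ?_)
    rw [← h3, h4]
  · right
    rw [sawtoothSum_of_eq_neg ha, squareSum_of_eq_neg ha, h4] at h3
    refine mul_left_cancel₀ h6 (mul_right_cancel₀ h5 ?_)
    linear_combination -h3

end

end EulerMaclaurin

namespace EulerMaclaurin

open Finset

/-- The table of a character modulo `175` with values modulo `61`. -/
def table175 : ℕ :=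
  11364764328760098566388278727821964741284687876518998430120772124624419486494397626084607237606880230388230746664754052001433028103210975247204990293657779142116750555999406387557694637495283609962808746197752924048962128513432921634057562723888285251319291943174251527362195046491664914304349453307613515852836155456

/-- The table of a character modulo `61` with values modulo `41`. -/
def table61 : ℕ :=
  94241168666230560125888714608702110093456283036505522868382815815090484083328038662249604705463559005287616576

/-- The table of a character modulo `61` with values modulo `1861`. -/
def table61' : ℕ :=
  8898428535830047744958004833210766275419269405014661271821939682995817432761022038839779472853312212989252938562153400126526140057105049487351484325064159611720038428558991786617516640696384028076410880

/-- Residues modulo `175` and the residues modulo `61` which they determine. -/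
def residues175 : List (ℕ × ℕ) :=
  [(3, 3), (8, 8), (13, 13), (17, 17), (18, 2), (22, 49), (27, 4), (32, 10), (38, 8),
    (43, 59), (48, 39), (52, 25), (53, 6), (57, 36), (62, 15), (67, 24), (73, 44), (78, 51), (83, 39), (87, 27)]

/-- Residues modulo `61` and the residues modulo `41` which they determine. -/
def residues61 : List (ℕ × ℕ) := [(2, 2), (6, 11), (10, 19), (13, 13), (24, 35), (51, 22), (59, 39)]

/-- Residues modulo `61` and the residues modulo `1861` which they determine. -/
def residues61' : List (ℕ × ℕ) := [(8, 8), (49, 463)]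

set_option maxRecDepth 10000 in
theorem checkCharacter_175 : checkCharacter 175 61 6 table175 = true := by decide +kernel

theorem checkCharacter_61 : checkCharacter 61 41 6 table61 = true := by decide +kernel

theorem checkCharacter_61' : checkCharacter 61 1861 11 table61' = true := by decide +kernel

set_option maxRecDepth 10000 in
theorem checkClass_175 : ∀ p ∈ residues175, checkClass 175 61 6 table175 p.1 p.2 = true :=
  List.all_eq_true.mp <| show
    residues175.all (fun p ↦ checkClass 175 61 6 table175 p.1 p.2) = true by decide +kernel

theorem checkClass_61 : ∀ p ∈ residues61, checkClass 61 41 6 table61 p.1 p.2 = true :=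
  List.all_eq_true.mp <| show
    residues61.all (fun p ↦ checkClass 61 41 6 table61 p.1 p.2) = true by decide +kernel

theorem checkClass_61' : ∀ p ∈ residues61', checkClass 61 1861 11 table61' p.1 p.2 = true :=
  List.all_eq_true.mp <| show
    residues61'.all (fun p ↦ checkClass 61 1861 11 table61' p.1 p.2) = true by decide +kernel

/-- The test for a root of `X ^ 2 - c * X - 1` modulo `l`. -/
def hasRoot (l c : ℕ) : Bool := !natAll (fun b ↦ !((b ^ 2 + (l - 1) * (c * b + 1)) % l).beq 0) l

theorem exists_root_of_hasRoot {l c k : ℕ} [NeZero l] (h : hasRoot l c = true)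
    (hk : (k : ZMod l) = c ∨ (k : ZMod l) = -c) : ∃ b : ℤ, (l : ℤ) ∣ b ^ 2 - k * b - 1 := by
  rw [hasRoot, Bool.not_eq_true', ← Bool.not_eq_true, natAll_iff] at h
  push Not at h
  obtain ⟨b, -, hb⟩ := h
  rw [ne_eq, Bool.not_eq_true, Bool.not_eq_false', Nat.beq_eq] at hb
  have h1 := (ZMod.natCast_eq_zero_iff _ _).mpr (Nat.dvd_of_mod_eq_zero hb)
  push_cast at h1
  rw [natCast_pred_eq] at h1
  rcases hk with hk | hk
  · refine ⟨b, (ZMod.intCast_zmod_eq_zero_iff_dvd _ _).mp ?_⟩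
    push_cast
    rw [hk]
    linear_combination h1
  · refine ⟨-b, (ZMod.intCast_zmod_eq_zero_iff_dvd _ _).mp ?_⟩
    push_cast
    rw [hk]
    linear_combination h1

theorem residues175_complete : ∀ a < 175, hasRoot 5 (a % 5) = true ∨ hasRoot 7 (a % 7) = true ∨
    ∃ p ∈ residues175, p.1 = a ∨ p.1 + a = 175 := by decide +kernel

theorem residues61_complete : ∀ p ∈ residues175, hasRoot 61 p.2 = true ∨
    (∃ p' ∈ residues61, p'.1 = p.2) ∨ ∃ p' ∈ residues61', p'.1 = p.2 := by decide +kernel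

theorem hasRoot_41 : ∀ p ∈ residues61, hasRoot 41 p.2 = true := by decide +kernel

theorem hasRoot_1861 : ∀ p ∈ residues61', hasRoot 1861 p.2 = true := by decide +kernel

theorem coprime_of_inert {l k : ℕ} (hl : l.Prime) (hl2 : l ≠ 2)
    (h : ¬ ∃ b : ℤ, (l : ℤ) ∣ b ^ 2 - k * b - 1) : l.Coprime (k ^ 2 + 4) := by
  rw [hl.coprime_iff_not_dvd]
  intro hd
  obtain ⟨c, hc⟩ : Odd l := hl.odd_of_ne_two hl2
  have hd' : (l : ℤ) ∣ k ^ 2 + 4 := by exact_mod_cast hd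
  have h4 : IsCoprime (l : ℤ) 4 :=
    Nat.isCoprime_iff_coprime.mpr ((Nat.coprime_pow_right_iff two_pos l 2).mpr
      ((Nat.coprime_primes hl Nat.prime_two).mpr hl2))
  refine h ⟨k * (c + 1), h4.dvd_of_dvd_mul_left ?_⟩
  have : 4 * ((k * (c + 1) : ℤ) ^ 2 - k * (k * (c + 1)) - 1) = l * (k ^ 2 * l) - (k ^ 2 + 4) := by
    rw [hc]
    push_cast
    ring
  rw [this]
  exact dvd_sub (dvd_mul_right _ _) hd'

/-- If all prime ideals dividing a rational prime which is not inert are principal, then one of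
five small primes is not inert. -/
theorem exists_prime_root {k : ℕ} (hk : 0 < k) (hodd : Odd k)
    (hP : UnitOrder.PrincipalNorms k) :
    ∃ l : ℕ, l.Prime ∧ l ≤ 1861 ∧ ∃ b : ℤ, (l : ℤ) ∣ b ^ 2 - k * b - 1 := by
  have p5 : Nat.Prime 5 := by norm_num
  have p7 : Nat.Prime 7 := by norm_num
  have p41 : Nat.Prime 41 := by norm_num
  have p61 : Nat.Prime 61 := by norm_num
  have p1861 : Nat.Prime 1861 := by norm_num
  by_contra! hcon
  have hin (l : ℕ) (hl : l.Prime) (h : l ≤ 1861) : ¬ ∃ b : ℤ, (l : ℤ) ∣ b ^ 2 - k * b - 1 := by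
    rintro ⟨b, hb⟩
    exact hcon l hl h b hb
  have h5 := hin 5 p5 (by norm_num)
  have h7 := hin 7 p7 (by norm_num)
  have h41 := hin 41 p41 (by norm_num)
  have h61 := hin 61 p61 (by norm_num)
  have h1861 := hin 1861 p1861 le_rfl
  have c5 := coprime_of_inert p5 (by norm_num) h5
  have c7 := coprime_of_inert p7 (by norm_num) h7
  have c41 := coprime_of_inert p41 (by norm_num) h41
  have c61 := coprime_of_inert p61 (by norm_num) h61
  have c1861 := coprime_of_inert p1861 (by norm_num) h1861
  have c175 : Nat.Coprime 175 (k ^ 2 + 4) := (c5.mul_left c5).mul_left c7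
  have : Fact (Nat.Prime 41) := ⟨p41⟩
  have : Fact (Nat.Prime 61) := ⟨p61⟩
  have : Fact (Nat.Prime 1861) := ⟨p1861⟩
  have hmod (n : ℕ) (hn : n ∣ 175) : (k : ZMod n) = (k % 175 % n : ℕ) := by
    rw [Nat.mod_mod_of_dvd _ hn, ZMod.natCast_mod]
  rcases residues175_complete (k % 175) (Nat.mod_lt _ (by norm_num)) with h | h | ⟨p, hp, h⟩
  · exact h5 (exists_root_of_hasRoot h (.inl (hmod 5 (by norm_num))))
  · exact h7 (exists_root_of_hasRoot h (.inl (hmod 7 (by norm_num))))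
  have hk175 : (k : ZMod 175) = p.1 ∨ (k : ZMod 175) = -p.1 := by
    rcases h with h | h
    · left
      rw [h, ZMod.natCast_mod]
    · right
      have := congrArg (Nat.cast : ℕ → ZMod 175) h
      rw [Nat.cast_add, ZMod.natCast_mod, ZMod.natCast_self] at this
      exact eq_neg_of_add_eq_zero_right this
  have hk61 := natCast_eq_or_eq_neg checkCharacter_175 (checkClass_175 p hp) hk hodd hP c175 c61
    (by norm_num) hk175
  rcases residues61_complete p hp with h | ⟨p', hp', h⟩ | ⟨p', hp', h⟩
  · exact h61 (exists_root_of_hasRoot h hk61)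
  · rw [← h] at hk61
    exact h41 (exists_root_of_hasRoot (hasRoot_41 p' hp')
      (natCast_eq_or_eq_neg checkCharacter_61 (checkClass_61 p' hp') hk hodd hP c61 c41
        (by norm_num) hk61))
  · rw [← h] at hk61
    exact h1861 (exists_root_of_hasRoot (hasRoot_1861 p' hp')
      (natCast_eq_or_eq_neg checkCharacter_61' (checkClass_61' p' hp') hk hodd hP c61 c1861
        (by norm_num) hk61))

end EulerMaclaurin

namespace UnitOrder

open QuadraticAlgebra

section arithmetic

variable {k : ℤ}

theorem norm_ne_of_lt (hk : 0 < k) {l : ℕ} (hl : l.Prime) (hlk : (l : ℤ) < k) (z : UnitOrder k) :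
    (norm z).natAbs ≠ l := by
  intro h
  have hz : norm z ≠ 0 := by
    intro h0
    rw [h0] at h
    exact hl.ne_zero (by simpa using h.symm)
  obtain ⟨w, -, hw, h1, h2, h3⟩ := exists_cone hk z hz
  rw [h, norm_eq] at hw
  rcases h2.eq_or_lt with h4 | h4
  · rw [← h4] at hw
    have h5 : IsSquare (l : ℤ) := ⟨w.re, by rw [← hw]; ring⟩
    exact (Nat.prime_iff_prime_int.mp hl).irreducible.not_isSquare h5
  · have h5 : 0 ≤ (w.im - 1) * (k * w.re - w.im - 1) := mul_nonneg (by omega) (by omega)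
    nlinarith [mul_le_mul_of_nonneg_left (show 1 ≤ w.re by omega) hk.le]

theorem not_dvd_of_principalNorms (hk : 0 < k) (hP : PrincipalNorms k) {l : ℕ} (hl : l.Prime)
    (hlk : (l : ℤ) < k) : ¬ ∃ b : ℤ, (l : ℤ) ∣ b ^ 2 - k * b - 1 := by
  intro h
  obtain ⟨z, hz⟩ := hP l hl h
  exact norm_ne_of_lt hk hl hlk z hz

theorem principalNorms_of_isPrincipalIdealRing [IsPrincipalIdealRing (UnitOrder k)] :
    PrincipalNorms k := by
  rintro l hl ⟨b, hb⟩
  set w : UnitOrder k := ω - (b : UnitOrder k) with hw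
  have hre : w.re = -b := by simp [hw]
  have him : w.im = 1 := by simp [hw]
  have hnorm : norm w = b ^ 2 - k * b - 1 := by
    rw [norm_eq, hre, him]
    ring
  obtain ⟨g, hg⟩ := (IsPrincipalIdealRing.principal
    (Ideal.span {(l : UnitOrder k), w})).principal
  rw [← Ideal.span] at hg
  have hl_unit : ¬ ((l : ℤ) ∣ 1) := fun h ↦ hl.one_lt.ne' (by
    have := Int.eq_one_of_dvd_one (by positivity) h
    exact_mod_cast this)
  have hdvd (z v : UnitOrder k) (h : z = (l : UnitOrder k) * v) : (l : ℤ) ∣ z.im := by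
    rw [h]
    exact ⟨v.im, by simp⟩
  obtain ⟨u, hu⟩ : g ∣ (l : UnitOrder k) := by
    rw [← Ideal.mem_span_singleton, ← hg]
    exact Ideal.subset_span (by simp)
  obtain ⟨v, hv⟩ : g ∣ w := by
    rw [← Ideal.mem_span_singleton, ← hg]
    exact Ideal.subset_span (by simp)
  have hN : (norm g).natAbs * (norm u).natAbs = l ^ 2 := by
    rw [← Int.natAbs_mul, ← map_mul, ← hu, QuadraticAlgebra.norm_natCast]
    simp [Int.natAbs_pow]
  obtain ⟨i, hi, hgi⟩ := (Nat.dvd_prime_pow hl).mp (Dvd.intro _ hN)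
  interval_cases i
  · exfalso
    have hgu : IsUnit g := isUnit_iff_norm_isUnit.mpr
      (Int.isUnit_iff_natAbs_eq.mpr (by simpa using hgi))
    have h1 : (1 : UnitOrder k) ∈ Ideal.span {(l : UnitOrder k), w} := by
      rw [hg, Ideal.span_singleton_eq_top.mpr hgu]
      trivial
    obtain ⟨s, t, hst⟩ := Ideal.mem_span_pair.mp h1
    obtain ⟨c, hc⟩ := hb
    have h2 : star w = (l : UnitOrder k) * (s * star w + t * (c : UnitOrder k)) := by
      have h3 : w * star w = (l : UnitOrder k) * (c : UnitOrder k) := by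
        rw [← algebraMap_norm_eq_mul_star, hnorm, hc]
        simp
      linear_combination t * h3 - star w * hst
    have h4 := hdvd _ _ h2
    rw [im_star, him] at h4
    exact hl_unit ((dvd_neg).mp h4)
  · exact ⟨g, by simpa using hgi⟩
  · exfalso
    rw [hgi] at hN
    have hu1 : (norm u).natAbs = 1 :=
      Nat.eq_of_mul_eq_mul_left (pow_pos hl.pos 2) (by rw [hN, mul_one])
    obtain ⟨u', hu'⟩ := isUnit_iff_norm_isUnit.mpr (Int.isUnit_iff_natAbs_eq.mpr hu1)
    have h1 : w = (l : UnitOrder k) * (↑u'⁻¹ * v) := by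
      rw [hv, hu, ← hu', mul_assoc, ← mul_assoc (u' : UnitOrder k), Units.mul_inv, one_mul]
    have h2 := hdvd _ _ h1
    rw [him] at h2
    exact hl_unit h2

end arithmetic

section field

open Polynomial NumberField

variable {k : ℤ} {K : Type*} [Field K] [NumberField K] {x : K}

theorem rat_sq_ne {D : ℤ} (hsf : Squarefree D) (hD : 1 < D) (t : ℚ) : t ^ 2 ≠ D := by
  intro h
  have h1 : IsSquare (D : ℚ) := ⟨t, by rw [← h, sq]⟩
  obtain ⟨s, hs⟩ := Rat.isSquare_intCast_iff.mp h1
  have h2 : IsUnit s := hsf s (Dvd.intro 1 (by rw [mul_one, hs]))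
  rcases Int.isUnit_iff.mp h2 with h3 | h3 <;> subst h3 <;> omega

theorem den_eq_one_of_squarefree {D n : ℤ} (hsf : Squarefree D) {w : ℚ} (h : D * w ^ 2 = n) :
    w.den = 1 := by
  have h1 : D * w.num ^ 2 = n * (w.den : ℤ) ^ 2 := by
    have h2 : (w.den : ℚ) ≠ 0 := by exact_mod_cast w.den_nz
    rw [← Rat.num_div_den w] at h
    field_simp at h
    rw [mul_comm n]
    exact_mod_cast h
  have h3 : IsCoprime ((w.den : ℤ) ^ 2) (w.num ^ 2) :=
    (Int.isCoprime_iff_gcd_eq_one.mpr (by simpa [Int.gcd] using w.reduced.symm)).pow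
  have h4 : (w.den : ℤ) ^ 2 ∣ D := h3.dvd_of_dvd_mul_right ⟨n, by rw [h1]; ring⟩
  have h5 := hsf (w.den : ℤ) (by rwa [← sq])
  simpa using Int.isUnit_iff_natAbs_eq.mp h5

theorem exists_eq_add_mul (hrank : Module.finrank ℚ K = 2) (hx : ∀ t : ℚ, (t : K) ≠ x) (z : K) :
    ∃ u v : ℚ, z = u + v * x := by
  have hli : LinearIndependent ℚ ![(1 : K), x] := by
    rw [LinearIndependent.pair_iff]
    intro s t h
    rw [Algebra.smul_def, Algebra.smul_def, mul_one, eq_ratCast, eq_ratCast] at h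
    have ht : t = 0 := by
      by_contra ht
      have ht' : (t : K) ≠ 0 := by exact_mod_cast ht
      refine hx (-s / t) ?_
      push_cast
      rw [div_eq_iff ht']
      linear_combination -h
    subst ht
    simpa using h
  have htop := hli.span_eq_top_of_card_eq_finrank' (by rw [hrank]; rfl)
  have hz : z ∈ Submodule.span ℚ (Set.range ![(1 : K), x]) := by rw [htop]; trivial
  simp only [Matrix.range_cons, Matrix.range_empty, Set.union_empty, Set.singleton_union] at hz
  obtain ⟨u, v, h⟩ := Submodule.mem_span_pair.mp hz
  refine ⟨u, v, ?_⟩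
  rw [← h, Algebra.smul_def, Algebra.smul_def, mul_one, eq_ratCast, eq_ratCast]

theorem exists_int_of_isIntegral {D : ℤ} (hsq : ∀ t : ℚ, t ^ 2 ≠ D) (hx : x ^ 2 = (D : K))
    {u v : ℚ} (hv : v ≠ 0) (hz : IsIntegral ℤ ((u : K) + v * x)) :
    ∃ m n : ℤ, 2 * u = m ∧ u ^ 2 - D * v ^ 2 = n := by
  set z : K := (u : K) + v * x
  set p : ℚ[X] := X ^ 2 + (C (-(2 * u)) * X + C (u ^ 2 - D * v ^ 2)) with hp
  have hdeg : (C (-(2 * u)) * X + C (u ^ 2 - D * v ^ 2)).degree < ((2 : ℕ) : WithBot ℕ) :=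
    lt_of_le_of_lt degree_linear_le (by norm_num)
  have hmonic : p.Monic := monic_X_pow_add hdeg
  have hnat : p.natDegree = 2 := by
    rw [hp]
    compute_degree!
  have hirr : Irreducible p := by
    rw [hmonic.irreducible_iff_roots_eq_zero_of_degree_le_three (by omega) (by omega),
      Multiset.eq_zero_iff_forall_notMem]
    intro t ht
    rw [mem_roots hmonic.ne_zero, IsRoot] at ht
    simp only [hp, eval_add, eval_mul, eval_pow, eval_X, eval_C] at ht
    refine hsq ((t - u) / v) ?_
    field_simp
    linear_combination ht
  have hroot : aeval z p = 0 := by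
    simp only [hp, map_add, map_mul, map_pow, aeval_X, aeval_C, eq_ratCast, z]
    push_cast
    linear_combination (v : K) ^ 2 * hx
  have hmin : minpoly ℚ z = p := (minpoly.eq_of_irreducible_of_monic hirr hroot hmonic).symm
  rw [minpoly.isIntegrallyClosed_eq_field_fractions' ℚ hz] at hmin
  have h0 := congrArg (fun f ↦ coeff f 0) hmin
  have h1 := congrArg (fun f ↦ coeff f 1) hmin
  simp only [hp, coeff_map, coeff_add, coeff_X_pow, coeff_C_mul, coeff_X, coeff_C,
    eq_intCast] at h0 h1
  norm_num at h0 h1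
  refine ⟨-(minpoly ℤ z).coeff 1, (minpoly ℤ z).coeff 0, ?_, h0.symm⟩
  push_cast
  linarith

theorem exists_ringEquiv (hsf : Squarefree (k ^ 2 + 4))
    (hrank : Module.finrank ℚ K = 2) (hx : x ^ 2 = ((k ^ 2 + 4 : ℤ) : K)) :
    Nonempty (UnitOrder k ≃+* 𝓞 K) := by
  have hsq := rat_sq_ne hsf (by nlinarith)
  have hxrat (t : ℚ) : (t : K) ≠ x := by
    rintro rfl
    exact hsq t (by exact_mod_cast hx)
  have h_int : IsIntegral ℤ (((k : K) + x) / 2) := by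
    refine ⟨X ^ 2 + (C (-k) * X + C (-1)), monic_X_pow_add
      (lt_of_le_of_lt degree_linear_le (by norm_num)), ?_⟩
    simp only [eval₂_add, eval₂_mul, eval₂_pow, eval₂_X, eval₂_C]
    simp only [eq_intCast]
    push_cast at hx ⊢
    linear_combination hx / 4
  set θ : 𝓞 K := ⟨((k : K) + x) / 2, h_int⟩ with hθ
  have hθK : (algebraMap (𝓞 K) K) θ = ((k : K) + x) / 2 := rfl
  have hθ2 : θ * θ = (1 : ℤ) • 1 + k • θ := by
    apply RingOfIntegers.ext
    simp only [map_mul, map_add, zsmul_eq_mul, map_intCast, map_one, hθK]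
    push_cast at hx ⊢
    linear_combination hx / 4
  set f : UnitOrder k →ₐ[ℤ] 𝓞 K := QuadraticAlgebra.lift ⟨θ, hθ2⟩ with hf
  have hfz (z : UnitOrder k) : algebraMap (𝓞 K) K (f z) = z.re + z.im * (((k : K) + x) / 2) := by
    rw [hf, QuadraticAlgebra.lift_apply_apply]
    simp [hθK]
  refine ⟨RingEquiv.ofBijective f ⟨?_, ?_⟩⟩
  · rw [injective_iff_map_eq_zero]
    intro z hz
    have h1 := hfz z
    rw [hz, map_zero] at h1
    have h2 : z.im = 0 := by
      by_contra h2
      have h2' : (z.im : K) ≠ 0 := by exact_mod_cast h2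
      refine hxrat (-(2 * z.re + z.im * k) / z.im) ?_
      push_cast
      rw [div_eq_iff h2']
      linear_combination 2 * h1
    rw [h2] at h1
    have h3 : z.re = 0 := by
      have : (z.re : K) = 0 := by simpa using h1.symm
      exact_mod_cast this
    exact QuadraticAlgebra.ext h3 h2
  · intro y
    obtain ⟨u, v, hy⟩ := exists_eq_add_mul hrank hxrat (y : K)
    have hyint : IsIntegral ℤ ((u : K) + v * x) := hy ▸ y.isIntegral_coe
    suffices h : ∃ m n : ℤ, u = m + n * k / 2 ∧ v = n / 2 by
      obtain ⟨m, n, rfl, rfl⟩ := h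
      refine ⟨⟨m, n⟩, RingOfIntegers.ext ?_⟩
      change algebraMap (𝓞 K) K (f ⟨m, n⟩) = (y : K)
      rw [hfz, hy]
      push_cast
      ring
    rcases eq_or_ne v 0 with rfl | hv
    · have h1 : IsIntegral ℤ u := by
        rw [← isIntegral_algebraMap_iff (algebraMap ℚ K).injective]
        simpa using hyint
      obtain ⟨m, hm⟩ := IsIntegrallyClosed.isIntegral_iff.mp h1
      exact ⟨m, 0, by simpa using hm.symm, by simp⟩
    · obtain ⟨m, n, hm, hn⟩ := exists_int_of_isIntegral hsq hx hv hyint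
      have h1 : ((k ^ 2 + 4 : ℤ) : ℚ) * (2 * v) ^ 2 = (m ^ 2 - 4 * n : ℤ) := by
        push_cast at hn ⊢
        rw [← hm, ← hn]
        ring
      have h2 := den_eq_one_of_squarefree hsf h1
      obtain ⟨w, hw⟩ : ∃ w : ℤ, 2 * v = w := ⟨(2 * v).num, (Rat.den_eq_one_iff _).mp h2 |>.symm⟩
      rw [hw] at h1
      have h3 : (k ^ 2 + 4) * w ^ 2 = m ^ 2 - 4 * n := by exact_mod_cast h1
      have h4 : Even (m - w * k) := by
        have h5 : Even (m ^ 2 - (w * k) ^ 2) := ⟨2 * n + 2 * w ^ 2, by linear_combination -h3⟩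
        rw [sq_sub_sq, Int.even_mul] at h5
        rcases h5 with h5 | h5
        · have : m - w * k = m + w * k - 2 * (w * k) := by ring
          rw [this]
          exact h5.sub (even_two_mul _)
        · exact h5
      obtain ⟨c, hc⟩ := h4
      have hc' : (m : ℚ) - w * k = c + c := by exact_mod_cast hc
      exact ⟨c, w, by linarith, by linarith⟩

end field

end UnitOrder

namespace UnitOrder

open EulerMaclaurin in
theorem exists_hasRoot_of_le : ∀ k ≤ 1861, k % 2 = 1 → k ∉ [1, 3, 5, 7, 13, 17] →
    ∃ l ∈ [3, 5, 7, 11, 13, 17, 19, 23, 29, 31], l < k ∧ hasRoot l (k % l) = true := by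
  decide +kernel

theorem mem_of_principalNorms {k : ℕ} (hk : 0 < k) (hodd : Odd k) (hP : PrincipalNorms (k : ℤ)) :
    k ∈ [1, 3, 5, 7, 13, 17] := by
  obtain ⟨l, hl, hle, hroot⟩ := EulerMaclaurin.exists_prime_root hk hodd hP
  have hk1861 : k ≤ 1861 := by
    by_contra! h
    exact not_dvd_of_principalNorms (by exact_mod_cast hk) hP hl
      (by exact_mod_cast lt_of_le_of_lt hle h) hroot
  by_contra hmem
  obtain ⟨p, hp, hpk, hpr⟩ := exists_hasRoot_of_le k hk1861 (Nat.odd_iff.mp hodd) hmem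
  have hprime : ∀ p ∈ [3, 5, 7, 11, 13, 17, 19, 23, 29, 31], p.Prime := by norm_num
  have : NeZero p := ⟨(hprime p hp).ne_zero⟩
  exact not_dvd_of_principalNorms (by exact_mod_cast hk) hP (hprime p hp) (by exact_mod_cast hpk)
    (EulerMaclaurin.exists_root_of_hasRoot hpr (.inl (by simp)))

open QuadraticAlgebra in
theorem dvd_of_dvd_norm {k : ℤ} {p : ℕ} (hp : p.Prime)
    (hinert : ¬ ∃ b : ℤ, (p : ℤ) ∣ b ^ 2 - k * b - 1) {z : UnitOrder k} (hz : (p : ℤ) ∣ norm z) :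
    (p : UnitOrder k) ∣ z := by
  have hpi := Nat.prime_iff_prime_int.mp hp
  rw [norm_eq] at hz
  have him : (p : ℤ) ∣ z.im := by
    by_contra him
    obtain ⟨s, t, hst⟩ := ((Prime.coprime_iff_not_dvd hpi).mpr him)
    refine hinert ⟨-z.re * t, ?_⟩
    obtain ⟨c, hc⟩ := hz
    refine ⟨c * t ^ 2 + (k * z.re * t - 1 - t * z.im) * s, ?_⟩
    linear_combination (t ^ 2) * hc - (k * z.re * t - 1 - t * z.im) * hst
  have hre : (p : ℤ) ∣ z.re := by
    refine hpi.dvd_of_dvd_pow (n := 2) ?_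
    obtain ⟨c, hc⟩ := hz
    obtain ⟨d, hd⟩ := him
    exact ⟨c - k * z.re * d + d * z.im, by rw [hd] at hc ⊢; linear_combination hc⟩
  obtain ⟨c, hc⟩ := hre
  obtain ⟨d, hd⟩ := him
  exact ⟨⟨c, d⟩, QuadraticAlgebra.ext (by simp [hc]) (by simp [hd])⟩

open NumberField QuadraticAlgebra

section

variable {k : ℤ} {K : Type*} [Field K]

theorem isPrincipal_of_inert (e : UnitOrder k ≃+* 𝓞 K) {p : ℕ} (hp : p.Prime)
    (hinert : ¬ ∃ b : ℤ, (p : ℤ) ∣ b ^ 2 - k * b - 1) {P : Ideal (𝓞 K)}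
    (hP : P ∈ Ideal.primesOver (Ideal.span {(p : ℤ)}) (𝓞 K)) : P.IsPrincipal := by
  obtain ⟨-, hover⟩ := hP
  have hmem (n : ℤ) : (n : 𝓞 K) ∈ P ↔ (p : ℤ) ∣ n := by
    rw [← Ideal.mem_span_singleton, hover.over, Ideal.under_def, Ideal.mem_comap, eq_intCast]
  refine ⟨(p : 𝓞 K), le_antisymm (fun y hy ↦ ?_) ?_⟩
  · obtain ⟨z, rfl⟩ := e.surjective y
    have h1 : ((norm z : ℤ) : 𝓞 K) = e z * e (star z) := by
      rw [← map_mul, ← algebraMap_norm_eq_mul_star]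
      simp
    have h2 : (p : ℤ) ∣ norm z := by
      rw [← hmem, h1]
      exact P.mul_mem_right _ hy
    obtain ⟨w, rfl⟩ := dvd_of_dvd_norm hp hinert h2
    rw [map_mul, map_natCast]
    exact Ideal.mem_span_singleton.mpr (dvd_mul_right _ _)
  · rw [Submodule.span_singleton_le_iff_mem]
    simpa using hmem (p : ℤ)

theorem basis_zero : basis (1 : ℤ) k 0 = 1 := by
  apply (basis (1 : ℤ) k).repr.injective
  ext i
  fin_cases i <;> simp

theorem basis_one : basis (1 : ℤ) k 1 = omega := by
  apply (basis (1 : ℤ) k).repr.injective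
  ext i
  fin_cases i <;> simp

theorem trace_eq (z : UnitOrder k) : Algebra.trace ℤ (UnitOrder k) z = 2 * z.re + k * z.im := by
  rw [Algebra.trace_eq_matrix_trace (basis 1 k), Matrix.trace_fin_two,
    Algebra.leftMulMatrix_eq_repr_mul, Algebra.leftMulMatrix_eq_repr_mul]
  simp [basis_zero, basis_one]
  ring

variable [NumberField K]

theorem discr_eq (e : UnitOrder k ≃+* 𝓞 K) : discr K = k ^ 2 + 4 := by
  let e' : UnitOrder k ≃ₐ[ℤ] 𝓞 K := AlgEquiv.ofRingEquiv (f := e) (by simp)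
  rw [← discr_eq_discr K ((basis 1 k).map e'.toLinearEquiv), Algebra.discr_def,
    Matrix.det_fin_two]
  simp only [Algebra.traceMatrix_apply, Algebra.traceForm_apply, Module.Basis.map_apply,
    AlgEquiv.toLinearEquiv_apply, ← map_mul, Algebra.trace_eq_of_algEquiv, trace_eq,
    basis_zero, basis_one]
  simp
  ring

theorem isPrincipalIdealRing_of_inert (e : UnitOrder k ≃+* 𝓞 K) (hrank : Module.finrank ℚ K = 2)
    {n : ℕ} (hn : (16 * (k ^ 2 + 4) : ℝ) < (6 * n) ^ 2)
    (h : ∀ p < n, p.Prime → ¬ ∃ b : ℤ, (p : ℤ) ∣ b ^ 2 - k * b - 1) :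
    IsPrincipalIdealRing (𝓞 K) := by
  refine RingOfIntegers.isPrincipalIdealRing_of_isPrincipal_of_pow_le_of_mem_primesOver_of_mem_Icc
    fun p hpmem hp P hP _ ↦ isPrincipal_of_inert e hp (h p ?_ hp) hP
  refine lt_of_le_of_lt (Finset.mem_Icc.mp hpmem).2 ?_
  rw [Nat.floor_lt (by positivity), hrank, discr_eq e]
  have hc : InfinitePlace.nrComplexPlaces K ≤ 1 := by
    have := InfinitePlace.card_add_two_mul_card_eq_rank K
    omega
  have hpi : (4 / Real.pi) ^ InfinitePlace.nrComplexPlaces K ≤ 4 / 3 := by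
    have h1 : 4 / Real.pi ≤ 4 / 3 := by
      gcongr
      exact Real.pi_gt_three.le
    interval_cases InfinitePlace.nrComplexPlaces K <;> norm_num [h1]
  have hs : √|((k ^ 2 + 4 : ℤ) : ℝ)| < 6 * n / 4 := by
    rw [abs_of_nonneg (by push_cast; positivity), Real.sqrt_lt' ?_]
    · push_cast
      linarith
    · have : (0 : ℝ) < n := by
        rcases n.eq_zero_or_pos with rfl | h
        · have := sq_nonneg (k : ℝ)
          norm_num at hn
          linarith
        · exact_mod_cast h
      positivity
  calc _ ≤ 4 / 3 * ((2 : ℕ).factorial / (2 : ℕ) ^ 2 * √|((k ^ 2 + 4 : ℤ) : ℝ)|) := by gcongr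
    _ < n := by
      norm_num [Nat.factorial] at hs ⊢
      linarith

end

end UnitOrder

/-- Biró's theorem (Theorem 4.5): for odd `k > 0` with `D = k² + 4` square-free, the
class number of `ℚ(√D)` is `1` iff `k ∈ {1, 3, 5, 7, 13, 17}`. Here `ℚ(√D)` is
formalized as any number field of degree `2` over `ℚ` containing a square root of `D`. -/
theorem stmt12 (k : ℤ) (hk : 0 < k) (hodd : Odd k)
    (D : ℤ) (hD : D = k ^ 2 + 4) (hsf : Squarefree D)
    (K : Type) [Field K] [NumberField K]
    (hrank : Module.finrank ℚ K = 2) (hroot : ∃ x : K, x ^ 2 = (D : K)) :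
    NumberField.classNumber K = 1 ↔
      k = 1 ∨ k = 3 ∨ k = 5 ∨ k = 7 ∨ k = 13 ∨ k = 17 := by
  subst hD
  obtain ⟨x, hx⟩ := hroot
  obtain ⟨e⟩ := UnitOrder.exists_ringEquiv hsf hrank hx
  rw [NumberField.classNumber_eq_one_iff]
  constructor
  · intro h
    have : IsPrincipalIdealRing (UnitOrder k) :=
      IsPrincipalIdealRing.of_surjective (e.symm : NumberField.RingOfIntegers K →+* UnitOrder k)
        e.symm.surjective
    lift k to ℕ using hk.le
    have := UnitOrder.mem_of_principalNorms (by exact_mod_cast hk) (by exact_mod_cast hodd)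
      (UnitOrder.principalNorms_of_isPrincipalIdealRing (k := k))
    simp only [List.mem_cons, List.not_mem_nil, or_false] at this
    exact_mod_cast this
  · have key (n : ℕ) (hn : (16 * (k ^ 2 + 4) : ℝ) < (6 * n) ^ 2)
        (h : ∀ p < n, p.Prime → ∀ b : ZMod p, b ^ 2 - k * b - 1 ≠ 0) :
        IsPrincipalIdealRing (NumberField.RingOfIntegers K) := by
      refine UnitOrder.isPrincipalIdealRing_of_inert e hrank hn fun p hpn hp ⟨b, hb⟩ ↦ ?_
      refine h p hpn hp b ?_
      exact_mod_cast (ZMod.intCast_zmod_eq_zero_iff_dvd _ p).mpr hb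
    rintro (rfl | rfl | rfl | rfl | rfl | rfl)
    · exact key 2 (by norm_num) (by intro p hp h; interval_cases p <;> norm_num at h)
    · exact key 3 (by norm_num) fun p hp h ↦ by
        interval_cases p <;> first | (norm_num at h; done) | decide
    · exact key 5 (by norm_num) fun p hp h ↦ by
        interval_cases p <;> first | (norm_num at h; done) | decide
    · exact key 5 (by norm_num) fun p hp h ↦ by
        interval_cases p <;> first | (norm_num at h; done) | decide
    · exact key 11 (by norm_num) fun p hp h ↦ by
        interval_cases p <;> first | (norm_num at h; done) | decide
    · exact key 13 (by norm_num) fun p hp h ↦ by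
        interval_cases p <;> first | (norm_num at h; done) | decide
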